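/- arXiv:2211.14908 — 3 statements merged into one kernel-verified Lean document; each statement's English description precedes it below -/
import Mathlib

section
/- Fixed kernel and fixed null distribution asymptotic normality (Theorem 1/prop:simple-asymptotic-normality): Suppose the feature map φ (hence the kernel k) and the distribution P do not change with n, and both samples are drawn i.i.d. from P (the null hypothesis P = Q). If 0 < E[k̄(X,X')⁴] < ∞ for X, X' i.i.d. P, then the studentized cross-MMD statistic x̄MMD² converges in distribution to the standard normal distribution N(0,1) as n → ∞. -/
open MeasureTheory ProbabilityTheory Filter
open scoped ENNReal NNReal RealInnerProductSpace Topology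

noncomputable section

namespace CrossMMD

variable {𝒳 : Type*} [MeasurableSpace 𝒳]
variable {H : Type*} [NormedAddCommGroup H] [InnerProductSpace ℝ H] [CompleteSpace H]

/-- The kernel mean embedding `μ_P = ∫ φ(x) dP(x)` of a measure `P` under the feature map `φ`. -/
def meanEmb (φ : 𝒳 → H) (P : Measure 𝒳) : H := ∫ x, φ x ∂P

/-- The centered kernel `k̄(x,y) = ⟪φ(x) − μ_P, φ(y) − μ_P⟫`. -/
def kbar (φ : 𝒳 → H) (P : Measure 𝒳) (x y : 𝒳) : ℝ :=
  ⟪φ x - meanEmb φ P, φ y - meanEmb φ P⟫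

/-- Empirical mean embedding of the first half of a sample of size `n`
(the first `⌊n/2⌋` points). -/
def empMean1 (φ : 𝒳 → H) {n : ℕ} (xs : Fin n → 𝒳) : H :=
  ((n / 2 : ℕ) : ℝ)⁻¹ • ∑ i ∈ Finset.univ.filter (fun i : Fin n => (i : ℕ) < n / 2), φ (xs i)

/-- Empirical mean embedding of the second half of a sample of size `n`
(the last `n − ⌊n/2⌋` points). -/
def empMean2 (φ : 𝒳 → H) {n : ℕ} (xs : Fin n → 𝒳) : H :=
  ((n - n / 2 : ℕ) : ℝ)⁻¹ • ∑ i ∈ Finset.univ.filter (fun i : Fin n => n / 2 ≤ (i : ℕ)), φ (xs i)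

/-- The joint law of two mutually independent i.i.d. samples, of sizes `n` from `P`
and `m` from `Q`. -/
def sampleMeasure (P Q : Measure 𝒳) (n m : ℕ) : Measure ((Fin n → 𝒳) × (Fin m → 𝒳)) :=
  (Measure.pi fun _ : Fin n => P).prod (Measure.pi fun _ : Fin m => Q)

/-- The cross-MMD statistic `xMMD² = ⟪μ̂₁ − ν̂₁, μ̂₂ − ν̂₂⟫`. -/
def xMMD2 (φ : 𝒳 → H) {n m : ℕ} (ω : (Fin n → 𝒳) × (Fin m → 𝒳)) : ℝ :=
  ⟪empMean1 φ ω.1 - empMean1 φ ω.2, empMean2 φ ω.1 - empMean2 φ ω.2⟫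

/-- `U_{X,i} = ⟪φ(X_i), μ̂₂ − ν̂₂⟫`. -/
def UX (φ : 𝒳 → H) {n m : ℕ} (ω : (Fin n → 𝒳) × (Fin m → 𝒳)) (i : Fin n) : ℝ :=
  ⟪φ (ω.1 i), empMean2 φ ω.1 - empMean2 φ ω.2⟫

/-- `U_{Y,j} = ⟪φ(Y_j), μ̂₂ − ν̂₂⟫`. -/
def UY (φ : 𝒳 → H) {n m : ℕ} (ω : (Fin n → 𝒳) × (Fin m → 𝒳)) (j : Fin m) : ℝ :=
  ⟪φ (ω.2 j), empMean2 φ ω.1 - empMean2 φ ω.2⟫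

/-- The empirical variance `σ̂_X² = n₁⁻¹ Σ_{i≤n₁} (U_{X,i} − Ū_X)²`. -/
def sigmaHatX2 (φ : 𝒳 → H) {n m : ℕ} (ω : (Fin n → 𝒳) × (Fin m → 𝒳)) : ℝ :=
  ((n / 2 : ℕ) : ℝ)⁻¹ *
    ∑ i ∈ Finset.univ.filter (fun i : Fin n => (i : ℕ) < n / 2),
      (UX φ ω i - ((n / 2 : ℕ) : ℝ)⁻¹ *
        ∑ l ∈ Finset.univ.filter (fun l : Fin n => (l : ℕ) < n / 2), UX φ ω l) ^ 2

/-- The empirical variance `σ̂_Y² = m₁⁻¹ Σ_{j≤m₁} (U_{Y,j} − Ū_Y)²`. -/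
def sigmaHatY2 (φ : 𝒳 → H) {n m : ℕ} (ω : (Fin n → 𝒳) × (Fin m → 𝒳)) : ℝ :=
  ((m / 2 : ℕ) : ℝ)⁻¹ *
    ∑ j ∈ Finset.univ.filter (fun j : Fin m => (j : ℕ) < m / 2),
      (UY φ ω j - ((m / 2 : ℕ) : ℝ)⁻¹ *
        ∑ l ∈ Finset.univ.filter (fun l : Fin m => (l : ℕ) < m / 2), UY φ ω l) ^ 2

/-- `σ̂² = σ̂_X²/n₁ + σ̂_Y²/m₁`. -/
def sigmaHat2 (φ : 𝒳 → H) {n m : ℕ} (ω : (Fin n → 𝒳) × (Fin m → 𝒳)) : ℝ :=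
  sigmaHatX2 φ ω / ((n / 2 : ℕ) : ℝ) + sigmaHatY2 φ ω / ((m / 2 : ℕ) : ℝ)

/-- The studentized cross-MMD statistic `x̄MMD² = xMMD²/σ̂`. -/
def studentized (φ : 𝒳 → H) {n m : ℕ} (ω : (Fin n → 𝒳) × (Fin m → 𝒳)) : ℝ :=
  xMMD2 φ ω / Real.sqrt (sigmaHat2 φ ω)

/-- The standard normal cumulative distribution function `Φ`. -/
def stdGaussianCDF (x : ℝ) : ℝ := (gaussianReal 0 1 (Set.Iic x)).toReal

lemma norm_exp_I_mul_sub_taylor_two_le (x : ℝ) :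
    ‖Complex.exp (Complex.I * x) - (1 + Complex.I * x - x ^ 2 / 2)‖ ≤ 4 * |x| ^ 3 := by
  have hI : ‖Complex.I * x‖ = |x| := by simp
  have hsum : ∑ m ∈ Finset.range 3, (Complex.I * x) ^ m / (m.factorial : ℂ)
      = 1 + Complex.I * x - x ^ 2 / 2 := by
    simp [Finset.sum_range_succ, mul_pow]; ring
  rcases le_total |x| 1 with h | h
  · have := Complex.exp_bound (x := Complex.I * x) (by rwa [hI]) (n := 3) (by norm_num)
    rw [hsum, hI] at this
    refine this.trans ?_
    rw [mul_comm]
    refine mul_le_mul_of_nonneg_right ?_ (by positivity)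
    norm_num [Nat.factorial]
  · have h1 : ‖Complex.exp (Complex.I * x)‖ = 1 := Complex.norm_exp_I_mul_ofReal x
    have h2 : ‖(1 : ℂ) + Complex.I * x - x ^ 2 / 2‖ ≤ 1 + |x| + |x| ^ 2 / 2 := by
      refine (norm_sub_le _ _).trans (add_le_add ((norm_add_le _ _).trans ?_) ?_)
      · rw [hI]; simp
      · simp
    have h3 : |x| ^ 2 ≤ |x| ^ 3 := pow_le_pow_right₀ h (by norm_num)
    have h4 : |x| ≤ |x| ^ 3 := by simpa using pow_le_pow_right₀ h (show 1 ≤ 3 by norm_num)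
    have h5 : 1 ≤ |x| ^ 3 := one_le_pow₀ h
    refine (norm_sub_le _ _).trans ?_
    rw [h1]
    linarith

lemma norm_exp_neg_half_sq_sub_le (x : ℝ) :
    ‖Complex.exp (-(x : ℂ) ^ 2 / 2) - (1 - x ^ 2 / 2)‖ ≤ x ^ 4 := by
  have h : Complex.exp (-(x : ℂ) ^ 2 / 2) - (1 - x ^ 2 / 2)
      = ((Real.exp (-x ^ 2 / 2) - (1 - x ^ 2 / 2) : ℝ) : ℂ) := by push_cast; rfl
  rw [h, Complex.norm_real, Real.norm_eq_abs]
  have h1 := Real.add_one_le_exp (-x ^ 2 / 2)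
  rw [abs_of_nonneg (by linarith)]
  rcases le_total (x ^ 2) 2 with h2 | h2
  · have := Real.norm_exp_sub_one_sub_id_le (x := -x ^ 2 / 2)
      (by rw [Real.norm_eq_abs, abs_le]; constructor <;> nlinarith [sq_nonneg x])
    rw [Real.norm_eq_abs, Real.norm_eq_abs, sq_abs] at this
    have := (le_abs_self _).trans this
    nlinarith [sq_nonneg (x ^ 2)]
  · have : Real.exp (-x ^ 2 / 2) ≤ 1 := Real.exp_le_one_iff.2 (by nlinarith [sq_nonneg x])
    nlinarith

lemma norm_prod_sub_prod_le {ι : Type*} (s : Finset ι) (z w : ι → ℂ)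
    (hz : ∀ i ∈ s, ‖z i‖ ≤ 1) (hw : ∀ i ∈ s, ‖w i‖ ≤ 1) :
    ‖∏ i ∈ s, z i - ∏ i ∈ s, w i‖ ≤ ∑ i ∈ s, ‖z i - w i‖ := by
  classical
  induction s using Finset.induction_on with
  | empty => simp
  | insert a s ha ih =>
    rw [Finset.prod_insert ha, Finset.prod_insert ha, Finset.sum_insert ha]
    have h1 : z a * ∏ i ∈ s, z i - w a * ∏ i ∈ s, w i
        = (z a - w a) * ∏ i ∈ s, z i + w a * (∏ i ∈ s, z i - ∏ i ∈ s, w i) := by ring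
    have h2 : ‖∏ i ∈ s, z i‖ ≤ 1 := by
      rw [norm_prod]
      exact Finset.prod_le_one (fun _ _ => norm_nonneg _)
        fun i hi => hz i (Finset.mem_insert_of_mem hi)
    have h3 := ih (fun i hi => hz i (Finset.mem_insert_of_mem hi))
      fun i hi => hw i (Finset.mem_insert_of_mem hi)
    rw [h1]
    refine (norm_add_le _ _).trans (add_le_add ?_ ?_)
    · rw [norm_mul]
      exact mul_le_of_le_one_right (norm_nonneg _) h2
    · rw [norm_mul]
      exact (mul_le_of_le_one_left (norm_nonneg _) (hw a (Finset.mem_insert_self _ _))).trans h3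

/-- A measure on the line is close to the standard Gaussian at a given point of the distribution
function as soon as its characteristic function is close to the Gaussian one, uniformly over all
such measures. -/
lemma exists_forall_abs_measureReal_Iic_sub_le (t : ℝ) {ε : ℝ} (hε : 0 < ε) :
    ∃ δ > 0, ∀ ν : Measure ℝ, IsProbabilityMeasure ν →
      (∀ s : ℝ, ‖charFun ν s - Complex.exp (-(s : ℂ) ^ 2 / 2)‖ ≤ δ * (|s| ^ 3 + s ^ 4)) →
      |ν.real (Set.Iic t) - stdGaussianCDF t| ≤ ε := by
  by_contra! hcon
  choose ν hν hchar hbig using fun k : ℕ => hcon (1 / ((k : ℝ) + 1)) (by positivity)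
  let νs : ℕ → ProbabilityMeasure ℝ := fun k => ⟨ν k, hν k⟩
  let ν₀ : ProbabilityMeasure ℝ := ⟨gaussianReal 0 1, inferInstance⟩
  have hconv : Tendsto νs atTop (𝓝 ν₀) := by
    rw [ProbabilityMeasure.tendsto_iff_tendsto_charFun]
    intro s
    have h0 : charFun (ν₀ : Measure ℝ) s = Complex.exp (-(s : ℂ) ^ 2 / 2) := by
      change charFun (gaussianReal 0 1) s = _
      rw [charFun_gaussianReal]; congr 1; simp; ring
    rw [h0, tendsto_iff_norm_sub_tendsto_zero]
    refine squeeze_zero (fun _ => norm_nonneg _) (fun k => hchar k s) ?_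
    simpa using tendsto_one_div_add_atTop_nhds_zero_nat.mul_const (|s| ^ 3 + s ^ 4)
  have h1 : Tendsto (fun k => (ν k) (Set.Iic t)) atTop (𝓝 (gaussianReal 0 1 (Set.Iic t))) := by
    refine ProbabilityMeasure.tendsto_measure_of_null_frontier_of_tendsto' hconv ?_
    rw [frontier_Iic]
    have := nullSingletonClass_gaussianReal (μ := 0) (v := 1) one_ne_zero
    exact measure_singleton (μ := gaussianReal 0 1) t
  have h2 := (ENNReal.tendsto_toReal (measure_ne_top _ _)).comp h1
  have h3 := (h2.sub_const (stdGaussianCDF t)).abs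
  rw [show (gaussianReal 0 1 (Set.Iic t)).toReal - stdGaussianCDF t = 0 from sub_self _,
    abs_zero] at h3
  obtain ⟨k, hk⟩ := (h3.eventually_lt_const hε).exists
  exact absurd hk (not_lt.2 (hbig k).le)

lemma norm_integral_exp_I_mul_sub_le {P : Measure 𝒳} [IsProbabilityMeasure P] {u : 𝒳 → ℝ} {c : ℝ}
    (hu : Integrable u P) (hu2 : Integrable (fun x => u x ^ 2) P)
    (hu3 : Integrable (fun x => |u x| ^ 3) P) (h0 : ∫ x, u x ∂P = 0)
    (h2 : ∫ x, u x ^ 2 ∂P = c ^ 2) :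
    ‖∫ x, Complex.exp (Complex.I * u x) ∂P - Complex.exp (-(c : ℂ) ^ 2 / 2)‖
      ≤ 4 * ∫ x, |u x| ^ 3 ∂P + c ^ 4 := by
  have hexp : Integrable (fun x => Complex.exp (Complex.I * u x)) P := by
    refine Integrable.of_bound (C := 1) ?_ (ae_of_all _ fun x => ?_)
    · have hc : Continuous fun y : ℝ => Complex.exp (Complex.I * y) := by fun_prop
      exact hc.comp_aestronglyMeasurable hu.1
    · rw [Complex.norm_exp_I_mul_ofReal]
  have huC : Integrable (fun x => Complex.I * (u x : ℂ)) P := hu.ofReal.const_mul _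
  have hu2C : Integrable (fun x => ((u x : ℂ)) ^ 2 / 2) P := by
    have := (hu2.ofReal (𝕜 := ℂ)).div_const 2
    simpa using this
  have hq : ∫ x, (1 + Complex.I * (u x : ℂ) - (u x : ℂ) ^ 2 / 2) ∂P = 1 - (c : ℂ) ^ 2 / 2 := by
    rw [integral_sub (by exact (integrable_const _).add huC) hu2C,
      integral_add (integrable_const _) huC, integral_const_mul, integral_div]
    have e1 : ∫ x, (u x : ℂ) ∂P = 0 := by rw [integral_complex_ofReal, h0]; simp
    have e2 : ∫ x, (u x : ℂ) ^ 2 ∂P = (c : ℂ) ^ 2 := by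
      have : ∫ x, ((u x ^ 2 : ℝ) : ℂ) ∂P = ((c ^ 2 : ℝ) : ℂ) := by
        rw [integral_complex_ofReal, h2]
      simpa using this
    rw [e1, e2]; simp
  have hq_int : Integrable (fun x => 1 + Complex.I * (u x : ℂ) - (u x : ℂ) ^ 2 / 2) P :=
    ((integrable_const _).add huC).sub hu2C
  have hA : ‖∫ x, Complex.exp (Complex.I * u x) ∂P - (1 - (c : ℂ) ^ 2 / 2)‖
      ≤ 4 * ∫ x, |u x| ^ 3 ∂P := by
    rw [← hq, ← integral_sub hexp hq_int, ← integral_const_mul]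
    exact norm_integral_le_of_norm_le (hu3.const_mul 4)
      (ae_of_all _ fun x => norm_exp_I_mul_sub_taylor_two_le (u x))
  have hB := norm_exp_neg_half_sq_sub_le c
  rw [norm_sub_rev] at hB
  calc _ = ‖(∫ x, Complex.exp (Complex.I * u x) ∂P - (1 - (c : ℂ) ^ 2 / 2))
        + ((1 - (c : ℂ) ^ 2 / 2) - Complex.exp (-(c : ℂ) ^ 2 / 2))‖ := by congr 1; ring
    _ ≤ _ := (norm_add_le _ _).trans (add_le_add hA hB)

lemma memLp_nat_of_integrable_pow {P : Measure 𝒳} {f : 𝒳 → ℝ} {p : ℕ} (hp0 : p ≠ 0)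
    (hp : Even p) (hf : AEStronglyMeasurable f P) (h : Integrable (fun x => f x ^ p) P) :
    MemLp f p P := by
  refine (integrable_norm_rpow_iff hf (by simpa using hp0) (by simp)).1 ?_
  refine h.congr (ae_of_all _ fun x => ?_)
  simp [hp.pow_abs]

lemma integrable_pow_of_memLp {P : Measure 𝒳} [IsFiniteMeasure P] {f : 𝒳 → ℝ} {p q : ℕ}
    (hf : MemLp f p P) (hqp : q ≤ p) : Integrable (fun x => f x ^ q) P := by
  have h1 : MemLp f q P := hf.mono_exponent (by exact_mod_cast hqp)
  refine (h1.integrable_norm_pow' ).mono' (hf.1.pow q) (ae_of_all _ fun x => ?_)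
  simp

lemma one_le_integral_pow_four {P : Measure 𝒳} [IsProbabilityMeasure P] {f : 𝒳 → ℝ}
    (hf : MemLp f 4 P) (h2 : ∫ x, f x ^ 2 ∂P = 1) : 1 ≤ ∫ x, f x ^ 4 ∂P := by
  have i2 : Integrable (fun x => f x ^ 2) P := integrable_pow_of_memLp (p := 4) hf (by norm_num)
  have i4 : Integrable (fun x => f x ^ 4) P := integrable_pow_of_memLp (p := 4) hf le_rfl
  have h : ∫ x, (2 * f x ^ 2 - 1) ∂P ≤ ∫ x, f x ^ 4 ∂P :=
    integral_mono ((i2.const_mul 2).sub (integrable_const _)) i4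
      fun x => by nlinarith [sq_nonneg (f x ^ 2 - 1)]
  rw [integral_sub (i2.const_mul 2) (integrable_const _), integral_const_mul, h2] at h
  simp at h; linarith

section Product

variable {ι : Type*} [Fintype ι] {P : Measure 𝒳} [IsProbabilityMeasure P]

lemma charFun_map_weighted_sum {f : 𝒳 → ℝ} (hf : Measurable f) (α : ι → ℝ) (s : ℝ) :
    charFun ((Measure.pi fun _ : ι => P).map fun ω => ∑ i, α i * f (ω i)) s
      = ∏ i, ∫ x, Complex.exp (Complex.I * (s * α i * f x : ℝ)) ∂P := by
  have hmeas : Measurable fun ω : ι → 𝒳 => ∑ i, α i * f (ω i) := by fun_prop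
  rw [charFun_apply_real, integral_map hmeas.aemeasurable (by fun_prop),
    ← integral_fintype_prod_eq_prod]
  refine integral_congr_ae (ae_of_all _ fun ω => ?_)
  dsimp only
  rw [← Complex.exp_sum]
  congr 1
  push_cast
  rw [Finset.mul_sum, Finset.sum_mul]
  exact Finset.sum_congr rfl fun i _ => by ring

lemma norm_charFun_weighted_sum_sub_le {f : 𝒳 → ℝ} (hf : Measurable f)
    (hf4 : MemLp f 4 P) (h0 : ∫ x, f x ∂P = 0) (h2 : ∫ x, f x ^ 2 ∂P = 1)
    {α : ι → ℝ} (hα : ∑ i, α i ^ 2 = 1) {b η : ℝ} (hb : ∀ i, α i ^ 2 ≤ b) (hη : 0 < η)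
    (hη1 : η ≤ 1) (hbM : b * ∫ x, f x ^ 4 ∂P ≤ η ^ 2) (s : ℝ) :
    ‖charFun ((Measure.pi fun _ : ι => P).map fun ω => ∑ i, α i * f (ω i)) s
      - Complex.exp (-(s : ℂ) ^ 2 / 2)‖ ≤ 4 * η * (|s| ^ 3 + s ^ 4) := by
  have i1 : Integrable f P := by
    simpa using integrable_pow_of_memLp (p := 4) (q := 1) hf4 (by norm_num)
  have i2 : Integrable (fun x => f x ^ 2) P := integrable_pow_of_memLp (p := 4) hf4 (by norm_num)
  have i3 : Integrable (fun x => |f x| ^ 3) P := by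
    simpa [abs_pow] using (integrable_pow_of_memLp (p := 4) (q := 3) hf4 (by norm_num)).abs
  have i4 : Integrable (fun x => f x ^ 4) P := integrable_pow_of_memLp (p := 4) hf4 le_rfl
  have hM := one_le_integral_pow_four hf4 h2
  set M := ∫ x, f x ^ 4 ∂P
  have hthird : ∀ i, |α i| * ∫ x, |f x| ^ 3 ∂P ≤ η := by
    intro i
    have h : ∫ x, |α i| * |f x| ^ 3 ∂P
        ≤ ∫ x, (α i ^ 2 / (2 * η) * f x ^ 4 + η / 2 * f x ^ 2) ∂P := by
      refine integral_mono (i3.const_mul _) ((i4.const_mul _).add (i2.const_mul _)) fun x => ?_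
      have e1 : f x ^ 4 = |f x| ^ 4 := (Even.pow_abs (by decide) _).symm
      have e2 : f x ^ 2 = |f x| ^ 2 := (sq_abs _).symm
      have e3 : α i ^ 2 = |α i| ^ 2 := (sq_abs _).symm
      dsimp only
      rw [e1, e2, e3]
      have : |α i| ^ 2 / (2 * η) * |f x| ^ 4 + η / 2 * |f x| ^ 2 - |α i| * |f x| ^ 3
          = |f x| ^ 2 * (|α i| * |f x| - η) ^ 2 / (2 * η) := by field_simp; ring
      have h' : 0 ≤ |f x| ^ 2 * (|α i| * |f x| - η) ^ 2 / (2 * η) := by positivity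
      linarith
    rw [integral_const_mul, integral_add (i4.const_mul _) (i2.const_mul _), integral_const_mul,
      integral_const_mul, h2] at h
    have h' : α i ^ 2 / (2 * η) * M ≤ η / 2 := by
      rw [div_mul_eq_mul_div, div_le_iff₀ (by positivity)]
      nlinarith [mul_le_mul_of_nonneg_right (hb i) (by linarith : (0 : ℝ) ≤ M)]
    linarith
  have hsq : ∀ i, α i ^ 2 ≤ η := by
    intro i
    nlinarith [hb i, sq_nonneg (α i)]
  have hsplit : Complex.exp (-(s : ℂ) ^ 2 / 2)
      = ∏ i, Complex.exp (-((s * α i : ℝ) : ℂ) ^ 2 / 2) := by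
    rw [← Complex.exp_sum]
    congr 1
    have : ((∑ i, α i ^ 2 : ℝ) : ℂ) = 1 := by rw [hα]; simp
    push_cast at this ⊢
    simp_rw [mul_pow]
    rw [← Finset.sum_div, Finset.sum_neg_distrib, ← Finset.mul_sum, this, mul_one]
  rw [charFun_map_weighted_sum hf, hsplit]
  refine (norm_prod_sub_prod_le _ _ _ ?_ ?_).trans ?_
  · intro i _
    refine (norm_integral_le_of_norm_le (integrable_const 1)
      (ae_of_all _ fun x => (Complex.norm_exp_I_mul_ofReal _).le)).trans ?_
    simp
  · intro i _
    rw [Complex.norm_exp, Real.exp_le_one_iff]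
    have : (-((s * α i : ℝ) : ℂ) ^ 2 / 2) = ((-(s * α i) ^ 2 / 2 : ℝ) : ℂ) := by push_cast; ring
    rw [this, Complex.ofReal_re]
    nlinarith [sq_nonneg (s * α i)]
  · have hterm : ∀ i ∈ Finset.univ,
        ‖∫ x, Complex.exp (Complex.I * (s * α i * f x : ℝ)) ∂P
          - Complex.exp (-((s * α i : ℝ) : ℂ) ^ 2 / 2)‖
        ≤ α i ^ 2 * (4 * η * (|s| ^ 3 + s ^ 4)) := by
      intro i _
      have e2 : ∀ x, (s * α i * f x) ^ 2 = (s * α i) ^ 2 * f x ^ 2 := fun x => by ring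
      have e3 : ∀ x, |s * α i * f x| ^ 3 = |s| ^ 3 * |α i| ^ 3 * |f x| ^ 3 := fun x => by
        rw [abs_mul, abs_mul]; ring
      have h := norm_integral_exp_I_mul_sub_le (P := P) (u := fun x => s * α i * f x)
        (c := s * α i) (i1.const_mul _) (by simp_rw [e2]; exact i2.const_mul _)
        (by simp_rw [e3]; exact i3.const_mul _) (by rw [integral_const_mul, h0, mul_zero])
        (by simp_rw [e2]; rw [integral_const_mul, h2, mul_one])
      refine h.trans ?_
      simp_rw [e3]
      rw [integral_const_mul]
      have t1 : |s| ^ 3 * |α i| ^ 3 * ∫ x, |f x| ^ 3 ∂P ≤ α i ^ 2 * (|s| ^ 3 * η) := by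
        have : |s| ^ 3 * |α i| ^ 3 * ∫ x, |f x| ^ 3 ∂P
            = α i ^ 2 * (|s| ^ 3 * (|α i| * ∫ x, |f x| ^ 3 ∂P)) := by
          rw [← sq_abs (α i)]; ring
        rw [this]
        gcongr
        exact hthird i
      have t2 : (s * α i) ^ 4 ≤ α i ^ 2 * (s ^ 4 * η) := by
        have : (s * α i) ^ 4 = α i ^ 2 * (s ^ 4 * α i ^ 2) := by ring
        rw [this]
        gcongr
        exact hsq i
      have t3 : 0 ≤ α i ^ 2 * (s ^ 4 * η) := by positivity
      linarith
    refine (Finset.sum_le_sum hterm).trans ?_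
    rw [← Finset.sum_mul, hα, one_mul]

/-- Uniform Lyapunov central limit theorem for weighted sums of i.i.d. variables. -/
lemma exists_forall_abs_weighted_sum_sub_le (t : ℝ) {ε : ℝ} (hε : 0 < ε) :
    ∃ δ > 0, ∀ {ι : Type} [Fintype ι] {𝒳 : Type*} [MeasurableSpace 𝒳] {P : Measure 𝒳}
      [IsProbabilityMeasure P] {f : 𝒳 → ℝ} {α : ι → ℝ} {b : ℝ},
      Measurable f → MemLp f 4 P → ∫ x, f x ∂P = 0 → ∫ x, f x ^ 2 ∂P = 1 →
      ∑ i, α i ^ 2 = 1 → (∀ i, α i ^ 2 ≤ b) → b * ∫ x, f x ^ 4 ∂P ≤ δ →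
      |(Measure.pi fun _ : ι => P).real {ω | ∑ i, α i * f (ω i) ≤ t} - stdGaussianCDF t| ≤ ε := by
  obtain ⟨δ, hδ, h⟩ := exists_forall_abs_measureReal_Iic_sub_le t hε
  have hη : 0 < min 1 (δ / 4) := by positivity
  refine ⟨(min 1 (δ / 4)) ^ 2, by positivity, ?_⟩
  intro ι _ 𝒳 _ P _ f α b hf hf4 h0 h2 hα hb hbM
  have hmeas : Measurable fun ω : ι → 𝒳 => ∑ i, α i * f (ω i) := by fun_prop
  have := h ((Measure.pi fun _ : ι => P).map fun ω => ∑ i, α i * f (ω i))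
    (Measure.isProbabilityMeasure_map hmeas.aemeasurable) fun s => by
      refine (norm_charFun_weighted_sum_sub_le hf hf4 h0 h2 hα hb hη (min_le_left _ _) hbM s).trans ?_
      have h4 : 4 * min 1 (δ / 4) ≤ δ := by linarith [min_le_right 1 (δ / 4)]
      gcongr
  rwa [map_measureReal_apply hmeas measurableSet_Iic] at this

lemma integral_weighted_sum_moments {g : 𝒳 → ℝ} (hg : Measurable g) (hg2 : MemLp g 2 P)
    (h0 : ∫ x, g x ∂P = 0) (β : ι → ℝ) (s : Finset ι) :
    MemLp (fun ω : ι → 𝒳 => ∑ i ∈ s, β i * g (ω i)) 2 (Measure.pi fun _ => P) ∧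
    ∫ ω : ι → 𝒳, (∑ i ∈ s, β i * g (ω i)) ∂(Measure.pi fun _ => P) = 0 ∧
    ∫ ω : ι → 𝒳, (∑ i ∈ s, β i * g (ω i)) ^ 2 ∂(Measure.pi fun _ => P)
      = (∑ i ∈ s, β i ^ 2) * ∫ x, g x ^ 2 ∂P := by
  classical
  induction s using Finset.induction_on with
  | empty => simp
  | insert a s ha ih =>
    obtain ⟨hS, hS0, hS2⟩ := ih
    have hmp := measurePreserving_eval (fun _ : ι => P) a
    have hX : MemLp (fun ω : ι → 𝒳 => β a * g (ω a)) 2 (Measure.pi fun _ => P) :=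
      (hg2.comp_measurePreserving hmp).const_mul _
    have hX0 : ∫ ω : ι → 𝒳, β a * g (ω a) ∂(Measure.pi fun _ => P) = 0 := by
      rw [integral_const_mul, integral_comp_eval (μ := fun _ : ι => P) hg.aestronglyMeasurable,
        h0, mul_zero]
    have hX2 : ∫ ω : ι → 𝒳, (β a * g (ω a)) ^ 2 ∂(Measure.pi fun _ => P)
        = β a ^ 2 * ∫ x, g x ^ 2 ∂P := by
      simp_rw [mul_pow]
      rw [integral_const_mul, integral_comp_eval (μ := fun _ : ι => P) (i := a)
        (f := fun x => g x ^ 2) (by fun_prop)]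
    have hind : IndepFun (fun ω : ι → 𝒳 => ∑ i ∈ s, β i * g (ω i))
        (fun ω => β a * g (ω a)) (Measure.pi fun _ => P) := by
      have h := (iIndepFun_pi (μ := fun _ : ι => P) (X := fun i x => β i * g x)
        fun i => by fun_prop).indepFun_finsetSum_of_notMem (fun i => by fun_prop) ha
      convert h using 1
      ext ω; simp
    have hXS : ∫ ω : ι → 𝒳, (∑ i ∈ s, β i * g (ω i)) * (β a * g (ω a))
        ∂(Measure.pi fun _ => P) = 0 := by
      rw [hind.integral_fun_mul_eq_mul_integral hS.1 hX.1, hX0, mul_zero]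
    have hXSi : Integrable (fun ω : ι → 𝒳 => (∑ i ∈ s, β i * g (ω i)) * (β a * g (ω a)))
        (Measure.pi fun _ => P) := hS.integrable_mul hX
    simp_rw [Finset.sum_insert ha]
    refine ⟨hX.add hS, ?_, ?_⟩
    · rw [integral_add (hX.integrable (by norm_num)) (hS.integrable (by norm_num)), hX0, hS0,
        add_zero]
    · have e : ∀ ω : ι → 𝒳, (β a * g (ω a) + ∑ i ∈ s, β i * g (ω i)) ^ 2
          = (β a * g (ω a)) ^ 2 + (2 * ((∑ i ∈ s, β i * g (ω i)) * (β a * g (ω a)))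
            + (∑ i ∈ s, β i * g (ω i)) ^ 2) := fun ω => by ring
      simp_rw [e]
      have hXsq := hX.integrable_sq
      have hSsq := hS.integrable_sq
      rw [integral_add hXsq (by fun_prop), integral_add (by fun_prop) hSsq, integral_const_mul, hXS, hX2, hS2]
      ring

lemma sq_integral_sq_le_integral_pow_four {g : 𝒳 → ℝ} (hg4 : MemLp g 4 P) :
    (∫ x, g x ^ 2 ∂P) ^ 2 ≤ ∫ x, g x ^ 4 ∂P := by
  have i2 : Integrable (fun x => g x ^ 2) P := integrable_pow_of_memLp (p := 4) hg4 (by norm_num)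
  have i4 : Integrable (fun x => g x ^ 4) P := integrable_pow_of_memLp (p := 4) hg4 le_rfl
  set v := ∫ x, g x ^ 2 ∂P with hv
  have h : ∫ x, (2 * v * g x ^ 2 - v ^ 2) ∂P ≤ ∫ x, g x ^ 4 ∂P :=
    integral_mono ((i2.const_mul (2 * v)).sub (integrable_const _)) i4
      fun x => by nlinarith [sq_nonneg (g x ^ 2 - v)]
  rw [integral_sub (i2.const_mul _) (integrable_const _), integral_const_mul, ← hv] at h
  simp at h; linarith

lemma integral_weighted_sum_pow_four_le {g : 𝒳 → ℝ} (hg : Measurable g) (hg4 : MemLp g 4 P)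
    (h0 : ∫ x, g x ∂P = 0) (β : ι → ℝ) (s : Finset ι) :
    MemLp (fun ω : ι → 𝒳 => ∑ i ∈ s, β i * g (ω i)) 4 (Measure.pi fun _ => P) ∧
    ∫ ω : ι → 𝒳, (∑ i ∈ s, β i * g (ω i)) ^ 4 ∂(Measure.pi fun _ => P)
      ≤ 3 * (∑ i ∈ s, β i ^ 2) ^ 2 * ∫ x, g x ^ 4 ∂P := by
  classical
  have hg2 : MemLp g 2 P := hg4.mono_exponent (by norm_num)
  induction s using Finset.induction_on with
  | empty => simp
  | insert a s ha ih =>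
    obtain ⟨hS, hS4⟩ := ih
    obtain ⟨-, hS1, hS2⟩ := integral_weighted_sum_moments hg hg2 h0 β s
    set S : (ι → 𝒳) → ℝ := fun ω => ∑ i ∈ s, β i * g (ω i) with hSdef
    set X : (ι → 𝒳) → ℝ := fun ω => β a * g (ω a) with hXdef
    have hmp := measurePreserving_eval (fun _ : ι => P) a
    have hX : MemLp X 4 (Measure.pi fun _ => P) :=
      (hg4.comp_measurePreserving hmp).const_mul _
    have hXp : ∀ k : ℕ, ∫ ω, X ω ^ k ∂(Measure.pi fun _ => P) = β a ^ k * ∫ x, g x ^ k ∂P := by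
      intro k
      simp_rw [hXdef, mul_pow]
      rw [integral_const_mul, integral_comp_eval (μ := fun _ : ι => P) (i := a)
        (f := fun x => g x ^ k) (by fun_prop)]
    have hind : IndepFun S X (Measure.pi fun _ => P) := by
      have h := (iIndepFun_pi (μ := fun _ : ι => P) (X := fun i x => β i * g x)
        fun i => by fun_prop).indepFun_finsetSum_of_notMem (fun i => by fun_prop) ha
      convert h using 1
      ext ω; simp [hSdef]
    have iS : ∀ k ≤ 4, Integrable (fun ω => S ω ^ k) (Measure.pi fun _ => P) :=
      fun k hk => integrable_pow_of_memLp (p := 4) hS hk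
    have iX : ∀ k ≤ 4, Integrable (fun ω => X ω ^ k) (Measure.pi fun _ => P) :=
      fun k hk => integrable_pow_of_memLp (p := 4) hX hk
    have hindp : ∀ k l : ℕ, IndepFun (fun ω => S ω ^ k) (fun ω => X ω ^ l)
        (Measure.pi fun _ => P) := fun k l =>
      hind.comp (φ := fun x : ℝ => x ^ k) (ψ := fun x : ℝ => x ^ l) (by fun_prop) (by fun_prop)
    have iSX : ∀ k l, k ≤ 4 → l ≤ 4 →
        Integrable (fun ω => S ω ^ k * X ω ^ l) (Measure.pi fun _ => P) :=
      fun k l hk hl => (hindp k l).integrable_mul (iS k hk) (iX l hl)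
    have eSX : ∀ k l, k ≤ 4 → l ≤ 4 → ∫ ω, S ω ^ k * X ω ^ l ∂(Measure.pi fun _ => P)
        = (∫ ω, S ω ^ k ∂(Measure.pi fun _ => P)) * (β a ^ l * ∫ x, g x ^ l ∂P) :=
      fun k l hk hl => by
        rw [(hindp k l).integral_fun_mul_eq_mul_integral (iS k hk).1 (iX l hl).1, hXp]
    have e31 := eSX 3 1 (by norm_num) (by norm_num)
    have e13 := eSX 1 3 (by norm_num) (by norm_num)
    have e22 := eSX 2 2 (by norm_num) (by norm_num)
    simp only [pow_one] at e31 e13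
    rw [h0, mul_zero, mul_zero] at e31
    rw [hS1, zero_mul] at e13
    rw [hS2] at e22
    have i31 := iSX 3 1 (by norm_num) (by norm_num)
    have i13 := iSX 1 3 (by norm_num) (by norm_num)
    have i22 := iSX 2 2 (by norm_num) (by norm_num)
    simp only [pow_one] at i31 i13
    simp_rw [Finset.sum_insert ha]
    refine ⟨hX.add hS, ?_⟩
    have e : ∀ ω, (X ω + S ω) ^ 4 = X ω ^ 4 + (4 * (S ω ^ 3 * X ω) + (4 * (S ω * X ω ^ 3)
        + (6 * (S ω ^ 2 * X ω ^ 2) + S ω ^ 4))) := fun ω => by ring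
    have hsq := sq_integral_sq_le_integral_pow_four hg4
    change ∫ ω, (X ω + S ω) ^ 4 ∂(Measure.pi fun _ => P) ≤ _
    simp_rw [e]
    rw [integral_add (iX 4 le_rfl) (by fun_prop (disch := norm_num)),
      integral_add (by fun_prop) (by fun_prop (disch := norm_num)),
      integral_add (by fun_prop) (by fun_prop (disch := norm_num)),
      integral_add (by fun_prop) (iS 4 le_rfl)]
    simp_rw [integral_const_mul]
    rw [e31, e13, e22, hXp]
    set q := ∑ i ∈ s, β i ^ 2
    have hq : 0 ≤ q := Finset.sum_nonneg fun i _ => sq_nonneg _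
    set K := ∫ x, g x ^ 4 ∂P
    set v := ∫ x, g x ^ 2 ∂P
    have hK : 0 ≤ K := (sq_nonneg v).trans hsq
    have t1 : q * v * (β a ^ 2 * v) ≤ q * β a ^ 2 * K := by
      have : q * v * (β a ^ 2 * v) = q * β a ^ 2 * v ^ 2 := by ring
      rw [this]; gcongr
    have t2 : 0 ≤ β a ^ 4 * K := by positivity
    nlinarith


end Product

lemma continuous_stdGaussianCDF : Continuous stdGaussianCDF := by
  have h : stdGaussianCDF = cdf (gaussianReal 0 1) := by
    ext x; rw [cdf_eq_real]; rfl
  rw [h, continuous_iff_continuousAt]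
  intro x
  have := nullSingletonClass_gaussianReal (μ := 0) (v := 1) one_ne_zero
  have h0 := (cdf (gaussianReal 0 1)).measure_singleton x
  rw [measure_cdf, measure_singleton, eq_comm, ENNReal.ofReal_eq_zero] at h0
  rw [(monotone_cdf _).continuousAt_iff_leftLim_eq_rightLim, StieltjesFunction.rightLim_eq]
  exact le_antisymm ((monotone_cdf _).leftLim_le le_rfl) (by linarith)

lemma div_sqrt_le_iff_bounds {T v t κ : ℝ} (hκ : κ < 1) (hv : |v - 1| ≤ κ) :
    (T / √v ≤ t → T ≤ t + |t| * κ) ∧ (T ≤ t - |t| * κ → T / √v ≤ t) := by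
  have hv' := abs_le.1 hv
  have hv0 : 0 < v := by linarith
  have hs := Real.sqrt_pos.2 hv0
  have hsq := Real.sq_sqrt hv0.le
  have h1 : |√v - 1| ≤ κ := by
    have : |√v - 1| * (√v + 1) = |v - 1| := by
      rw [← abs_of_pos (show 0 < √v + 1 by linarith), ← abs_mul]
      congr 1; nlinarith
    nlinarith [abs_nonneg (√v - 1)]
  have h2 : |t * √v - t| ≤ |t| * κ := by
    rw [show t * √v - t = t * (√v - 1) by ring, abs_mul]
    gcongr
  have h2' := abs_le.1 h2
  rw [div_le_iff₀ hs]
  constructor <;> intro h <;> linarith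

section Statistic

variable {ι : Type*}

/-- The mean of `u` over `A`. -/
def sMean (A : Finset ι) (u : ι → ℝ) : ℝ := (A.card : ℝ)⁻¹ * ∑ i ∈ A, u i

/-- The biased empirical variance of `u` over `A`. -/
def sVar (A : Finset ι) (u : ι → ℝ) : ℝ := (A.card : ℝ)⁻¹ * ∑ i ∈ A, (u i - sMean A u) ^ 2

/-- The two-sample studentized difference of means of `u` over `A` and `B`. -/
def tStat (A B : Finset ι) (u : ι → ℝ) : ℝ :=
  (sMean A u - sMean B u) / √(sVar A u / A.card + sVar B u / B.card)

lemma sMean_affine {A : Finset ι} (hA : A.Nonempty) (c d : ℝ) (u : ι → ℝ) :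
    sMean A (fun i => c * u i + d) = c * sMean A u + d := by
  have : (A.card : ℝ) ≠ 0 := by exact_mod_cast hA.card_pos.ne'
  simp only [sMean, Finset.sum_add_distrib, ← Finset.mul_sum, Finset.sum_const, nsmul_eq_mul]
  field_simp

lemma sVar_affine {A : Finset ι} (hA : A.Nonempty) (c d : ℝ) (u : ι → ℝ) :
    sVar A (fun i => c * u i + d) = c ^ 2 * sVar A u := by
  simp only [sVar, sMean_affine hA]
  rw [mul_left_comm, Finset.mul_sum (a := c ^ 2)]
  congr 1
  exact Finset.sum_congr rfl fun i _ => by ring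

lemma tStat_affine {A B : Finset ι} (hA : A.Nonempty) (hB : B.Nonempty) {c : ℝ} (hc : 0 < c)
    (d : ℝ) (u : ι → ℝ) : tStat A B (fun i => c * u i + d) = tStat A B u := by
  simp only [tStat, sMean_affine hA, sMean_affine hB, sVar_affine hA, sVar_affine hB]
  rw [show c ^ 2 * sVar A u / A.card + c ^ 2 * sVar B u / B.card
      = c ^ 2 * (sVar A u / A.card + sVar B u / B.card) by ring, Real.sqrt_mul (sq_nonneg c),
    Real.sqrt_sq hc.le, show c * sMean A u + d - (c * sMean B u + d)
      = c * (sMean A u - sMean B u) by ring, mul_div_mul_left _ _ hc.ne']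

lemma sVar_eq {A : Finset ι} (hA : A.Nonempty) (u : ι → ℝ) :
    sVar A u = sMean A (fun i => u i ^ 2) - sMean A u ^ 2 := by
  have h : (A.card : ℝ) ≠ 0 := by exact_mod_cast hA.card_pos.ne'
  have h1 : ∑ i ∈ A, u i = A.card * sMean A u := by rw [sMean]; field_simp
  have h2 : ∑ i ∈ A, u i ^ 2 = A.card * sMean A (fun i => u i ^ 2) := by rw [sMean]; field_simp
  rw [sVar]
  simp_rw [sub_sq]
  rw [Finset.sum_add_distrib, Finset.sum_sub_distrib, ← Finset.sum_mul, ← Finset.mul_sum, h1, h2,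
    Finset.sum_const, nsmul_eq_mul]
  field_simp; ring

variable [DecidableEq ι]

/-- The weights of the difference of means over `A` and `B`. -/
def contrast (A B : Finset ι) (i : ι) : ℝ :=
  (if i ∈ A then (A.card : ℝ)⁻¹ else 0) - (if i ∈ B then (B.card : ℝ)⁻¹ else 0)

lemma sum_contrast_smul [Fintype ι] {E : Type*} [AddCommGroup E] [Module ℝ E]
    (A B : Finset ι) (u : ι → E) :
    ∑ i, contrast A B i • u i
      = (A.card : ℝ)⁻¹ • ∑ i ∈ A, u i - (B.card : ℝ)⁻¹ • ∑ i ∈ B, u i := by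
  simp [contrast, sub_smul, Finset.sum_sub_distrib, ite_smul, Finset.smul_sum]

lemma sum_contrast_mul [Fintype ι] (A B : Finset ι) (u : ι → ℝ) :
    ∑ i, contrast A B i * u i = sMean A u - sMean B u :=
  sum_contrast_smul A B u

lemma contrast_sq {A B : Finset ι} (hAB : Disjoint A B) (i : ι) :
    contrast A B i ^ 2 = (if i ∈ A then ((A.card : ℝ)⁻¹) ^ 2 else 0)
      + (if i ∈ B then ((B.card : ℝ)⁻¹) ^ 2 else 0) := by
  have : i ∈ A → i ∉ B := fun h => Finset.disjoint_left.1 hAB h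
  by_cases hA : i ∈ A <;> by_cases hB : i ∈ B <;> simp_all [contrast]

lemma sum_contrast_sq [Fintype ι] {A B : Finset ι} (hAB : Disjoint A B) :
    ∑ i, contrast A B i ^ 2 = (A.card : ℝ)⁻¹ + (B.card : ℝ)⁻¹ := by
  have h : ∀ a : ℝ, a * (a ^ 2)⁻¹ = a⁻¹ := fun a => by
    rcases eq_or_ne a 0 with rfl | ha
    · simp
    · field_simp
  simp_rw [contrast_sq hAB, Finset.sum_add_distrib]
  simp [h]

lemma contrast_sq_mul_le {A B : Finset ι} (hAB : Disjoint A B) {M δ : ℝ} (hδ : 0 ≤ δ)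
    (hA : M ≤ δ * A.card) (hB : M ≤ δ * B.card) (i : ι) :
    contrast A B i ^ 2 * M ≤ δ * ((A.card : ℝ)⁻¹ + (B.card : ℝ)⁻¹) := by
  have key : ∀ a : ℝ, 0 ≤ a → M ≤ δ * a → a⁻¹ ^ 2 * M ≤ δ * a⁻¹ := fun a ha h => by
    rcases ha.eq_or_lt with rfl | ha
    · simp
    · calc a⁻¹ ^ 2 * M ≤ a⁻¹ ^ 2 * (δ * a) := by gcongr
        _ = δ * a⁻¹ := by field_simp
  have h1 := key _ (Nat.cast_nonneg _) hA
  have h2 := key _ (Nat.cast_nonneg _) hB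
  have h3 : 0 ≤ δ * (A.card : ℝ)⁻¹ := by positivity
  have h4 : 0 ≤ δ * (B.card : ℝ)⁻¹ := by positivity
  have : i ∈ A → i ∉ B := fun h => Finset.disjoint_left.1 hAB h
  rw [contrast_sq hAB, mul_add]
  by_cases hiA : i ∈ A
  · rw [if_pos hiA, if_neg (this hiA)]; linarith
  · rw [if_neg hiA]
    split_ifs <;> linarith

end Statistic

section Studentized

variable {ι : Type*} [Fintype ι] {P : Measure 𝒳} [IsProbabilityMeasure P]

lemma measureReal_le_sMean_sq_le {g : 𝒳 → ℝ} (hg : Measurable g) (hg2 : MemLp g 2 P)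
    (h0 : ∫ x, g x ∂P = 0) {A : Finset ι} (hA : A.Nonempty) (c : ℝ) :
    c * (Measure.pi fun _ : ι => P).real {ω | c ≤ sMean A (fun i => g (ω i)) ^ 2}
      ≤ (A.card : ℝ)⁻¹ * ∫ x, g x ^ 2 ∂P := by
  obtain ⟨hL, -, h2⟩ := integral_weighted_sum_moments hg hg2 h0 (fun _ : ι => (A.card : ℝ)⁻¹) A
  simp_rw [← Finset.mul_sum] at hL h2
  have hc : (A.card : ℝ) ≠ 0 := by exact_mod_cast hA.card_pos.ne'
  refine (mul_meas_ge_le_integral_of_nonneg (ae_of_all _ fun ω => sq_nonneg _)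
    hL.integrable_sq c).trans ?_
  change ∫ ω : ι → 𝒳, ((A.card : ℝ)⁻¹ * ∑ i ∈ A, g (ω i)) ^ 2 ∂_ ≤ _
  rw [h2, Finset.sum_const, nsmul_eq_mul]
  refine le_of_eq ?_
  field_simp

lemma measureReal_lt_abs_sVar_sub_one_le {f : 𝒳 → ℝ} (hf : Measurable f)
    (hf4 : MemLp f 4 P) (h0 : ∫ x, f x ∂P = 0) (h2 : ∫ x, f x ^ 2 ∂P = 1)
    {A : Finset ι} (hA : A.Nonempty) {κ δ : ℝ} (hκ : 0 < κ) (hM : ∫ x, f x ^ 4 ∂P ≤ δ * A.card) :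
    (Measure.pi fun _ : ι => P).real {ω | κ < |sVar A (fun i => f (ω i)) - 1|}
      ≤ δ * (4 / κ ^ 2 + 2 / κ) := by
  have i2 : Integrable (fun x => f x ^ 2) P := integrable_pow_of_memLp (p := 4) hf4 (by norm_num)
  have i4 : Integrable (fun x => f x ^ 4) P := integrable_pow_of_memLp (p := 4) hf4 le_rfl
  have hM1 := one_le_integral_pow_four hf4 h2
  have hc : 0 < (A.card : ℝ) := by exact_mod_cast hA.card_pos
  set M := ∫ x, f x ^ 4 ∂P with hMdef
  have hexp : ∀ x, (f x ^ 2 - 1) ^ 2 = f x ^ 4 - 2 * f x ^ 2 + 1 := fun x => by ring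
  have ig : Integrable (fun x => (f x ^ 2 - 1) ^ 2) P := by
    simp_rw [hexp]
    exact (i4.sub (i2.const_mul 2)).add (integrable_const _)
  have eg : ∫ x, (f x ^ 2 - 1) ^ 2 ∂P = M - 1 := by
    simp_rw [hexp]
    rw [integral_add (by exact i4.sub (i2.const_mul 2)) (integrable_const _),
      integral_sub i4 (i2.const_mul 2), integral_const_mul, h2]
    simp; linarith
  have eg0 : ∫ x, (f x ^ 2 - 1) ∂P = 0 := by
    rw [integral_sub i2 (integrable_const _), h2]; simp
  have hgm : Measurable fun x => f x ^ 2 - 1 := by fun_prop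
  have hgL : MemLp (fun x => f x ^ 2 - 1) 2 P :=
    memLp_nat_of_integrable_pow (p := 2) two_ne_zero even_two hgm.aestronglyMeasurable ig
  have b1 := measureReal_le_sMean_sq_le hgm hgL eg0 hA (κ ^ 2 / 4)
  have b2 := measureReal_le_sMean_sq_le hf (hf4.mono_exponent (by norm_num)) h0 hA (κ / 2)
  rw [eg] at b1
  rw [h2] at b2
  have hMA : (A.card : ℝ)⁻¹ * M ≤ δ := by
    rw [inv_mul_le_iff₀ hc, mul_comm]; exact hM
  have hA1 : (A.card : ℝ)⁻¹ * 1 ≤ δ := le_trans (by gcongr) hMA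
  have hA2 : (A.card : ℝ)⁻¹ * (M - 1) ≤ δ := le_trans (by gcongr; linarith) hMA
  have b1' := b1.trans hA2
  have b2' := b2.trans hA1
  have hsub : {ω : ι → 𝒳 | κ < |sVar A (fun i => f (ω i)) - 1|}
      ⊆ {ω | κ ^ 2 / 4 ≤ sMean A (fun i => f (ω i) ^ 2 - 1) ^ 2}
        ∪ {ω | κ / 2 ≤ sMean A (fun i => f (ω i)) ^ 2} := by
    intro ω hω
    by_contra hcon
    simp only [Set.mem_union, Set.mem_ofPred_eq, not_or, not_le] at hcon hω
    have hsm : sMean A (fun i => f (ω i) ^ 2 - 1) = sMean A (fun i => f (ω i) ^ 2) - 1 := by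
      simpa [sub_eq_add_neg] using sMean_affine hA 1 (-1) (fun i => f (ω i) ^ 2)
    rw [hsm] at hcon
    rw [sVar_eq hA] at hω
    have h3 := abs_lt_of_sq_lt_sq
      (show (sMean A (fun i => f (ω i) ^ 2) - 1) ^ 2 < (κ / 2) ^ 2 by linarith [hcon.1])
      (by positivity)
    have h4 := abs_lt.1 h3
    have h5 := sq_nonneg (sMean A fun i => f (ω i))
    rcases lt_abs.1 hω with h | h <;> linarith [hcon.2]
  refine (measureReal_mono hsub).trans ((measureReal_union_le _ _).trans ?_)
  rw [mul_add]
  refine add_le_add ?_ ?_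
  · rw [mul_div_assoc', le_div_iff₀ (by positivity)]
    linarith
  · rw [mul_div_assoc', le_div_iff₀ hκ]
    linarith

end Studentized

/-- Uniform asymptotic normality of the two-sample studentized statistic. -/
lemma exists_forall_abs_tStat_sub_le (t : ℝ) {ε : ℝ} (hε : 0 < ε) :
    ∃ δ > 0, ∀ {ι : Type} [Fintype ι] {𝒳 : Type*} [MeasurableSpace 𝒳] {P : Measure 𝒳}
      [IsProbabilityMeasure P] {f : 𝒳 → ℝ} {A B : Finset ι},
      Disjoint A B → A.Nonempty → B.Nonempty →
      Measurable f → MemLp f 4 P → ∫ x, f x ∂P = 0 → ∫ x, f x ^ 2 ∂P = 1 →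
      ∫ x, f x ^ 4 ∂P ≤ δ * A.card → ∫ x, f x ^ 4 ∂P ≤ δ * B.card →
      |(Measure.pi fun _ : ι => P).real {ω | tStat A B (fun i => f (ω i)) ≤ t}
        - stdGaussianCDF t| ≤ ε := by
  classical
  obtain ⟨κ, hκ0, hκ1, hκp, hκm⟩ : ∃ κ : ℝ, 0 < κ ∧ κ < 1 ∧
      |stdGaussianCDF (t + |t| * κ) - stdGaussianCDF t| ≤ ε / 4 ∧
      |stdGaussianCDF (t - |t| * κ) - stdGaussianCDF t| ≤ ε / 4 := by
    have c1 : Tendsto (fun κ : ℝ => |stdGaussianCDF (t + |t| * κ) - stdGaussianCDF t|)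
        (𝓝[>] 0) (𝓝 0) := by
      have hc := continuous_stdGaussianCDF
      have : Continuous fun κ : ℝ => |stdGaussianCDF (t + |t| * κ) - stdGaussianCDF t| := by
        fun_prop
      simpa using (this.tendsto 0).mono_left nhdsWithin_le_nhds
    have c2 : Tendsto (fun κ : ℝ => |stdGaussianCDF (t - |t| * κ) - stdGaussianCDF t|)
        (𝓝[>] 0) (𝓝 0) := by
      have hc := continuous_stdGaussianCDF
      have : Continuous fun κ : ℝ => |stdGaussianCDF (t - |t| * κ) - stdGaussianCDF t| := by
        fun_prop
      simpa using (this.tendsto 0).mono_left nhdsWithin_le_nhds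
    have hε4 : 0 < ε / 4 := by positivity
    obtain ⟨κ, h1, h2, h3⟩ := ((c1.eventually_le_const hε4).and ((c2.eventually_le_const hε4).and
      (Ioo_mem_nhdsGT (show (0 : ℝ) < 1 by norm_num)))).exists
    exact ⟨κ, h3.1, h3.2, h1, h2⟩
  have hε4 : 0 < ε / 4 := by positivity
  obtain ⟨δ₁, hδ₁, H₁⟩ := exists_forall_abs_weighted_sum_sub_le (t + |t| * κ) hε4
  obtain ⟨δ₂, hδ₂, H₂⟩ := exists_forall_abs_weighted_sum_sub_le (t - |t| * κ) hε4
  set C := 4 / κ ^ 2 + 2 / κ with hC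
  have hC0 : 0 < C := by positivity
  set δ := min (min δ₁ δ₂) (ε / (4 * C)) with hδ
  have hδ0 : 0 < δ := by positivity
  refine ⟨δ, hδ0, ?_⟩
  intro ι _ 𝒳 _ P _ f A B hAB hA hB hf hf4 h0 h2 hMA hMB
  have hM1 := one_le_integral_pow_four hf4 h2
  set M := ∫ x, f x ^ 4 ∂P with hM
  have hδC : δ * C ≤ ε / 4 := by
    calc δ * C ≤ ε / (4 * C) * C := by gcongr; exact min_le_right _ _
      _ = ε / 4 := by field_simp
  have bA := (measureReal_lt_abs_sVar_sub_one_le hf hf4 h0 h2 hA hκ0 hMA).trans hδC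
  have bB := (measureReal_lt_abs_sVar_sub_one_le hf hf4 h0 h2 hB hκ0 hMB).trans hδC
  have ha : 0 < (A.card : ℝ) := by exact_mod_cast hA.card_pos
  have hb : 0 < (B.card : ℝ) := by exact_mod_cast hB.card_pos
  set q := (A.card : ℝ)⁻¹ + (B.card : ℝ)⁻¹ with hq
  have hq0 : 0 < q := by positivity
  have hsq : √q ^ 2 = q := Real.sq_sqrt hq0.le
  have hα : ∑ i, (contrast A B i / √q) ^ 2 = 1 := by
    simp_rw [div_pow, hsq]
    rw [← Finset.sum_div, sum_contrast_sq hAB, ← hq, div_self hq0.ne']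
  have hbd : ∀ i, (contrast A B i / √q) ^ 2 ≤ δ / M := fun i => by
    rw [div_pow, hsq, div_le_div_iff₀ hq0 (by linarith)]
    exact contrast_sq_mul_le hAB hδ0.le hMA hMB i
  have hδM : δ / M * M = δ := div_mul_cancel₀ _ (by linarith)
  have K₁ := H₁ (P := P) hf hf4 h0 h2 hα hbd
    (hδM.le.trans ((min_le_left _ _).trans (min_le_left _ _)))
  have K₂ := H₂ (P := P) hf hf4 h0 h2 hα hbd
    (hδM.le.trans ((min_le_left _ _).trans (min_le_right _ _)))
  have hT : ∀ ω : ι → 𝒳, ∑ i, contrast A B i / √q * f (ω i)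
      = (sMean A (fun i => f (ω i)) - sMean B (fun i => f (ω i))) / √q := fun ω => by
    rw [← sum_contrast_mul, Finset.sum_div]
    exact Finset.sum_congr rfl fun i _ => by ring
  simp_rw [hT] at K₁ K₂
  have hgood : ∀ ω : ι → 𝒳, ¬ κ < |sVar A (fun i => f (ω i)) - 1| →
      ¬ κ < |sVar B (fun i => f (ω i)) - 1| →
      (tStat A B (fun i => f (ω i)) ≤ t →
        (sMean A (fun i => f (ω i)) - sMean B (fun i => f (ω i))) / √q ≤ t + |t| * κ) ∧
      ((sMean A (fun i => f (ω i)) - sMean B (fun i => f (ω i))) / √q ≤ t - |t| * κ →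
        tStat A B (fun i => f (ω i)) ≤ t) := by
    intro ω h1 h2
    set vA := sVar A (fun i => f (ω i))
    set vB := sVar B (fun i => f (ω i))
    have hv : |(vA / A.card + vB / B.card) / q - 1| ≤ κ := by
      have e : (vA / A.card + vB / B.card) / q - 1
          = ((A.card : ℝ)⁻¹ * (vA - 1) + (B.card : ℝ)⁻¹ * (vB - 1)) / q := by
        rw [eq_div_iff hq0.ne', sub_mul, div_mul_cancel₀ _ hq0.ne', hq]; ring
      rw [e, abs_div, abs_of_pos hq0, div_le_iff₀ hq0]
      refine (abs_add_le _ _).trans ?_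
      rw [abs_mul, abs_mul, abs_of_pos (inv_pos.2 ha), abs_of_pos (inv_pos.2 hb), hq, mul_add,
        mul_comm κ, mul_comm κ]
      gcongr
      · exact not_lt.1 h1
      · exact not_lt.1 h2
    have e2 : tStat A B (fun i => f (ω i))
        = (sMean A (fun i => f (ω i)) - sMean B (fun i => f (ω i))) / √q
          / √((vA / A.card + vB / B.card) / q) := by
      rw [Real.sqrt_div' _ hq0.le, tStat, div_div, mul_div_cancel₀ _ (Real.sqrt_pos.2 hq0).ne']
    rw [e2]
    exact div_sqrt_le_iff_bounds hκ1 hv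
  have hup := (measureReal_mono (μ := Measure.pi fun _ : ι => P)
    (show {ω | tStat A B (fun i => f (ω i)) ≤ t} ⊆
      {ω | (sMean A (fun i => f (ω i)) - sMean B (fun i => f (ω i))) / √q ≤ t + |t| * κ} ∪
      ({ω | κ < |sVar A (fun i => f (ω i)) - 1|} ∪ {ω | κ < |sVar B (fun i => f (ω i)) - 1|}) from
      fun ω hω => by
        by_contra hcon
        simp only [Set.mem_union, not_or] at hcon
        exact hcon.1 ((hgood ω hcon.2.1 hcon.2.2).1 hω))).trans ((measureReal_union_le _ _).trans
          (add_le_add_right (measureReal_union_le _ _) _))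
  have hlo := (measureReal_mono (μ := Measure.pi fun _ : ι => P)
    (show {ω | (sMean A (fun i => f (ω i)) - sMean B (fun i => f (ω i))) / √q ≤ t - |t| * κ} ⊆
      {ω | tStat A B (fun i => f (ω i)) ≤ t} ∪
      ({ω | κ < |sVar A (fun i => f (ω i)) - 1|} ∪ {ω | κ < |sVar B (fun i => f (ω i)) - 1|}) from
      fun ω hω => by
        by_contra hcon
        simp only [Set.mem_union, not_or] at hcon
        exact hcon.1 ((hgood ω hcon.2.1 hcon.2.2).2 hω))).trans ((measureReal_union_le _ _).trans
          (add_le_add_right (measureReal_union_le _ _) _))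
  have K₁' := abs_le.1 K₁
  have K₂' := abs_le.1 K₂
  have hκp' := abs_le.1 hκp
  have hκm' := abs_le.1 hκm
  rw [abs_le]
  constructor <;> linarith

lemma measurePreserving_piecewise {ι : Type*} [Fintype ι] [DecidableEq ι] (P : Measure 𝒳)
    [IsProbabilityMeasure P] (S : Finset ι) :
    MeasurePreserving (fun p : (ι → 𝒳) × (ι → 𝒳) => S.piecewise p.1 p.2)
      ((Measure.pi fun _ => P).prod (Measure.pi fun _ => P)) (Measure.pi fun _ => P) := by
  have hm : Measurable fun p : (ι → 𝒳) × (ι → 𝒳) => S.piecewise p.1 p.2 := by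
    refine measurable_pi_lambda _ fun i => ?_
    by_cases hi : i ∈ S
    · simp only [Finset.piecewise, hi, if_true]; fun_prop
    · simp only [Finset.piecewise, hi, if_false]; fun_prop
  refine ⟨hm, (Measure.pi_eq fun s hs => ?_).symm⟩
  rw [Measure.map_apply hm (MeasurableSet.univ_pi hs)]
  have : (fun p : (ι → 𝒳) × (ι → 𝒳) => S.piecewise p.1 p.2) ⁻¹' Set.univ.pi s
      = (Set.univ.pi fun i => if i ∈ S then s i else Set.univ) ×ˢ
        (Set.univ.pi fun i => if i ∈ S then Set.univ else s i) := by
    ext p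
    simp only [Set.mem_preimage, Set.mem_pi, Set.mem_univ, true_imp_iff, Set.mem_prod,
      ← forall_and]
    refine forall_congr' fun i => ?_
    by_cases hi : i ∈ S <;> simp [hi]
  rw [this, Measure.prod_prod, Measure.pi_pi, Measure.pi_pi, ← Finset.prod_mul_distrib]
  refine Finset.prod_congr rfl fun i _ => ?_
  by_cases hi : i ∈ S <;> simp [hi]

lemma abs_measureReal_prod_sub_le {Ω Ω' : Type*} [MeasurableSpace Ω] [MeasurableSpace Ω']
    (μ : Measure Ω) (ν : Measure Ω') [IsProbabilityMeasure μ] [IsProbabilityMeasure ν]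
    {D : Set (Ω × Ω')} (hD : MeasurableSet D) {G : Set Ω'} (hG : MeasurableSet G) {a ε : ℝ}
    (ha0 : 0 ≤ a) (ha1 : a ≤ 1) (hε : 0 ≤ ε)
    (h : ∀ y ∈ G, |μ.real {x | (x, y) ∈ D} - a| ≤ ε) :
    |(μ.prod ν).real D - a| ≤ ε + ν.real Gᶜ := by
  have hmeas : Measurable fun y => μ.real {x | (x, y) ∈ D} :=
    (measurable_measure_prodMk_right hD).ennreal_toReal
  have hF : (μ.prod ν).real D = ∫ y, μ.real {x | (x, y) ∈ D} ∂ν := by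
    rw [measureReal_def, Measure.prod_apply_symm hD]
    exact (integral_toReal (measurable_measure_prodMk_right hD).aemeasurable
      (ae_of_all _ fun y => measure_lt_top _ _)).symm
  have hint : Integrable (fun y => μ.real {x | (x, y) ∈ D}) ν :=
    Integrable.of_bound hmeas.aestronglyMeasurable 1 (ae_of_all _ fun y => by
      rw [Real.norm_of_nonneg measureReal_nonneg]; exact measureReal_le_one)
  have hind : Integrable (Gᶜ.indicator fun _ => (1 : ℝ)) ν :=
    (integrable_const _).indicator hG.compl
  calc |(μ.prod ν).real D - a| = |∫ y, (μ.real {x | (x, y) ∈ D} - a) ∂ν| := by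
        rw [integral_sub hint (integrable_const _), hF]; simp
    _ ≤ ∫ y, |μ.real {x | (x, y) ∈ D} - a| ∂ν := abs_integral_le_integral_abs
    _ ≤ ∫ y, (ε + Gᶜ.indicator (fun _ => (1 : ℝ)) y) ∂ν := by
        refine integral_mono (hint.sub (integrable_const _)).abs
          ((integrable_const _).add hind) fun y => ?_
        by_cases hy : y ∈ G
        · simpa [hy] using h y hy
        · have h0 := measureReal_nonneg (μ := μ) (s := {x | (x, y) ∈ D})
          have h1 := measureReal_le_one (μ := μ) (s := {x | (x, y) ∈ D})
          simp only [Set.mem_compl_iff, hy, not_false_eq_true, Set.indicator_of_mem]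
          rw [abs_le]; constructor <;> linarith
    _ = ε + ν.real Gᶜ := by
        rw [integral_add (integrable_const _) hind, integral_indicator_const _ hG.compl]; simp

section Feature

variable {P : Measure 𝒳} [IsProbabilityMeasure P] {ψ : 𝒳 → H}

lemma inner_setIntegral_sq_le (hi : Integrable ψ P) (A : Set 𝒳) {h : H}
    (h2 : MemLp (fun x => ⟪ψ x, h⟫) 2 P) :
    ⟪∫ x in A, ψ x ∂P, h⟫ ^ 2 ≤ ∫ x, ⟪ψ x, h⟫ ^ 2 ∂P := by
  have e : ⟪∫ x in A, ψ x ∂P, h⟫ = ∫ x in A, ⟪ψ x, h⟫ ∂P := by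
    rw [real_inner_comm, ← integral_inner hi.integrableOn]
    simp_rw [real_inner_comm]
  have i1 : Integrable (fun x => ⟪ψ x, h⟫) (P.restrict A) := (hi.inner_const h).integrableOn
  have i2 : Integrable (fun x => ⟪ψ x, h⟫ ^ 2) (P.restrict A) := h2.integrable_sq.integrableOn
  rw [e]
  set c := ∫ x in A, ⟪ψ x, h⟫ ∂P with hc
  have h3 : ∫ x in A, (2 * c * ⟪ψ x, h⟫ - c ^ 2) ∂P ≤ ∫ x in A, ⟪ψ x, h⟫ ^ 2 ∂P :=
    integral_mono ((i1.const_mul _).sub (integrable_const _)) i2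
      fun x => by nlinarith [sq_nonneg (⟪ψ x, h⟫ - c)]
  rw [integral_sub (i1.const_mul _) (integrable_const _), integral_const_mul, ← hc] at h3
  simp only [integral_const, smul_eq_mul, measureReal_restrict_apply_univ] at h3
  have h4 : ∫ x in A, ⟪ψ x, h⟫ ^ 2 ∂P ≤ ∫ x, ⟪ψ x, h⟫ ^ 2 ∂P :=
    setIntegral_le_integral h2.integrable_sq (ae_of_all _ fun x => sq_nonneg _)
  have h5 : P.real A ≤ 1 := measureReal_le_one
  nlinarith [sq_nonneg c]

variable [MeasurableSpace H] [BorelSpace H] [SecondCountableTopology H]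

lemma exists_inner_memLp_four (hψ : Measurable ψ) (hi : Integrable ψ P)
    (hk : Integrable (fun p : 𝒳 × 𝒳 => ⟪ψ p.1, ψ p.2⟫ ^ 4) (P.prod P))
    (hpos : 0 < ∫ x, ∫ y, ⟪ψ x, ψ y⟫ ^ 4 ∂P ∂P) :
    ∃ w : H, MemLp (fun x => ⟪w, ψ x⟫) 4 P ∧ 0 < ∫ x, ⟪w, ψ x⟫ ^ 2 ∂P ∧
      ∀ h : H, MemLp (fun x => ⟪ψ x, h⟫) 2 P → ⟪w, h⟫ ^ 2 ≤ ∫ x, ⟪ψ x, h⟫ ^ 2 ∂P := by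
  have hL : ∀ᵐ y ∂P, MemLp (fun x => ⟪ψ x, ψ y⟫) 4 P := by
    filter_upwards [hk.prod_left_ae] with y hy
    exact memLp_nat_of_integrable_pow (p := 4) (by norm_num) (by decide)
      (by fun_prop) hy
  have h4 : ∀ A : Set 𝒳, MemLp (fun x => ⟪∫ x in A, ψ x ∂P, ψ x⟫) 4 P := fun A => by
    refine memLp_nat_of_integrable_pow (p := 4) (by norm_num) (by decide) (by fun_prop) ?_
    refine hk.integral_prod_right.mono' (by fun_prop) ?_
    filter_upwards [hL] with y hy
    have s1 := inner_setIntegral_sq_le hi A (hy.mono_exponent (by norm_num))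
    have s2 := sq_integral_sq_le_integral_pow_four hy
    rw [Real.norm_of_nonneg (by positivity)]
    calc ⟪∫ x in A, ψ x ∂P, ψ y⟫ ^ 4 = (⟪∫ x in A, ψ x ∂P, ψ y⟫ ^ 2) ^ 2 := by ring
      _ ≤ (∫ x, ⟪ψ x, ψ y⟫ ^ 2 ∂P) ^ 2 := by gcongr
      _ ≤ _ := s2
  by_contra! hcon
  have hz : ∀ A, MeasurableSet A → ∫ x in A, ψ x ∂P = 0 := fun A _ => by
    set w := ∫ x in A, ψ x ∂P with hw
    have hle : ¬ 0 < ∫ x, ⟪w, ψ x⟫ ^ 2 ∂P := fun h => by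
      obtain ⟨v, hv, hv'⟩ := hcon w (h4 A) h
      exact absurd (inner_setIntegral_sq_le hi A hv) (not_le.2 hv')
    have i2 : Integrable (fun x => ⟪w, ψ x⟫ ^ 2) P :=
      integrable_pow_of_memLp (p := 4) (h4 A) (by norm_num)
    have h0 : ∫ x, ⟪w, ψ x⟫ ^ 2 ∂P = 0 :=
      le_antisymm (not_lt.1 hle) (integral_nonneg fun x => sq_nonneg _)
    rw [integral_eq_zero_iff_of_nonneg (fun x => sq_nonneg _) i2] at h0
    have h1 : ∫ x in A, ⟪w, ψ x⟫ ∂P = 0 := by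
      refine integral_eq_zero_of_ae (ae_restrict_of_ae ?_)
      filter_upwards [h0] with x hx
      simpa using hx
    rw [integral_inner hi.integrableOn, ← hw] at h1
    exact inner_self_eq_zero.1 h1
  have hae : ψ =ᵐ[P] 0 := hi.ae_eq_zero_of_forall_setIntegral_eq_zero fun A hA _ => hz A hA
  refine hpos.ne' (integral_eq_zero_of_ae ?_)
  filter_upwards [hae] with x hx
  simp [hx]

lemma lintegral_inner_weighted_sum_pow_four_le {ι : Type*} [Fintype ι] (hψ : Measurable ψ)
    (hi : Integrable ψ P) (h0 : ∫ x, ψ x ∂P = 0)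
    (hk : Integrable (fun p : 𝒳 × 𝒳 => ⟪ψ p.1, ψ p.2⟫ ^ 4) (P.prod P)) (α : ι → ℝ) :
    ∫⁻ ω : ι → 𝒳, ∫⁻ x, ENNReal.ofReal (⟪ψ x, ∑ i, α i • ψ (ω i)⟫ ^ 4) ∂P ∂(Measure.pi fun _ => P)
      ≤ ENNReal.ofReal (3 * (∑ i, α i ^ 2) ^ 2 * ∫ x, ∫ y, ⟪ψ x, ψ y⟫ ^ 4 ∂P ∂P) := by
  rw [lintegral_lintegral_swap (by fun_prop)]
  have hK : 0 ≤ 3 * (∑ i, α i ^ 2) ^ 2 := by positivity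
  calc ∫⁻ x, ∫⁻ ω : ι → 𝒳, ENNReal.ofReal (⟪ψ x, ∑ i, α i • ψ (ω i)⟫ ^ 4)
          ∂(Measure.pi fun _ => P) ∂P
      ≤ ∫⁻ x, ENNReal.ofReal (3 * (∑ i, α i ^ 2) ^ 2 * ∫ y, ⟪ψ x, ψ y⟫ ^ 4 ∂P) ∂P := by
        refine lintegral_mono_ae ?_
        filter_upwards [hk.prod_right_ae] with x hx
        have hg : Measurable fun y => ⟪ψ x, ψ y⟫ := by fun_prop
        have hg0 : ∫ y, ⟪ψ x, ψ y⟫ ∂P = 0 := by rw [integral_inner hi, h0, inner_zero_right]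
        have hg4 : MemLp (fun y => ⟪ψ x, ψ y⟫) 4 P :=
          memLp_nat_of_integrable_pow (p := 4) (by norm_num) (by decide)
            hg.aestronglyMeasurable hx
        obtain ⟨hS, hS4⟩ := integral_weighted_sum_pow_four_le hg hg4 hg0 α Finset.univ
        simp_rw [inner_sum, real_inner_smul_right]
        rw [← ofReal_integral_eq_lintegral_ofReal
          (integrable_pow_of_memLp (p := 4) hS le_rfl) (ae_of_all _ fun _ => by positivity)]
        exact ENNReal.ofReal_le_ofReal hS4
    _ = _ := by
        rw [← integral_const_mul, ofReal_integral_eq_lintegral_ofReal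
          (hk.integral_prod_left.const_mul _) (ae_of_all _ fun x =>
            mul_nonneg hK (integral_nonneg fun y => by positivity))]

end Feature

lemma contrast_eq_zero {ι : Type*} [DecidableEq ι] {A B : Finset ι} {i : ι} (hi : i ∉ A ∪ B) :
    contrast A B i = 0 := by
  simp only [Finset.mem_union, not_or] at hi
  simp [contrast, hi.1, hi.2]

lemma tStat_congr {ι : Type*} {A B : Finset ι} {u v : ι → ℝ} (hA : ∀ i ∈ A, u i = v i)
    (hB : ∀ i ∈ B, u i = v i) : tStat A B u = tStat A B v := by
  have mA : sMean A u = sMean A v := by rw [sMean, sMean, Finset.sum_congr rfl hA]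
  have mB : sMean B u = sMean B v := by rw [sMean, sMean, Finset.sum_congr rfl hB]
  have vA : sVar A u = sVar A v := by
    rw [sVar, sVar, mA, Finset.sum_congr rfl fun i hi => by rw [hA i hi]]
  have vB : sVar B u = sVar B v := by
    rw [sVar, sVar, mB, Finset.sum_congr rfl fun i hi => by rw [hB i hi]]
  rw [tStat, tStat, mA, mB, vA, vB]

/-- Scale-free form of `exists_forall_abs_tStat_sub_le`. -/
lemma exists_forall_abs_tStat_sub_le_of_pos (t : ℝ) {ε : ℝ} (hε : 0 < ε) :
    ∃ δ > 0, ∀ {ι : Type} [Fintype ι] {𝒳 : Type*} [MeasurableSpace 𝒳] {P : Measure 𝒳}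
      [IsProbabilityMeasure P] {f : 𝒳 → ℝ} {A B : Finset ι},
      Disjoint A B → A.Nonempty → B.Nonempty →
      Measurable f → MemLp f 4 P → ∫ x, f x ∂P = 0 → 0 < ∫ x, f x ^ 2 ∂P →
      ∫ x, f x ^ 4 ∂P ≤ δ * A.card * (∫ x, f x ^ 2 ∂P) ^ 2 →
      ∫ x, f x ^ 4 ∂P ≤ δ * B.card * (∫ x, f x ^ 2 ∂P) ^ 2 →
      |(Measure.pi fun _ : ι => P).real {ω | tStat A B (fun i => f (ω i)) ≤ t}
        - stdGaussianCDF t| ≤ ε := by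
  obtain ⟨δ, hδ, hmain⟩ := exists_forall_abs_tStat_sub_le t hε
  refine ⟨δ, hδ, ?_⟩
  intro ι _ 𝒳 _ P _ f A B hAB hA hB hf hf4 h0 hv hMA hMB
  set v := ∫ x, f x ^ 2 ∂P with hvdef
  have hs : 0 < (√v)⁻¹ := inv_pos.2 (Real.sqrt_pos.2 hv)
  have hs2 : (√v)⁻¹ ^ 2 = v⁻¹ := by rw [inv_pow, Real.sq_sqrt hv.le]
  have hs4 : (√v)⁻¹ ^ 4 = (v ^ 2)⁻¹ := by
    rw [show (√v)⁻¹ ^ 4 = ((√v)⁻¹ ^ 2) ^ 2 by ring, hs2, inv_pow]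
  have e4 : ∫ x, ((√v)⁻¹ * f x) ^ 4 ∂P = (v ^ 2)⁻¹ * ∫ x, f x ^ 4 ∂P := by
    simp_rw [mul_pow, hs4]; rw [integral_const_mul]
  have key := hmain (P := P) (f := fun x => (√v)⁻¹ * f x) hAB hA hB (by fun_prop)
    (hf4.const_mul _) (by rw [integral_const_mul, h0, mul_zero])
    (by simp_rw [mul_pow, hs2]; rw [integral_const_mul, ← hvdef, inv_mul_cancel₀ hv.ne'])
    (by rw [e4, inv_mul_le_iff₀ (by positivity), mul_comm]; exact hMA)
    (by rw [e4, inv_mul_le_iff₀ (by positivity), mul_comm]; exact hMB)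
  have e : ∀ ω : ι → 𝒳, tStat A B (fun i => (√v)⁻¹ * f (ω i)) = tStat A B (fun i => f (ω i)) :=
    fun ω => by simpa using tStat_affine hA hB hs 0 (fun i => f (ω i))
  simpa only [e] using key

/-- Anti-concentration of the difference of means. -/
lemma exists_forall_measureReal_contrast_sq_le {P : Measure 𝒳} [IsProbabilityMeasure P]
    {g : 𝒳 → ℝ} (hg : Measurable g) (hg4 : MemLp g 4 P) (h0 : ∫ x, g x ∂P = 0)
    (hv : 0 < ∫ x, g x ^ 2 ∂P) {ε : ℝ} (hε : 0 < ε) :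
    ∃ c > 0, ∃ N : ℕ, ∀ {ι : Type} [Fintype ι] [DecidableEq ι] {A B : Finset ι},
      Disjoint A B → A.Nonempty → B.Nonempty → N ≤ A.card → N ≤ B.card →
      (Measure.pi fun _ : ι => P).real
        {ω | (∑ i, contrast A B i * g (ω i)) ^ 2 ≤ c * ((A.card : ℝ)⁻¹ + (B.card : ℝ)⁻¹)} ≤ ε := by
  obtain ⟨κ, hκ, hκε⟩ : ∃ κ : ℝ, 0 < κ ∧
      |stdGaussianCDF κ - stdGaussianCDF (-(2 * κ))| ≤ ε / 3 := by
    have hc := continuous_stdGaussianCDF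
    have hc' : Continuous fun κ : ℝ => |stdGaussianCDF κ - stdGaussianCDF (-(2 * κ))| := by
      fun_prop
    have c1 : Tendsto (fun κ : ℝ => |stdGaussianCDF κ - stdGaussianCDF (-(2 * κ))|)
        (𝓝[>] 0) (𝓝 0) := by
      simpa using (hc'.tendsto 0).mono_left nhdsWithin_le_nhds
    obtain ⟨κ, h1, h2⟩ := ((c1.eventually_le_const (show 0 < ε / 3 by positivity)).and
      self_mem_nhdsWithin).exists
    exact ⟨κ, h2, h1⟩
  have hε3 : 0 < ε / 3 := by positivity
  obtain ⟨δ₁, hδ₁, H₁⟩ := exists_forall_abs_weighted_sum_sub_le κ hε3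
  obtain ⟨δ₂, hδ₂, H₂⟩ := exists_forall_abs_weighted_sum_sub_le (-(2 * κ)) hε3
  set δ := min δ₁ δ₂ with hδ
  have hδ0 : 0 < δ := by positivity
  set v := ∫ x, g x ^ 2 ∂P with hvdef
  set f : 𝒳 → ℝ := fun x => (√v)⁻¹ * g x with hfdef
  have hsv : 0 < √v := Real.sqrt_pos.2 hv
  have hf4 : MemLp f 4 P := hg4.const_mul _
  have hf0 : ∫ x, f x ∂P = 0 := by rw [integral_const_mul, h0, mul_zero]
  have hf2 : ∫ x, f x ^ 2 ∂P = 1 := by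
    simp_rw [hfdef, mul_pow, inv_pow, Real.sq_sqrt hv.le]
    rw [integral_const_mul, ← hvdef, inv_mul_cancel₀ hv.ne']
  have hM1 := one_le_integral_pow_four hf4 hf2
  set M := ∫ x, f x ^ 4 ∂P with hM
  refine ⟨κ ^ 2 * v, by positivity, ⌈M / δ⌉₊, ?_⟩
  intro ι _ _ A B hAB hA hB hNA hNB
  have ha : 0 < (A.card : ℝ) := by exact_mod_cast hA.card_pos
  have hb : 0 < (B.card : ℝ) := by exact_mod_cast hB.card_pos
  have hMA : M ≤ δ * A.card := by rw [← div_le_iff₀' hδ0]; exact Nat.ceil_le.1 hNA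
  have hMB : M ≤ δ * B.card := by rw [← div_le_iff₀' hδ0]; exact Nat.ceil_le.1 hNB
  set q := (A.card : ℝ)⁻¹ + (B.card : ℝ)⁻¹ with hq
  have hq0 : 0 < q := by positivity
  have hsq : √q ^ 2 = q := Real.sq_sqrt hq0.le
  have hsq0 : 0 < √q := Real.sqrt_pos.2 hq0
  have hα : ∑ i, (contrast A B i / √q) ^ 2 = 1 := by
    simp_rw [div_pow, hsq]
    rw [← Finset.sum_div, sum_contrast_sq hAB, ← hq, div_self hq0.ne']
  have hbd : ∀ i, (contrast A B i / √q) ^ 2 ≤ δ / M := fun i => by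
    rw [div_pow, hsq, div_le_div_iff₀ hq0 (by linarith)]
    exact contrast_sq_mul_le hAB hδ0.le hMA hMB i
  have hδM : δ / M * M = δ := div_mul_cancel₀ _ (by linarith)
  have hfm : Measurable f := by fun_prop
  have K₁ := abs_le.1 (H₁ (P := P) hfm hf4 hf0 hf2 hα hbd (hδM.le.trans (min_le_left _ _)))
  have K₂ := abs_le.1 (H₂ (P := P) hfm hf4 hf0 hf2 hα hbd (hδM.le.trans (min_le_right _ _)))
  have hκ' := abs_le.1 hκε
  have hT : ∀ ω : ι → 𝒳, ∑ i, contrast A B i / √q * f (ω i)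
      = (∑ i, contrast A B i * g (ω i)) / (√q * √v) := fun ω => by
    rw [Finset.sum_div]
    exact Finset.sum_congr rfl fun i _ => by rw [hfdef]; field_simp
  have hsub : {ω : ι → 𝒳 | (∑ i, contrast A B i * g (ω i)) ^ 2 ≤ κ ^ 2 * v * q} ⊆
      {ω | ∑ i, contrast A B i / √q * f (ω i) ≤ κ} \
        {ω | ∑ i, contrast A B i / √q * f (ω i) ≤ -(2 * κ)} := by
    intro ω hω
    simp only [Set.mem_ofPred_eq] at hω
    have h1 : |∑ i, contrast A B i / √q * f (ω i)| ≤ κ := by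
      refine abs_le_of_sq_le_sq ?_ hκ.le
      rw [hT, div_pow, mul_pow, hsq, Real.sq_sqrt hv.le, div_le_iff₀ (by positivity)]
      linarith
    have h2 := abs_le.1 h1
    refine ⟨h2.2, ?_⟩
    simp only [Set.mem_ofPred_eq, not_le]
    linarith
  have hmeas : MeasurableSet {ω : ι → 𝒳 | ∑ i, contrast A B i / √q * f (ω i) ≤ -(2 * κ)} :=
    measurableSet_le (by fun_prop) measurable_const
  refine (measureReal_mono hsub).trans ?_
  rw [measureReal_sdiff (fun ω hω => by
    simp only [Set.mem_ofPred_eq] at hω ⊢; linarith) hmeas]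
  linarith

section Feature

variable {P : Measure 𝒳} [IsProbabilityMeasure P] {ψ : 𝒳 → H}
variable [MeasurableSpace H] [BorelSpace H] [SecondCountableTopology H]

omit [CompleteSpace H] in
/-- Conditioning on one half of the coordinates for the cross statistic. -/
lemma abs_cross_tStat_sub_le {ι : Type*} [Fintype ι] [DecidableEq ι] (hψ : Measurable ψ)
    {A₁ B₁ A₂ B₂ : Finset ι} (hdisj : Disjoint (A₁ ∪ B₁) (A₂ ∪ B₂)) {G : Set (ι → 𝒳)}
    (hG : MeasurableSet G) {t a ε : ℝ} (ha0 : 0 ≤ a) (ha1 : a ≤ 1) (hε : 0 ≤ ε)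
    (h : ∀ y ∈ G, |(Measure.pi fun _ : ι => P).real
      {ω | tStat A₁ B₁ (fun i => ⟪ψ (ω i), ∑ j, contrast A₂ B₂ j • ψ (y j)⟫) ≤ t} - a| ≤ ε) :
    |(Measure.pi fun _ : ι => P).real
      {ω | tStat A₁ B₁ (fun i => ⟪ψ (ω i), ∑ j, contrast A₂ B₂ j • ψ (ω j)⟫) ≤ t} - a|
      ≤ ε + (Measure.pi fun _ : ι => P).real Gᶜ := by
  set D : Set ((ι → 𝒳) × (ι → 𝒳)) :=
    {p | tStat A₁ B₁ (fun i => ⟪ψ (p.1 i), ∑ j, contrast A₂ B₂ j • ψ (p.2 j)⟫) ≤ t} with hDdef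
  have hD : MeasurableSet D := by
    refine measurableSet_le ?_ measurable_const
    unfold tStat sVar sMean
    fun_prop
  have hE : MeasurableSet {ω : ι → 𝒳 |
      tStat A₁ B₁ (fun i => ⟪ψ (ω i), ∑ j, contrast A₂ B₂ j • ψ (ω j)⟫) ≤ t} := by
    refine measurableSet_le ?_ measurable_const
    unfold tStat sVar sMean
    fun_prop
  have hpre : (fun p : (ι → 𝒳) × (ι → 𝒳) => (A₁ ∪ B₁).piecewise p.1 p.2) ⁻¹'
      {ω | tStat A₁ B₁ (fun i => ⟪ψ (ω i), ∑ j, contrast A₂ B₂ j • ψ (ω j)⟫) ≤ t} = D := by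
    ext p
    have hsum : ∑ j, contrast A₂ B₂ j • ψ ((A₁ ∪ B₁).piecewise p.1 p.2 j)
        = ∑ j, contrast A₂ B₂ j • ψ (p.2 j) := by
      refine Finset.sum_congr rfl fun j _ => ?_
      by_cases hj : j ∈ A₂ ∪ B₂
      · rw [Finset.piecewise_eq_of_notMem _ _ _ (Finset.disjoint_right.1 hdisj hj)]
      · rw [contrast_eq_zero hj, zero_smul, zero_smul]
    simp only [Set.mem_preimage, Set.mem_ofPred_eq, hDdef, hsum]
    rw [tStat_congr (v := fun i => ⟪ψ (p.1 i), ∑ j, contrast A₂ B₂ j • ψ (p.2 j)⟫)]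
    · intro i hi
      rw [Finset.piecewise_eq_of_mem _ _ _ (Finset.mem_union_left _ hi)]
    · intro i hi
      rw [Finset.piecewise_eq_of_mem _ _ _ (Finset.mem_union_right _ hi)]
  rw [← (measurePreserving_piecewise P (A₁ ∪ B₁)).measureReal_preimage hE.nullMeasurableSet, hpre]
  exact abs_measureReal_prod_sub_le _ _ hD hG ha0 ha1 hε h

lemma exists_forall_abs_cross_tStat_sub_le (hψ : Measurable ψ) (hi : Integrable ψ P)
    (h0 : ∫ x, ψ x ∂P = 0)
    (hk : Integrable (fun p : 𝒳 × 𝒳 => ⟪ψ p.1, ψ p.2⟫ ^ 4) (P.prod P))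
    (hpos : 0 < ∫ x, ∫ y, ⟪ψ x, ψ y⟫ ^ 4 ∂P ∂P) (t : ℝ) {ε : ℝ} (hε : 0 < ε) :
    ∃ N : ℕ, ∀ {ι : Type} [Fintype ι] [DecidableEq ι] {A₁ B₁ A₂ B₂ : Finset ι},
      Disjoint A₁ B₁ → Disjoint A₂ B₂ → Disjoint (A₁ ∪ B₁) (A₂ ∪ B₂) →
      N ≤ A₁.card → N ≤ B₁.card → N ≤ A₂.card → N ≤ B₂.card →
      |(Measure.pi fun _ : ι => P).real
        {ω | tStat A₁ B₁ (fun i => ⟪ψ (ω i), ∑ j, contrast A₂ B₂ j • ψ (ω j)⟫) ≤ t}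
        - stdGaussianCDF t| ≤ ε := by
  obtain ⟨w, hw4, hw2, hwle⟩ := exists_inner_memLp_four hψ hi hk hpos
  have hε3 : 0 < ε / 3 := by positivity
  obtain ⟨c, hc, N₁, hN₁⟩ := exists_forall_measureReal_contrast_sq_le (g := fun x => ⟪w, ψ x⟫)
    (by fun_prop) hw4 (by rw [integral_inner hi, h0, inner_zero_right]) hw2 hε3
  obtain ⟨δ, hδ, hmain⟩ := exists_forall_abs_tStat_sub_le_of_pos t hε3
  set K := ∫ x, ∫ y, ⟪ψ x, ψ y⟫ ^ 4 ∂P ∂P with hK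
  set N := max (max N₁ 1) ⌈3 * K / (δ * c ^ 2 * (ε / 3))⌉₊ with hN
  refine ⟨N, ?_⟩
  intro ι _ _ A₁ B₁ A₂ B₂ hAB₁ hAB₂ hdisj hA₁ hB₁ hA₂ hB₂
  have hN₁N : N₁ ≤ N := (le_max_left _ _).trans (le_max_left _ _)
  have h1N : 1 ≤ N := (le_max_right _ _).trans (le_max_left _ _)
  have hNr : 0 < (N : ℝ) := by exact_mod_cast h1N
  have hKN : 3 * K ≤ N * (δ * c ^ 2 * (ε / 3)) := by
    rw [← div_le_iff₀ (by positivity)]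
    exact Nat.ceil_le.1 (le_max_right _ _)
  have ne : ∀ {S : Finset ι}, N ≤ S.card → S.Nonempty := fun h =>
    Finset.card_pos.1 (by omega)
  have ha : 0 < (A₂.card : ℝ) := by exact_mod_cast (ne hA₂).card_pos
  have hb : 0 < (B₂.card : ℝ) := by exact_mod_cast (ne hB₂).card_pos
  set q := (A₂.card : ℝ)⁻¹ + (B₂.card : ℝ)⁻¹ with hq
  have hq0 : 0 < q := by positivity
  set S : (ι → 𝒳) → H := fun y => ∑ j, contrast A₂ B₂ j • ψ (y j) with hS
  have hSm : Measurable S := by fun_prop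
  set L := δ * N * (c * q) ^ 2 with hL
  have hL0 : 0 < L := by positivity
  set G₁ : Set (ι → 𝒳) := {y | ⟪w, S y⟫ ^ 2 ≤ c * q}
  set G₂ : Set (ι → 𝒳) :=
    {y | ENNReal.ofReal L ≤ ∫⁻ x, ENNReal.ofReal (⟪ψ x, S y⟫ ^ 4) ∂P}
  have hG₁ : MeasurableSet G₁ := measurableSet_le (by fun_prop) measurable_const
  have hFm : Measurable fun y => ∫⁻ x, ENNReal.ofReal (⟪ψ x, S y⟫ ^ 4) ∂P :=
    Measurable.lintegral_prod_right' (f := fun p : (ι → 𝒳) × 𝒳 =>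
      ENNReal.ofReal (⟪ψ p.2, S p.1⟫ ^ 4)) (by fun_prop)
  have hG₂ : MeasurableSet G₂ := measurableSet_le measurable_const hFm
  have hP₁ : (Measure.pi fun _ : ι => P).real G₁ ≤ ε / 3 := by
    have := hN₁ (ι := ι) hAB₂ (ne hA₂) (ne hB₂) (hN₁N.trans hA₂) (hN₁N.trans hB₂)
    simpa only [G₁, hS, inner_sum, real_inner_smul_right] using this
  have hP₂ : (Measure.pi fun _ : ι => P).real G₂ ≤ ε / 3 := by
    have hb := lintegral_inner_weighted_sum_pow_four_le hψ hi h0 hk (contrast A₂ B₂)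
    rw [sum_contrast_sq hAB₂, ← hq, ← hK] at hb
    have hmk := (mul_meas_ge_le_lintegral₀ (μ := Measure.pi fun _ : ι => P) hFm.aemeasurable
      (ENNReal.ofReal L)).trans hb
    have hmk' : L * (Measure.pi fun _ : ι => P).real G₂ ≤ 3 * q ^ 2 * K := by
      have := ENNReal.toReal_mono ENNReal.ofReal_ne_top hmk
      rwa [ENNReal.toReal_mul, ENNReal.toReal_ofReal hL0.le,
        ENNReal.toReal_ofReal (by positivity)] at this
    refine le_of_mul_le_mul_left (hmk'.trans ?_) hL0
    calc 3 * q ^ 2 * K = q ^ 2 * (3 * K) := by ring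
      _ ≤ q ^ 2 * (N * (δ * c ^ 2 * (ε / 3))) := by gcongr
      _ = L * (ε / 3) := by rw [hL]; ring
  have key := abs_cross_tStat_sub_le (P := P) hψ hdisj (hG₁.union hG₂).compl (t := t)
    (a := stdGaussianCDF t) (ε := ε / 3) ENNReal.toReal_nonneg
    (measureReal_le_one (μ := gaussianReal 0 1)) hε3.le fun y hy => by
      simp only [Set.mem_compl_iff, Set.mem_union, not_or] at hy
      obtain ⟨hy₁, hy₂⟩ := hy
      have hy₁ : c * q < ⟪w, S y⟫ ^ 2 := not_le.1 hy₁
      have hy₂ : ∫⁻ x, ENNReal.ofReal (⟪ψ x, S y⟫ ^ 4) ∂P < ENNReal.ofReal L := not_le.1 hy₂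
      have hfm : Measurable fun x => ⟪ψ x, S y⟫ := by fun_prop
      have i4 : Integrable (fun x => ⟪ψ x, S y⟫ ^ 4) P :=
        (lintegral_ofReal_ne_top_iff_integrable (by fun_prop)
          (ae_of_all _ fun x => by positivity)).1 (hy₂.trans ENNReal.ofReal_lt_top).ne
      have hf4 : MemLp (fun x => ⟪ψ x, S y⟫) 4 P :=
        memLp_nat_of_integrable_pow (p := 4) (by norm_num) (by decide)
          hfm.aestronglyMeasurable i4
      have hv := hy₁.trans_le (hwle (S y) (hf4.mono_exponent (by norm_num)))
      have hv0 : 0 < ∫ x, ⟪ψ x, S y⟫ ^ 2 ∂P := lt_trans (by positivity) hv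
      have hM : ∫ x, ⟪ψ x, S y⟫ ^ 4 ∂P ≤ L := by
        rw [integral_eq_lintegral_of_nonneg_ae (ae_of_all _ fun x => by positivity) i4.1]
        exact ENNReal.toReal_le_of_le_ofReal hL0.le hy₂.le
      have hML : ∀ {T : Finset ι}, N ≤ T.card →
          ∫ x, ⟪ψ x, S y⟫ ^ 4 ∂P ≤ δ * T.card * (∫ x, ⟪ψ x, S y⟫ ^ 2 ∂P) ^ 2 := fun hT =>
        hM.trans (by rw [hL]; gcongr)
      have hf0 : ∫ x, ⟪ψ x, S y⟫ ∂P = 0 := by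
        simp_rw [real_inner_comm (S y)]
        rw [integral_inner hi, h0, inner_zero_right]
      exact hmain (f := fun x => ⟪ψ x, S y⟫) hAB₁ (ne hA₁) (ne hB₁) hfm hf4 hf0 hv0 (hML hA₁)
        (hML hB₁)
  rw [compl_compl] at key
  have := (measureReal_union_le (μ := Measure.pi fun _ : ι => P) G₁ G₂)
  linarith

end Feature

section Samples

variable {n m : ℕ}

/-- The pooled indices of the first half of the first sample. -/
def firstX (n m : ℕ) : Finset (Fin n ⊕ Fin m) :=
  (Finset.univ.filter fun i : Fin n => (i : ℕ) < n / 2).map Function.Embedding.inl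

/-- The pooled indices of the first half of the second sample. -/
def firstY (n m : ℕ) : Finset (Fin n ⊕ Fin m) :=
  (Finset.univ.filter fun j : Fin m => (j : ℕ) < m / 2).map Function.Embedding.inr

/-- The pooled indices of the second half of the first sample. -/
def secondX (n m : ℕ) : Finset (Fin n ⊕ Fin m) :=
  (Finset.univ.filter fun i : Fin n => n / 2 ≤ (i : ℕ)).map Function.Embedding.inl

/-- The pooled indices of the second half of the second sample. -/
def secondY (n m : ℕ) : Finset (Fin n ⊕ Fin m) :=
  (Finset.univ.filter fun j : Fin m => m / 2 ≤ (j : ℕ)).map Function.Embedding.inr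

lemma card_filter_lt_half (n : ℕ) :
    (Finset.univ.filter fun i : Fin n => (i : ℕ) < n / 2).card = n / 2 := by
  rw [Fin.card_filter_val_lt]; omega

lemma card_filter_half_le (n : ℕ) :
    (Finset.univ.filter fun i : Fin n => n / 2 ≤ (i : ℕ)).card = n - n / 2 := by
  have h := Finset.card_filter_add_card_filter_not (s := (Finset.univ : Finset (Fin n)))
    (fun i : Fin n => (i : ℕ) < n / 2)
  simp only [not_lt] at h
  rw [card_filter_lt_half, Finset.card_univ, Fintype.card_fin] at h
  omega

lemma card_firstX : (firstX n m).card = n / 2 := by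
  rw [firstX, Finset.card_map, card_filter_lt_half]

lemma card_firstY : (firstY n m).card = m / 2 := by
  rw [firstY, Finset.card_map, card_filter_lt_half]

lemma card_secondX : (secondX n m).card = n - n / 2 := by
  rw [secondX, Finset.card_map, card_filter_half_le]

lemma card_secondY : (secondY n m).card = m - m / 2 := by
  rw [secondY, Finset.card_map, card_filter_half_le]

lemma disjoint_firstX_firstY : Disjoint (firstX n m) (firstY n m) := by
  rw [Finset.disjoint_left]
  rintro (i | j) <;> simp [firstX, firstY]

lemma disjoint_secondX_secondY : Disjoint (secondX n m) (secondY n m) := by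
  rw [Finset.disjoint_left]
  rintro (i | j) <;> simp [secondX, secondY]

lemma disjoint_first_second :
    Disjoint (firstX n m ∪ firstY n m) (secondX n m ∪ secondY n m) := by
  rw [Finset.disjoint_left]
  rintro (i | j) <;> simp [firstX, firstY, secondX, secondY]

omit [MeasurableSpace 𝒳] [CompleteSpace H] in
lemma studentized_eq_tStat (φ : 𝒳 → H) (z : Fin n ⊕ Fin m → 𝒳) :
    studentized φ (fun i => z (Sum.inl i), fun j => z (Sum.inr j))
      = tStat (firstX n m) (firstY n m)
        (fun i => ⟪φ (z i), ∑ j, contrast (secondX n m) (secondY n m) j • φ (z j)⟫) := by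
  have hS : ∑ j, contrast (secondX n m) (secondY n m) j • φ (z j)
      = empMean2 φ (fun i => z (Sum.inl i)) - empMean2 φ (fun j => z (Sum.inr j)) := by
    rw [sum_contrast_smul, card_secondX, card_secondY]
    simp [secondX, secondY, empMean2]
  rw [hS]
  simp only [studentized, tStat, sMean, sVar, sigmaHat2, sigmaHatX2, sigmaHatY2, UX, UY, xMMD2,
    firstX, firstY, Finset.sum_map, Finset.card_map, card_filter_lt_half]
  congr 1
  rw [inner_sub_left, empMean1, empMean1, real_inner_smul_left, real_inner_smul_left, sum_inner,
    sum_inner]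
  rfl

omit [CompleteSpace H] in
lemma toReal_sampleMeasure_studentized (φ : 𝒳 → H) (P : Measure 𝒳) [IsProbabilityMeasure P]
    (t : ℝ) :
    ((sampleMeasure P P n m) {ω | studentized φ ω ≤ t}).toReal
      = (Measure.pi fun _ : Fin n ⊕ Fin m => P).real {z | tStat (firstX n m) (firstY n m)
        (fun i => ⟪φ (z i), ∑ j, contrast (secondX n m) (secondY n m) j • φ (z j)⟫) ≤ t} := by
  have hmp := measurePreserving_sumPiEquivProdPi (fun _ : Fin n ⊕ Fin m => P)
  rw [sampleMeasure, ← hmp.measure_preimage_equiv, measureReal_def]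
  congr 2
  ext z
  exact (congrArg (· ≤ t) (studentized_eq_tStat φ z)).to_iff

end Samples

/-- **Theorem 1 (fixed kernel, fixed null distribution).**
If the feature map `φ` and the distribution `P` are fixed, both samples are i.i.d. `P`,
and `0 < E[k̄(X,X')⁴] < ∞`, then the studentized cross-MMD statistic converges in
distribution to `N(0,1)`. -/
theorem studentized_crossMMD_tendsto_gaussian_of_fixed_kernel
    [MeasurableSpace H] [BorelSpace H] [SecondCountableTopology H]
    (φ : 𝒳 → H) (hφ : Measurable φ)
    (P : Measure 𝒳) [IsProbabilityMeasure P]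
    (hφint : Integrable φ P)
    (m : ℕ → ℕ) (hm_mono : Monotone m) (hm_top : Tendsto m atTop atTop)
    (hk4_pos : 0 < ∫ x, ∫ y, kbar φ P x y ^ 4 ∂P ∂P)
    (hk4_fin : Integrable (fun p : 𝒳 × 𝒳 => kbar φ P p.1 p.2 ^ 4) (P.prod P)) :
    ∀ t : ℝ,
      Tendsto
        (fun n : ℕ =>
          ((sampleMeasure P P n (m n)) {ω | studentized φ ω ≤ t}).toReal)
        atTop (𝓝 (stdGaussianCDF t)) := by
  intro t
  set ψ : 𝒳 → H := fun x => φ x - meanEmb φ P with hψdef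
  have hψ : Measurable ψ := hφ.sub_const _
  have hi : Integrable ψ P := hφint.sub (integrable_const _)
  have h0 : ∫ x, ψ x ∂P = 0 := by
    rw [integral_sub hφint (integrable_const _), meanEmb]; simp
  rw [Metric.tendsto_atTop]
  intro ε hε
  obtain ⟨N, hN⟩ := exists_forall_abs_cross_tStat_sub_le hψ hi h0 hk4_fin hk4_pos t (half_pos hε)
  obtain ⟨n₀, hn₀⟩ := eventually_atTop.1 (hm_top.eventually_ge_atTop (2 * N + 2))
  refine ⟨max n₀ (2 * N + 2), fun n hn => ?_⟩
  have hn1 : 2 * N + 2 ≤ n := (le_max_right _ _).trans hn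
  have hm1 : 2 * N + 2 ≤ m n := hn₀ n ((le_max_left _ _).trans hn)
  have key := hN (disjoint_firstX_firstY (n := n) (m := m n)) disjoint_secondX_secondY
    disjoint_first_second (by rw [card_firstX]; omega) (by rw [card_firstY]; omega)
    (by rw [card_secondX]; omega) (by rw [card_secondY]; omega)
  have neA : (firstX n (m n)).Nonempty := Finset.card_pos.1 (by rw [card_firstX]; omega)
  have neB : (firstY n (m n)).Nonempty := Finset.card_pos.1 (by rw [card_firstY]; omega)
  have hc : ∑ j, contrast (secondX n (m n)) (secondY n (m n)) j = 0 := by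
    have h1 : ((n - n / 2 : ℕ) : ℝ) ≠ 0 := by exact_mod_cast (by omega : n - n / 2 ≠ 0)
    have h2 : ((m n - m n / 2 : ℕ) : ℝ) ≠ 0 := by exact_mod_cast (by omega : m n - m n / 2 ≠ 0)
    have h := sum_contrast_smul (secondX n (m n)) (secondY n (m n)) fun _ => (1 : ℝ)
    simp only [smul_eq_mul, mul_one, Finset.sum_const, nsmul_eq_mul, card_secondX,
      card_secondY] at h
    rw [h, inv_mul_cancel₀ h1, inv_mul_cancel₀ h2, sub_self]
  have hstat : ∀ z : Fin n ⊕ Fin (m n) → 𝒳,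
      tStat (firstX n (m n)) (firstY n (m n))
        (fun i => ⟪φ (z i), ∑ j, contrast (secondX n (m n)) (secondY n (m n)) j • φ (z j)⟫)
      = tStat (firstX n (m n)) (firstY n (m n))
        (fun i => ⟪ψ (z i), ∑ j, contrast (secondX n (m n)) (secondY n (m n)) j • ψ (z j)⟫) := by
    intro z
    have hsum : ∑ j, contrast (secondX n (m n)) (secondY n (m n)) j • ψ (z j)
        = ∑ j, contrast (secondX n (m n)) (secondY n (m n)) j • φ (z j) := by
      simp only [hψdef, smul_sub, Finset.sum_sub_distrib, ← Finset.sum_smul, hc, zero_smul,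
        sub_zero]
    rw [hsum]
    simp only [hψdef, inner_sub_left]
    simpa only [one_mul, ← sub_eq_add_neg] using (tStat_affine neA neB one_pos
      (-⟪meanEmb φ P, ∑ j, contrast (secondX n (m n)) (secondY n (m n)) j • φ (z j)⟫)
      (fun i => ⟪φ (z i), ∑ j, contrast (secondX n (m n)) (secondY n (m n)) j • φ (z j)⟫)).symm
  rw [Real.dist_eq, toReal_sampleMeasure_studentized]
  simp only [hstat]
  exact key.trans_lt (half_lt_self hε)

end CrossMMD
end
end

section
/- Consistency against a fixed alternative (Theorem corollary:fixed-alternative): Suppose P, Q and the feature map φ do not change with n, P ≠ Q, the kernel is characteristic (i.e., the map R ↦ μ_R is injective on probability measures with ∫‖φ‖ dR < ∞), and 0 < E_P[k̄_P(X₁,X₂)⁴] < ∞ and 0 < E_Q[k̄_Q(Y₁,Y₂)⁴] < ∞, where k̄_R(x,y) = ⟨φ(x) − μ_R, φ(y) − μ_R⟩_H. Then for every α ∈ (0,1), the power of the xMMD test tends to 1: P(x̄MMD² ≥ z_{1−α}) → 1 as n → ∞. -/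
open MeasureTheory ProbabilityTheory Filter
open scoped ENNReal NNReal RealInnerProductSpace Topology

noncomputable section

namespace CrossMMD

variable {𝒳 : Type*} [MeasurableSpace 𝒳]
variable {H : Type*} [NormedAddCommGroup H] [InnerProductSpace ℝ H] [CompleteSpace H]

section CharacteristicFunction

/-- The mass at the origin is bounded by the Gaussian average of the modulus of the
characteristic function. -/
theorem measureReal_singleton_zero_le_integral_norm_charFun (ρ : Measure ℝ)
    [IsProbabilityMeasure ρ] :
    ρ.real {0} ≤ ∫ t, ‖charFun ρ t‖ ∂(gaussianReal 0 1) := by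
  have hswap : ∫ t, charFun ρ t ∂(gaussianReal 0 1) = ∫ x, charFun (gaussianReal 0 1) x ∂ρ := by
    simp_rw [charFun_apply_real]
    rw [integral_integral_swap]
    · simp_rw [mul_comm]
    · refine Integrable.of_bound (C := 1) ?_ ?_
      · exact Measurable.aestronglyMeasurable (by fun_prop)
      · refine ae_of_all _ fun p => le_of_eq ?_
        simp only [Function.uncurry]
        rw [← Complex.ofReal_mul, Complex.norm_exp_ofReal_mul_I]
  have hreal : ∫ x, charFun (gaussianReal 0 1) x ∂ρ
      = ((∫ x, Real.exp (-(x ^ 2 / 2)) ∂ρ : ℝ) : ℂ) := by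
    rw [← integral_complex_ofReal]
    refine integral_congr_ae (ae_of_all _ fun x => ?_)
    simp [charFun_gaussianReal]
  have hint : Integrable (fun x : ℝ => Real.exp (-(x ^ 2 / 2))) ρ := by
    refine Integrable.of_bound (C := 1) (Measurable.aestronglyMeasurable (by fun_prop)) ?_
    refine ae_of_all _ fun x => ?_
    rw [Real.norm_eq_abs, Real.abs_exp, Real.exp_le_one_iff]
    nlinarith [sq_nonneg x]
  calc ρ.real {0} = ∫ x, Set.indicator {(0 : ℝ)} (fun _ => (1 : ℝ)) x ∂ρ := by
        rw [integral_indicator_const _ (measurableSet_singleton _)]; simp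
    _ ≤ ∫ x, Real.exp (-(x ^ 2 / 2)) ∂ρ := by
        refine integral_mono ((integrable_const _).indicator (measurableSet_singleton _)) hint ?_
        intro x
        by_cases hx : x = 0
        · simp [hx]
        · simp [hx, Real.exp_nonneg]
    _ ≤ ‖((∫ x, Real.exp (-(x ^ 2 / 2)) ∂ρ : ℝ) : ℂ)‖ := by
        rw [Complex.norm_real]; exact le_abs_self _
    _ = ‖∫ t, charFun ρ t ∂(gaussianReal 0 1)‖ := by rw [hswap, hreal]
    _ ≤ _ := norm_integral_le_integral_norm _

theorem countable_setOf_exp_mul_I_eq_one {d : ℝ} (hd : d ≠ 0) :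
    {t : ℝ | Complex.exp (t * d * Complex.I) = 1}.Countable := by
  refine (Set.countable_range fun n : ℤ => (n : ℝ) * (2 * Real.pi) / d).mono fun t ht => ?_
  obtain ⟨n, hn⟩ := Complex.exp_eq_one_iff.1 ht
  refine ⟨n, ?_⟩
  have h : ((t * d : ℝ) : ℂ) = ((n * (2 * Real.pi) : ℝ) : ℂ) := by
    push_cast
    exact mul_right_cancel₀ Complex.I_ne_zero (by rw [hn]; ring)
  have h' : t * d = n * (2 * Real.pi) := by exact_mod_cast h
  simp only [← h']
  field_simp

/-- The characteristic function of a nondegenerate law on `ℝ` has modulus less than one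
almost everywhere. -/
theorem ae_norm_charFun_lt_one (γ ρ : Measure ℝ) [IsProbabilityMeasure γ] [NullSingletonClass γ]
    [IsProbabilityMeasure ρ] (hρ : ¬ ∀ᵐ p ∂ρ.prod ρ, p.1 = p.2) :
    ∀ᵐ t ∂γ, ‖charFun ρ t‖ < 1 := by
  have hset : MeasurableSet {q : (ℝ × ℝ) × ℝ |
      Complex.exp (q.2 * (q.1.1 - q.1.2 : ℝ) * Complex.I) = 1 → q.1.1 = q.1.2} := by
    refine MeasurableSet.imp ?_ ?_
    · exact measurableSet_eq_fun (by fun_prop) (by fun_prop)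
    · exact measurableSet_eq_fun (by fun_prop) (by fun_prop)
  have h1 : ∀ᵐ p : ℝ × ℝ ∂ρ.prod ρ, ∀ᵐ t : ℝ ∂γ,
      Complex.exp (t * (p.1 - p.2 : ℝ) * Complex.I) = 1 → p.1 = p.2 := by
    refine ae_of_all _ fun p => ?_
    by_cases hp : p.1 = p.2
    · simp [hp]
    · have := (countable_setOf_exp_mul_I_eq_one (sub_ne_zero.2 hp)).ae_notMem γ
      filter_upwards [this] with t ht h
      exact absurd h ht
  rw [Measure.ae_ae_comm hset] at h1
  filter_upwards [h1] with t ht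
  have hb : ∀ᵐ x : ℝ ∂ρ, ‖Complex.exp ((t * x : ℝ) * Complex.I)‖ ≤ 1 :=
    ae_of_all _ fun x => (Complex.norm_exp_ofReal_mul_I _).le
  rcases ae_eq_const_or_norm_integral_lt_of_norm_le_const hb with h | h
  · refine absurd ?_ hρ
    have hfst : ∀ᵐ p ∂ρ.prod ρ, Complex.exp ((t * p.1 : ℝ) * Complex.I)
        = ⨍ x, Complex.exp ((t * x : ℝ) * Complex.I) ∂ρ :=
      Measure.quasiMeasurePreserving_fst.ae h
    have hsnd : ∀ᵐ p ∂ρ.prod ρ, Complex.exp ((t * p.2 : ℝ) * Complex.I)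
        = ⨍ x, Complex.exp ((t * x : ℝ) * Complex.I) ∂ρ :=
      Measure.quasiMeasurePreserving_snd.ae h
    filter_upwards [ht, hfst, hsnd] with p hp h1 h2
    apply hp
    have : (t * (p.1 - p.2 : ℝ) * Complex.I : ℂ)
        = (t * p.1 : ℝ) * Complex.I - (t * p.2 : ℝ) * Complex.I := by push_cast; ring
    rw [this, Complex.exp_sub, h1, ← h2, div_self (Complex.exp_ne_zero _)]
  · rw [charFun_apply_real]
    simpa using h

/-- Powers of the characteristic function of a nondegenerate law on `ℝ` vanish in the
Gaussian mean. -/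
theorem tendsto_integral_norm_charFun_pow (ρ : Measure ℝ) [IsProbabilityMeasure ρ]
    (hρ : ¬ ∀ᵐ p ∂ρ.prod ρ, p.1 = p.2) {k : ℕ → ℕ} (hk : Tendsto k atTop atTop) :
    Tendsto (fun n => ∫ t, ‖charFun ρ t‖ ^ k n ∂(gaussianReal 0 1)) atTop (𝓝 0) := by
  have : NullSingletonClass (gaussianReal 0 1) := nullSingletonClass_gaussianReal (by norm_num)
  have hlim : Tendsto (fun n => ∫ t, ‖charFun ρ t‖ ^ k n ∂(gaussianReal 0 1)) atTop
      (𝓝 (∫ _, (0 : ℝ) ∂(gaussianReal 0 1))) := by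
    refine tendsto_integral_of_dominated_convergence (fun _ => 1)
      (fun n => (measurable_charFun.norm.pow_const _).aestronglyMeasurable)
      (integrable_const _) (fun n => ae_of_all _ fun t => ?_) ?_
    · rw [norm_pow, norm_norm]
      exact pow_le_one₀ (norm_nonneg _) (norm_charFun_le_one t)
    · filter_upwards [ae_norm_charFun_lt_one (gaussianReal 0 1) ρ hρ] with t ht
      exact (tendsto_pow_atTop_nhds_zero_of_lt_one (norm_nonneg _) ht).comp hk
  simpa using hlim

end CharacteristicFunction

section Averages

set_option linter.unusedSectionVars false

variable {E : Type*} [NormedAddCommGroup E] [NormedSpace ℝ E]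

theorem sum_univ_fin_filter_lt (f : ℕ → E) (n : ℕ) :
    ∑ i ∈ Finset.univ.filter (fun i : Fin n => (i : ℕ) < n / 2), f i
      = ∑ i ∈ Finset.range (n / 2), f i := by
  rw [Finset.sum_filter, Fin.sum_univ_eq_sum_range (fun i => if i < n / 2 then f i else 0) n,
    ← Finset.sum_filter]
  congr 1
  ext i
  simp only [Finset.mem_filter, Finset.mem_range]
  omega

theorem sum_univ_fin_filter_le (f : ℕ → E) (n : ℕ) :
    ∑ i ∈ Finset.univ.filter (fun i : Fin n => n / 2 ≤ (i : ℕ)), f i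
      = ∑ i ∈ Finset.Ico (n / 2) n, f i := by
  rw [Finset.sum_filter, Fin.sum_univ_eq_sum_range (fun i => if n / 2 ≤ i then f i else 0) n,
    ← Finset.sum_filter]
  congr 1
  ext i
  simp only [Finset.mem_filter, Finset.mem_range, Finset.mem_Ico]
  omega

theorem tendsto_average_Ico_half {f : ℕ → E} {a : E}
    (h : Tendsto (fun n : ℕ => (n : ℝ)⁻¹ • ∑ i ∈ Finset.range n, f i) atTop (𝓝 a)) :
    Tendsto (fun n : ℕ => ((n - n / 2 : ℕ) : ℝ)⁻¹ • ∑ i ∈ Finset.Ico (n / 2) n, f i)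
      atTop (𝓝 a) := by
  set A : ℕ → E := fun n => (n : ℝ)⁻¹ • ∑ i ∈ Finset.range n, f i with hA
  have h2 : Tendsto (fun n => A (n / 2)) atTop (𝓝 a) :=
    h.comp (Nat.tendsto_div_const_atTop two_ne_zero)
  have hb : Tendsto (fun n => 2 * ‖A n - a‖ + ‖A (n / 2) - a‖) atTop (𝓝 0) := by
    simpa using ((tendsto_iff_norm_sub_tendsto_zero.1 h).const_mul 2).add
      (tendsto_iff_norm_sub_tendsto_zero.1 h2)
  rw [tendsto_iff_norm_sub_tendsto_zero]
  refine squeeze_zero' (Eventually.of_forall fun _ => norm_nonneg _) ?_ hb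
  filter_upwards [eventually_ge_atTop 2] with n hn
  set p := n / 2 with hp
  set q := n - p with hq
  have hp0 : (0 : ℝ) < p := by exact_mod_cast (by omega : 0 < p)
  have hq0 : (0 : ℝ) < q := by exact_mod_cast (by omega : 0 < q)
  have hpq : (p : ℝ) ≤ q := by exact_mod_cast (by omega : p ≤ q)
  have hn0 : (n : ℝ) = p + q := by exact_mod_cast (by omega : n = p + q)
  have hn' : (n : ℝ) ≠ 0 := by rw [hn0]; positivity
  have hsum : ∑ i ∈ Finset.Ico p n, f i = (n : ℝ) • A n - (p : ℝ) • A p := by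
    rw [Finset.sum_Ico_eq_sub _ (by omega : p ≤ n), hA]
    simp only
    rw [smul_inv_smul₀ hn', smul_inv_smul₀ hp0.ne']
  have key : (q : ℝ)⁻¹ • ∑ i ∈ Finset.Ico p n, f i - a
      = ((n : ℝ) / q) • (A n - a) - ((p : ℝ) / q) • (A p - a) := by
    have ha : a = ((n : ℝ) / q) • a - ((p : ℝ) / q) • a := by
      rw [← sub_smul, ← sub_div, hn0, add_sub_cancel_left, div_self hq0.ne', one_smul]
    rw [hsum]
    conv_lhs => rw [ha]
    simp only [smul_sub, smul_smul, div_eq_inv_mul]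
    abel
  rw [key]
  refine (norm_sub_le _ _).trans ?_
  rw [norm_smul, norm_smul, Real.norm_of_nonneg (by positivity),
    Real.norm_of_nonneg (by positivity)]
  have r1 : (n : ℝ) / q ≤ 2 := by rw [div_le_iff₀ hq0]; linarith
  have r2 : (p : ℝ) / q ≤ 1 := by rw [div_le_iff₀ hq0]; linarith
  have := mul_le_mul_of_nonneg_right r1 (norm_nonneg (A n - a))
  have := mul_le_mul_of_nonneg_right r2 (norm_nonneg (A p - a))
  linarith

/-- If the averages of a nonnegative sequence converge, then the sums of its squares are
`o(n ^ 2)`. -/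
theorem tendsto_sum_sq_div_sq {b : ℕ → ℝ} {β : ℝ} (hb : ∀ i, 0 ≤ b i)
    (h : Tendsto (fun n : ℕ => (n : ℝ)⁻¹ * ∑ i ∈ Finset.range n, b i) atTop (𝓝 β)) :
    Tendsto (fun n : ℕ => (∑ i ∈ Finset.range n, b i ^ 2) / (n : ℝ) ^ 2) atTop (𝓝 0) := by
  have hterm : Tendsto (fun n : ℕ => b n / ((n : ℝ) + 1)) atTop (𝓝 0) := by
    have h1 := h.comp (tendsto_add_atTop_nat 1)
    have h2 := h1.sub ((tendsto_natCast_div_add_atTop (1 : ℝ)).mul h)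
    rw [one_mul, sub_self] at h2
    refine h2.congr' ?_
    filter_upwards [eventually_gt_atTop 0] with n hn
    have : (n : ℝ) ≠ 0 := by positivity
    simp only [Function.comp, Finset.sum_range_succ]
    push_cast
    field_simp
    ring
  have ho : (fun n => b n / ((n : ℝ) + 1) * b n) =o[atTop] fun n => b n + 1 := by
    have h1 : (fun n => b n / ((n : ℝ) + 1)) =o[atTop] fun _ => (1 : ℝ) :=
      (Asymptotics.isLittleO_one_iff ℝ).2 hterm
    have h2 : (fun n => b n) =O[atTop] fun n => b n + 1 :=
      Asymptotics.IsBigO.of_bound 1 (Eventually.of_forall fun n => by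
        rw [Real.norm_of_nonneg (hb n), Real.norm_of_nonneg (by linarith [hb n])]; linarith)
    simpa using h1.mul_isBigO h2
  have hdiv : Tendsto (fun n => ∑ i ∈ Finset.range n, (b i + 1)) atTop atTop := by
    refine tendsto_atTop_mono (fun n => ?_) tendsto_natCast_atTop_atTop
    have := Finset.sum_nonneg fun i (_ : i ∈ Finset.range n) => hb i
    simp only [Finset.sum_add_distrib, Finset.sum_const, Finset.card_range, nsmul_eq_mul, mul_one]
    linarith
  have ho2 := ho.sum_range (fun n => by simp only [Pi.zero_apply]; linarith [hb n]) hdiv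
  have hO : (fun n => ∑ i ∈ Finset.range n, (b i + 1)) =O[atTop] fun n : ℕ => (n : ℝ) := by
    refine Asymptotics.isBigO_of_div_tendsto_nhds (c := β + 1) ?_ ?_
    · filter_upwards [eventually_gt_atTop 0] with n hn h0
      exact absurd h0 (by positivity)
    · refine (h.add_const 1).congr' ?_
      filter_upwards [eventually_gt_atTop 0] with n hn
      have : (n : ℝ) ≠ 0 := by positivity
      simp only [Finset.sum_add_distrib, Finset.sum_const, Finset.card_range, nsmul_eq_mul,
        mul_one, Pi.div_apply]
      field_simp
  have hlim := (ho2.trans_isBigO hO).tendsto_div_nhds_zero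
  refine squeeze_zero (fun n => by positivity) (fun n => ?_) hlim
  rcases Nat.eq_zero_or_pos n with rfl | hn
  · simp
  have hn0 : (0 : ℝ) < n := by exact_mod_cast hn
  rw [pow_two (n : ℝ), ← div_div]
  refine div_le_div_of_nonneg_right ?_ hn0.le
  rw [Finset.sum_div]
  refine Finset.sum_le_sum fun i hi => ?_
  have hi' : (i : ℝ) + 1 ≤ n := by exact_mod_cast Finset.mem_range.1 hi
  rw [div_mul_eq_mul_div, ← pow_two]
  exact div_le_div_of_nonneg_left (sq_nonneg _) (by positivity) hi'

theorem sum_sub_average_sq_le (u : ℕ → ℝ) (n : ℕ) :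
    ∑ i ∈ Finset.range n, (u i - (n : ℝ)⁻¹ * ∑ l ∈ Finset.range n, u l) ^ 2
      ≤ ∑ i ∈ Finset.range n, u i ^ 2 := by
  rcases Nat.eq_zero_or_pos n with rfl | hn
  · simp
  have hn0 : (0 : ℝ) < n := by exact_mod_cast hn
  set s := ∑ l ∈ Finset.range n, u l with hs
  have : ∑ i ∈ Finset.range n, (u i - (n : ℝ)⁻¹ * s) ^ 2
      = ∑ i ∈ Finset.range n, u i ^ 2 - (n : ℝ)⁻¹ * s ^ 2 := by
    simp only [sub_sq, Finset.sum_add_distrib, Finset.sum_sub_distrib, Finset.sum_const,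
      Finset.card_range, nsmul_eq_mul, ← Finset.sum_mul, ← Finset.mul_sum, ← hs]
    field_simp
    ring
  rw [this]
  have : 0 ≤ (n : ℝ)⁻¹ * s ^ 2 := by positivity
  linarith

end Averages

section Path

set_option linter.unusedSectionVars false

/-- The empirical variance of the projections of the first `n` features onto `g`. -/
def pathVar (φ : 𝒳 → H) (x : ℕ → 𝒳) (g : H) (n : ℕ) : ℝ :=
  (n : ℝ)⁻¹ * ∑ i ∈ Finset.range n,
    (⟪φ (x i), g⟫ - (n : ℝ)⁻¹ * ∑ l ∈ Finset.range n, ⟪φ (x l), g⟫) ^ 2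

/-- The initial segments of two sequences, as a pair of samples. -/
def truncate (x y : ℕ → 𝒳) (n m : ℕ) : (Fin n → 𝒳) × (Fin m → 𝒳) :=
  (fun i => x i, fun j => y j)

/-- The difference `μ̂₂ − ν̂₂` of the second-half empirical mean embeddings of two sequences. -/
def diffMean2 (φ : 𝒳 → H) (x y : ℕ → 𝒳) (n m : ℕ) : H :=
  ((n - n / 2 : ℕ) : ℝ)⁻¹ • ∑ i ∈ Finset.Ico (n / 2) n, φ (x i)
    - ((m - m / 2 : ℕ) : ℝ)⁻¹ • ∑ j ∈ Finset.Ico (m / 2) m, φ (y j)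

theorem pathVar_nonneg (φ : 𝒳 → H) (x : ℕ → 𝒳) (g : H) (n : ℕ) : 0 ≤ pathVar φ x g n :=
  mul_nonneg (by positivity) (Finset.sum_nonneg fun _ _ => sq_nonneg _)

theorem empMean1_restrict (φ : 𝒳 → H) (x : ℕ → 𝒳) (n : ℕ) :
    empMean1 φ (fun i : Fin n => x i)
      = ((n / 2 : ℕ) : ℝ)⁻¹ • ∑ i ∈ Finset.range (n / 2), φ (x i) := by
  rw [empMean1, sum_univ_fin_filter_lt fun i => φ (x i)]

theorem empMean2_restrict (φ : 𝒳 → H) (x : ℕ → 𝒳) (n : ℕ) :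
    empMean2 φ (fun i : Fin n => x i)
      = ((n - n / 2 : ℕ) : ℝ)⁻¹ • ∑ i ∈ Finset.Ico (n / 2) n, φ (x i) := by
  rw [empMean2, sum_univ_fin_filter_le fun i => φ (x i)]

theorem sigmaHat2_truncate (φ : 𝒳 → H) (x y : ℕ → 𝒳) (n m : ℕ) :
    sigmaHat2 φ (truncate x y n m)
      = pathVar φ x (diffMean2 φ x y n m) (n / 2) / ((n / 2 : ℕ) : ℝ)
        + pathVar φ y (diffMean2 φ x y n m) (m / 2) / ((m / 2 : ℕ) : ℝ) := by
  have hd : empMean2 φ (truncate x y n m).1 - empMean2 φ (truncate x y n m).2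
      = diffMean2 φ x y n m := by
    simp only [truncate, empMean2_restrict, diffMean2]
  simp only [sigmaHat2, sigmaHatX2, sigmaHatY2, UX, UY, hd, pathVar]
  simp only [truncate]
  rw [sum_univ_fin_filter_lt fun i => ⟪φ (x i), diffMean2 φ x y n m⟫,
    sum_univ_fin_filter_lt fun i => ⟪φ (y i), diffMean2 φ x y n m⟫,
    sum_univ_fin_filter_lt fun i => (⟪φ (x i), diffMean2 φ x y n m⟫ - ((n / 2 : ℕ) : ℝ)⁻¹ *
      ∑ l ∈ Finset.range (n / 2), ⟪φ (x l), diffMean2 φ x y n m⟫) ^ 2,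
    sum_univ_fin_filter_lt fun i => (⟪φ (y i), diffMean2 φ x y n m⟫ - ((m / 2 : ℕ) : ℝ)⁻¹ *
      ∑ l ∈ Finset.range (m / 2), ⟪φ (y l), diffMean2 φ x y n m⟫) ^ 2]

theorem pathVar_div_le (φ : 𝒳 → H) (x : ℕ → 𝒳) (g : H) (n : ℕ) :
    pathVar φ x g n / n
      ≤ ‖g‖ ^ 2 * ((∑ i ∈ Finset.range n, ‖φ (x i)‖ ^ 2) / (n : ℝ) ^ 2) := by
  have h : ∑ i ∈ Finset.range n, ⟪φ (x i), g⟫ ^ 2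
      ≤ ‖g‖ ^ 2 * ∑ i ∈ Finset.range n, ‖φ (x i)‖ ^ 2 := by
    rw [Finset.mul_sum]
    refine Finset.sum_le_sum fun i _ => ?_
    rw [← mul_pow, mul_comm ‖g‖, ← sq_abs]
    exact pow_le_pow_left₀ (abs_nonneg _) (abs_real_inner_le_norm _ _) 2
  have h2 := (sum_sub_average_sq_le (fun i => ⟪φ (x i), g⟫) n).trans h
  calc pathVar φ x g n / n = (∑ i ∈ Finset.range n,
        (⟪φ (x i), g⟫ - (n : ℝ)⁻¹ * ∑ l ∈ Finset.range n, ⟪φ (x l), g⟫) ^ 2) / (n : ℝ) ^ 2 := by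
        rw [pathVar, pow_two (n : ℝ), ← div_div]; ring
    _ ≤ _ := by
        rw [← mul_div_assoc]
        exact div_le_div_of_nonneg_right h2 (sq_nonneg _)

variable {φ : 𝒳 → H} {x y : ℕ → 𝒳} {a b : H} {α β : ℝ} {m : ℕ → ℕ}

theorem tendsto_diffMean2
    (hx : Tendsto (fun n : ℕ => (n : ℝ)⁻¹ • ∑ i ∈ Finset.range n, φ (x i)) atTop (𝓝 a))
    (hy : Tendsto (fun n : ℕ => (n : ℝ)⁻¹ • ∑ i ∈ Finset.range n, φ (y i)) atTop (𝓝 b))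
    (hm : Tendsto m atTop atTop) :
    Tendsto (fun n => diffMean2 φ x y n (m n)) atTop (𝓝 (a - b)) :=
  (tendsto_average_Ico_half hx).sub ((tendsto_average_Ico_half hy).comp hm)

theorem tendsto_xMMD2_truncate
    (hx : Tendsto (fun n : ℕ => (n : ℝ)⁻¹ • ∑ i ∈ Finset.range n, φ (x i)) atTop (𝓝 a))
    (hy : Tendsto (fun n : ℕ => (n : ℝ)⁻¹ • ∑ i ∈ Finset.range n, φ (y i)) atTop (𝓝 b))
    (hm : Tendsto m atTop atTop) :
    Tendsto (fun n => xMMD2 φ (truncate x y n (m n))) atTop (𝓝 (‖a - b‖ ^ 2)) := by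
  have hhalf := Nat.tendsto_div_const_atTop two_ne_zero
  rw [← real_inner_self_eq_norm_sq]
  simp only [xMMD2, truncate, empMean1_restrict, empMean2_restrict]
  exact ((hx.comp hhalf).sub (hy.comp (hhalf.comp hm))).inner (tendsto_diffMean2 hx hy hm)

theorem tendsto_sigmaHat2_truncate
    (hx : Tendsto (fun n : ℕ => (n : ℝ)⁻¹ • ∑ i ∈ Finset.range n, φ (x i)) atTop (𝓝 a))
    (hy : Tendsto (fun n : ℕ => (n : ℝ)⁻¹ • ∑ i ∈ Finset.range n, φ (y i)) atTop (𝓝 b))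
    (hx' : Tendsto (fun n : ℕ => (n : ℝ)⁻¹ * ∑ i ∈ Finset.range n, ‖φ (x i)‖) atTop (𝓝 α))
    (hy' : Tendsto (fun n : ℕ => (n : ℝ)⁻¹ * ∑ i ∈ Finset.range n, ‖φ (y i)‖) atTop (𝓝 β))
    (hm : Tendsto m atTop atTop) :
    Tendsto (fun n => sigmaHat2 φ (truncate x y n (m n))) atTop (𝓝 0) := by
  have hhalf := Nat.tendsto_div_const_atTop two_ne_zero
  have hg := ((tendsto_diffMean2 hx hy hm).norm.pow 2)
  have hX := (tendsto_sum_sq_div_sq (fun i => norm_nonneg (φ (x i))) hx').comp hhalf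
  have hY := (tendsto_sum_sq_div_sq (fun i => norm_nonneg (φ (y i))) hy').comp (hhalf.comp hm)
  have hsum := (hg.mul hX).add (hg.mul hY)
  simp only [mul_zero, add_zero] at hsum
  refine squeeze_zero (fun n => ?_) (fun n => ?_) hsum
  · rw [sigmaHat2_truncate]
    exact add_nonneg (div_nonneg (pathVar_nonneg _ _ _ _) (by positivity))
      (div_nonneg (pathVar_nonneg _ _ _ _) (by positivity))
  · rw [sigmaHat2_truncate]
    exact add_le_add (pathVar_div_le _ _ _ _) (pathVar_div_le _ _ _ _)

/-- On a path along which the averages converge to distinct limits, the test eventually rejects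
unless the variance estimate degenerates. -/
theorem eventually_le_studentized_truncate (hab : a ≠ b) (z : ℝ)
    (hx : Tendsto (fun n : ℕ => (n : ℝ)⁻¹ • ∑ i ∈ Finset.range n, φ (x i)) atTop (𝓝 a))
    (hy : Tendsto (fun n : ℕ => (n : ℝ)⁻¹ • ∑ i ∈ Finset.range n, φ (y i)) atTop (𝓝 b))
    (hx' : Tendsto (fun n : ℕ => (n : ℝ)⁻¹ * ∑ i ∈ Finset.range n, ‖φ (x i)‖) atTop (𝓝 α))
    (hy' : Tendsto (fun n : ℕ => (n : ℝ)⁻¹ * ∑ i ∈ Finset.range n, ‖φ (y i)‖) atTop (𝓝 β))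
    (hm : Tendsto m atTop atTop) :
    ∀ᶠ n in atTop, sigmaHat2 φ (truncate x y n (m n)) ≠ 0 →
      z ≤ studentized φ (truncate x y n (m n)) := by
  have h1 := tendsto_xMMD2_truncate hx hy hm
  have h2 := (tendsto_sigmaHat2_truncate hx hy hx' hy' hm).sqrt.const_mul z
  rw [Real.sqrt_zero, mul_zero] at h2
  have hpos : 0 < ‖a - b‖ ^ 2 := by
    have := norm_pos_iff.2 (sub_ne_zero.2 hab)
    positivity
  filter_upwards [h2.eventually_lt h1 hpos] with n hn hne
  have hσ : 0 < sigmaHat2 φ (truncate x y n (m n)) := by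
    refine lt_of_le_of_ne ?_ hne.symm
    rw [sigmaHat2_truncate]
    exact add_nonneg (div_nonneg (pathVar_nonneg _ _ _ _) (by positivity))
      (div_nonneg (pathVar_nonneg _ _ _ _) (by positivity))
  rw [studentized, le_div_iff₀ (Real.sqrt_pos.2 hσ)]
  exact hn.le

/-- If the variance estimate vanishes, every difference of first-half features is orthogonal to
the second-half mean difference. -/
theorem inner_sub_eq_zero_of_sigmaHat2_truncate_eq_zero {n k : ℕ}
    (h : sigmaHat2 φ (truncate x y n k) = 0) {i j : ℕ} (hi : i < n / 2) (hj : j < n / 2) :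
    ⟪φ (x i) - φ (x j), diffMean2 φ x y n k⟫ = 0 := by
  have hn : (0 : ℝ) < (n / 2 : ℕ) := by exact_mod_cast (by omega : 0 < n / 2)
  rw [sigmaHat2_truncate] at h
  set g := diffMean2 φ x y n k
  have hX : pathVar φ x g (n / 2) / ((n / 2 : ℕ) : ℝ) = 0 :=
    ((add_eq_zero_iff_of_nonneg (div_nonneg (pathVar_nonneg _ _ _ _) (by positivity))
      (div_nonneg (pathVar_nonneg _ _ _ _) (by positivity))).1 h).1
  rw [div_eq_zero_iff, or_iff_left hn.ne', pathVar, mul_eq_zero,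
    or_iff_right (inv_ne_zero hn.ne'), Finset.sum_eq_zero_iff_of_nonneg fun _ _ => sq_nonneg _] at hX
  have h1 := pow_eq_zero_iff two_ne_zero |>.1 (hX i (Finset.mem_range.2 hi))
  have h2 := pow_eq_zero_iff two_ne_zero |>.1 (hX j (Finset.mem_range.2 hj))
  rw [inner_sub_left]
  linarith

end Path

section Independence

/-- Functions of the members of an independent family with indices in disjoint sets are
independent. -/
theorem indepFun_of_measurable_iSup {Ω ι β γ δ : Type*} [MeasurableSpace Ω] [MeasurableSpace β]
    [MeasurableSpace γ] [MeasurableSpace δ] {μ : Measure Ω} {U : ι → Ω → β} (hU : iIndepFun U μ)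
    (mU : ∀ i, Measurable (U i)) {S T : Set ι} (hST : Disjoint S T) {f : Ω → γ} {g : Ω → δ}
    (hf : Measurable[⨆ i ∈ S, MeasurableSpace.comap (U i) inferInstance] f)
    (hg : Measurable[⨆ i ∈ T, MeasurableSpace.comap (U i) inferInstance] g) :
    IndepFun f g μ := by
  rw [IndepFun_iff_Indep]
  exact indep_of_indep_of_le_left (indep_of_indep_of_le_right
    (indep_iSup_of_disjoint (fun i => (mU i).comap_le) hU.iIndep hST) hg.comap_le) hf.comap_le

theorem measurable_iSup_comap {Ω ι β : Type*} [MeasurableSpace β] (U : ι → Ω → β) {S : Set ι}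
    {i : ι} (hi : i ∈ S) :
    Measurable[⨆ i ∈ S, MeasurableSpace.comap (U i) inferInstance] (U i) :=
  (comap_measurable (U i)).mono (le_iSup₂_of_le i hi le_rfl) le_rfl

end Independence

section Degeneracy

set_option linter.unusedSectionVars false

variable [MeasurableSpace H] [BorelSpace H] [SecondCountableTopology H]

/-- The directions along which the feature map is almost surely constant under `P`. -/
def degenerateDirections (φ : 𝒳 → H) (P : Measure 𝒳) : Set H :=
  {v | ∀ᵐ q ∂P.prod P, ⟪v, φ q.1 - φ q.2⟫ = 0}

theorem measurableSet_degenerateDirections {φ : 𝒳 → H} (hφ : Measurable φ) (P : Measure 𝒳)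
    [IsProbabilityMeasure P] : MeasurableSet (degenerateDirections φ P) := by
  have hS : MeasurableSet {r : H × 𝒳 × 𝒳 | ¬ ⟪r.1, φ r.2.1 - φ r.2.2⟫ = 0} := by
    refine (measurableSet_eq_fun ?_ measurable_const).compl
    exact measurable_fst.inner ((hφ.comp (measurable_fst.comp measurable_snd)).sub
      (hφ.comp (measurable_snd.comp measurable_snd)))
  exact (measurable_measure_prodMk_left (ν := P.prod P) hS) (measurableSet_singleton 0)

/-- If almost every difference of two independent features is a degenerate direction, then the
centered kernel vanishes almost everywhere. -/
theorem ae_kbar_eq_zero {φ : 𝒳 → H} (hφ : Measurable φ) (P : Measure 𝒳) [IsProbabilityMeasure P]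
    (hint : Integrable φ P)
    (h : ∀ᵐ p ∂P.prod P, φ p.1 - φ p.2 ∈ degenerateDirections φ P) :
    ∀ᵐ x ∂P, ∀ᵐ y ∂P, kbar φ P x y = 0 := by
  have hcenter : ∀ w : H, ∀ u : H, (∀ᵐ x ∂P, ⟪w, u - φ x⟫ = 0) → ⟪w, u - meanEmb φ P⟫ = 0 := by
    intro w u hw
    have h1 := integral_inner (𝕜 := ℝ) (f := fun x => u - φ x) ((integrable_const u).sub hint) w
    rw [integral_congr_ae hw, integral_zero, integral_sub (integrable_const u) hint,
      integral_const, probReal_univ, one_smul] at h1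
    exact h1.symm
  have h1 : ∀ᵐ x ∂P, ∀ᵐ x' ∂P, ∀ᵐ y ∂P, ⟪φ x - φ x', φ y - meanEmb φ P⟫ = 0 := by
    filter_upwards [Measure.ae_ae_of_ae_prod h] with x hx
    filter_upwards [hx] with x' hx'
    filter_upwards [Measure.ae_ae_of_ae_prod hx'] with y hy
    exact hcenter _ _ hy
  filter_upwards [h1] with x hx
  rw [Measure.ae_ae_comm] at hx
  · filter_upwards [hx] with y hy
    rw [kbar, real_inner_comm]
    refine hcenter _ _ ?_
    filter_upwards [hy] with x' hx'
    rw [real_inner_comm, hx']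
  · refine measurableSet_eq_fun ?_ measurable_const
    exact (measurable_const.sub (hφ.comp measurable_fst)).inner
      ((hφ.comp measurable_snd).sub measurable_const)

variable {φ : 𝒳 → H} {P Q : Measure 𝒳} [IsProbabilityMeasure P] [IsProbabilityMeasure Q]
  {Ω : Type*} [MeasurableSpace Ω] {μ : Measure Ω} [IsProbabilityMeasure μ]
  {U : ℕ ⊕ ℕ → Ω → 𝒳} {m : ℕ → ℕ}

theorem measurable_diffMean2 (hφ : Measurable φ) {S : Set (ℕ ⊕ ℕ)} {n k : ℕ}
    (hX : ∀ i ∈ Finset.Ico (n / 2) n, Sum.inl i ∈ S)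
    (hY : ∀ j ∈ Finset.Ico (k / 2) k, Sum.inr j ∈ S) :
    Measurable[⨆ s ∈ S, MeasurableSpace.comap (U s) inferInstance]
      fun ω => diffMean2 φ (fun i => U (Sum.inl i) ω) (fun j => U (Sum.inr j) ω) n k :=
  ((Finset.measurable_sum _ fun i hi =>
      hφ.comp (measurable_iSup_comap U (hX i hi))).const_smul _).sub
    ((Finset.measurable_sum _ fun j hj =>
      hφ.comp (measurable_iSup_comap U (hY j hj))).const_smul _)

theorem measurable_diffMean2_of_measurable (hφ : Measurable φ) (mU : ∀ s, Measurable (U s)) (n k : ℕ) :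
    Measurable
      fun ω => diffMean2 φ (fun i => U (Sum.inl i) ω) (fun j => U (Sum.inr j) ω) n k :=
  (measurable_diffMean2 hφ (S := Set.univ) (by simp) (by simp)).mono
    (iSup₂_le fun s _ => (mU s).comap_le) le_rfl

/-- In a nondegenerate direction, the second-half mean difference has vanishing probability of
being orthogonal. -/
theorem tendsto_measure_inner_diffMean2_eq_zero (hφ : Measurable φ) (hU : iIndepFun U μ)
    (mU : ∀ s, Measurable (U s)) (hX : ∀ i, μ.map (U (Sum.inl i)) = P)
    {v : H} (hv : v ∉ degenerateDirections φ P) :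
    Tendsto (fun n => μ {ω | ⟪v, diffMean2 φ (fun i => U (Sum.inl i) ω)
      (fun j => U (Sum.inr j) ω) n (m n)⟫ = 0}) atTop (𝓝 0) := by
  have hpr : Measurable fun x => ⟪v, φ x⟫ := measurable_const.inner hφ
  set ρ : Measure ℝ := P.map fun x => ⟪v, φ x⟫ with hρ
  have : IsProbabilityMeasure ρ := Measure.isProbabilityMeasure_map hpr.aemeasurable
  have hdeg : ¬ ∀ᵐ p ∂ρ.prod ρ, p.1 = p.2 := by
    refine fun h => hv ?_
    rw [hρ, Measure.map_prod_map _ _ hpr hpr] at h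
    filter_upwards [ae_of_ae_map (hpr.prodMap hpr).aemeasurable h] with q hq
    rw [inner_sub_right, sub_eq_zero]
    exact hq
  have hk : Tendsto (fun n : ℕ => n - n / 2) atTop atTop := by
    refine tendsto_atTop_mono (fun n => ?_) (Nat.tendsto_div_const_atTop two_ne_zero)
    omega
  have hlim := ENNReal.tendsto_ofReal (tendsto_integral_norm_charFun_pow ρ hdeg hk)
  rw [ENNReal.ofReal_zero] at hlim
  refine tendsto_of_tendsto_of_tendsto_of_le_of_le' tendsto_const_nhds hlim
    (Eventually.of_forall fun _ => zero_le) ?_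
  filter_upwards [eventually_ge_atTop 1] with n hn
  have hn0 : ((n - n / 2 : ℕ) : ℝ) ≠ 0 := by
    have : 0 < n - n / 2 := by omega
    positivity
  set A : Ω → ℝ := fun ω => ∑ i ∈ Finset.Ico (n / 2) n, ⟪v, φ (U (Sum.inl i) ω)⟫ with hA
  set B : Ω → ℝ := fun ω => -((n - n / 2 : ℕ) : ℝ) *
    ⟪v, ((m n - m n / 2 : ℕ) : ℝ)⁻¹ • ∑ j ∈ Finset.Ico (m n / 2) (m n), φ (U (Sum.inr j) ω)⟫ with hB
  have hAm : Measurable[⨆ s ∈ Set.range Sum.inl, MeasurableSpace.comap (U s) inferInstance] A :=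
    Finset.measurable_sum _ fun i _ => hpr.comp (measurable_iSup_comap U (Set.mem_range_self i))
  have hBm : Measurable[⨆ s ∈ Set.range Sum.inr, MeasurableSpace.comap (U s) inferInstance] B :=
    ((measurable_const (a := v)).inner ((Finset.measurable_sum _ fun j _ =>
      hφ.comp (measurable_iSup_comap U (Set.mem_range_self j))).const_smul _)).const_mul _
  have hle : ∀ S : Set (ℕ ⊕ ℕ), ⨆ s ∈ S, MeasurableSpace.comap (U s) inferInstance
      ≤ (inferInstance : MeasurableSpace Ω) := fun S => iSup₂_le fun s _ => (mU s).comap_le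
  have hind : IndepFun A B μ := indepFun_of_measurable_iSup hU mU
    Set.isCompl_range_inl_range_inr.disjoint hAm hBm
  have mA : Measurable A := hAm.mono (hle _) le_rfl
  have mB : Measurable B := hBm.mono (hle _) le_rfl
  have mAB : Measurable fun ω => A ω + B ω := mA.add mB
  have hset : {ω | ⟪v, diffMean2 φ (fun i => U (Sum.inl i) ω)
      (fun j => U (Sum.inr j) ω) n (m n)⟫ = 0} = (fun ω => A ω + B ω) ⁻¹' {0} := by
    ext ω
    have hAB : A ω + B ω = ((n - n / 2 : ℕ) : ℝ) * ⟪v, diffMean2 φ (fun i => U (Sum.inl i) ω)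
      (fun j => U (Sum.inr j) ω) n (m n)⟫ := by
      simp only [hA, hB, diffMean2, inner_sub_right, inner_smul_right, inner_sum]
      rw [mul_sub, mul_inv_cancel_left₀ hn0]
      ring
    simp only [Set.mem_ofPred_eq, Set.mem_preimage, Set.mem_singleton_iff, hAB, mul_eq_zero, hn0,
      false_or]
  have hcA : charFun (μ.map A) = charFun ρ ^ (n - n / 2) := by
    have hind' : iIndepFun (fun (i : ℕ) ω => ⟪v, φ (U (Sum.inl i) ω)⟫) μ :=
      (hU.precomp Sum.inl_injective).comp (fun _ x => ⟪v, φ x⟫) fun _ => hpr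
    rw [hA, iIndepFun.charFun_map_fun_finsetSum_eq_prod
      (X := fun i ω => ⟪v, φ (U (Sum.inl i) ω)⟫)
      (fun i _ => (hpr.comp (mU (Sum.inl i))).aemeasurable) (hind'.restrict _)]
    have : ∀ i, μ.map (fun ω => ⟪v, φ (U (Sum.inl i) ω)⟫) = ρ := fun i => by
      rw [hρ, ← hX i, Measure.map_map hpr (mU _)]
      rfl
    simp [this]
  have : IsProbabilityMeasure (μ.map fun ω => A ω + B ω) :=
    Measure.isProbabilityMeasure_map mAB.aemeasurable
  have : IsProbabilityMeasure (μ.map B) := Measure.isProbabilityMeasure_map mB.aemeasurable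
  rw [hset, ← Measure.map_apply mAB (measurableSet_singleton 0), ← ofReal_measureReal]
  refine ENNReal.ofReal_le_ofReal
    ((measureReal_singleton_zero_le_integral_norm_charFun _).trans ?_)
  rw [hind.charFun_map_fun_add_eq_mul mA.aemeasurable mB.aemeasurable, hcA]
  refine integral_mono_of_nonneg (ae_of_all _ fun t => norm_nonneg _) ?_ (ae_of_all _ fun t => ?_)
  · refine Integrable.of_bound (C := 1)
      (measurable_charFun.norm.pow_const _).aestronglyMeasurable (ae_of_all _ fun t => ?_)
    rw [norm_pow, norm_norm]
    exact pow_le_one₀ (norm_nonneg _) (norm_charFun_le_one t)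
  · simp only [Pi.mul_apply, Pi.pow_apply, norm_mul, norm_pow]
    exact mul_le_of_le_one_right (by positivity) (norm_charFun_le_one t)

theorem tendsto_measure_inner_sub_diffMean2_eq_zero (hφ : Measurable φ) (hU : iIndepFun U μ)
    (mU : ∀ s, Measurable (U s)) (hX : ∀ i, μ.map (U (Sum.inl i)) = P) (i j : ℕ) :
    Tendsto (fun n => μ {ω | φ (U (Sum.inl i) ω) - φ (U (Sum.inl j) ω) ∉ degenerateDirections φ P ∧
      ⟪φ (U (Sum.inl i) ω) - φ (U (Sum.inl j) ω), diffMean2 φ (fun i => U (Sum.inl i) ω)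
        (fun j => U (Sum.inr j) ω) n (m n)⟫ = 0}) atTop (𝓝 0) := by
  set D : Ω → H := fun ω => φ (U (Sum.inl i) ω) - φ (U (Sum.inl j) ω) with hD
  set h : ℕ → Ω → H := fun n ω => diffMean2 φ (fun i => U (Sum.inl i) ω)
    (fun j => U (Sum.inr j) ω) n (m n) with hh
  have mD : Measurable D := (hφ.comp (mU _)).sub (hφ.comp (mU _))
  have mh : ∀ n, Measurable (h n) := fun n => measurable_diffMean2_of_measurable hφ mU n (m n)
  set S : Set (H × H) := {r | r.1 ∉ degenerateDirections φ P ∧ ⟪r.1, r.2⟫ = 0} with hS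
  have mS : MeasurableSet S :=
    (measurable_fst (measurableSet_degenerateDirections hφ P).compl).inter
      (measurableSet_eq_fun (measurable_fst.inner measurable_snd) measurable_const)
  have : IsProbabilityMeasure (μ.map D) := Measure.isProbabilityMeasure_map mD.aemeasurable
  have hlim : Tendsto (fun n => ∫⁻ v, μ.map (h n) (Prod.mk v ⁻¹' S) ∂(μ.map D)) atTop
      (𝓝 (∫⁻ _, 0 ∂(μ.map D))) := by
    refine tendsto_lintegral_of_dominated_convergence (fun _ => 1)
      (fun n => measurable_measure_prodMk_left mS) (fun n => ae_of_all _ fun v => ?_)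
      (by simp) (ae_of_all _ fun v => ?_)
    · have : IsProbabilityMeasure (μ.map (h n)) :=
        Measure.isProbabilityMeasure_map (mh n).aemeasurable
      exact prob_le_one
    · by_cases hv : v ∈ degenerateDirections φ P
      · have : Prod.mk v ⁻¹' S = ∅ := by
          ext g
          simp [hS, hv]
        simp [this]
      · refine (tendsto_measure_inner_diffMean2_eq_zero (m := m) hφ hU mU hX hv).congr fun n => ?_
        rw [Measure.map_apply (mh n) (measurable_prodMk_left mS)]
        congr 1
        ext ω
        simp [hS, hv, hh]
  rw [lintegral_zero] at hlim
  refine hlim.congr' ?_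
  filter_upwards [eventually_ge_atTop (2 * (i + j + 1))] with n hn
  have hind : IndepFun D (h n) μ := by
    refine indepFun_of_measurable_iSup hU mU (S := {Sum.inl i, Sum.inl j})
      (T := {Sum.inl i, Sum.inl j}ᶜ) disjoint_compl_right ?_ ?_
    · exact (hφ.comp (measurable_iSup_comap U (by simp))).sub
        (hφ.comp (measurable_iSup_comap U (by simp)))
    · refine measurable_diffMean2 hφ (fun l hl => ?_) (by simp)
      have := (Finset.mem_Ico.1 hl).1
      simp only [Set.mem_compl_iff, Set.mem_insert_iff, Sum.inl.injEq, Set.mem_singleton_iff]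
      omega
  rw [← Measure.prod_apply mS, ← (indepFun_iff_map_prod_eq_prod_map_map mD.aemeasurable
    (mh n).aemeasurable).1 hind, Measure.map_apply (mD.prodMk (mh n)) mS]
  rfl

theorem map_prodMk_eq_prod (hU : iIndepFun U μ) (mU : ∀ s, Measurable (U s))
    (hX : ∀ i, μ.map (U (Sum.inl i)) = P) {i j : ℕ} (hij : i ≠ j) :
    μ.map (fun ω => (U (Sum.inl i) ω, U (Sum.inl j) ω)) = P.prod P := by
  rw [(indepFun_iff_map_prod_eq_prod_map_map (mU _).aemeasurable (mU _).aemeasurable).1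
    (hU.indepFun (Sum.inl_injective.ne hij)), hX, hX]

/-- Almost surely, some difference of consecutive features is a nondegenerate direction. -/
theorem ae_exists_notMem_degenerateDirections (hφ : Measurable φ) (hU : iIndepFun U μ)
    (mU : ∀ s, Measurable (U s)) (hX : ∀ i, μ.map (U (Sum.inl i)) = P)
    (hP : ¬ ∀ᵐ p ∂P.prod P, φ p.1 - φ p.2 ∈ degenerateDirections φ P) :
    ∀ᵐ ω ∂μ, ∃ k : ℕ, φ (U (Sum.inl (2 * k)) ω) - φ (U (Sum.inl (2 * k + 1)) ω)
      ∉ degenerateDirections φ P := by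
  set M : Set (𝒳 × 𝒳) := {p | φ p.1 - φ p.2 ∈ degenerateDirections φ P} with hM
  have mM : MeasurableSet M := ((hφ.comp measurable_fst).sub (hφ.comp measurable_snd))
    (measurableSet_degenerateDirections hφ P)
  set Z : ℕ → Ω → 𝒳 × 𝒳 := fun k ω => (U (Sum.inl (2 * k)) ω, U (Sum.inl (2 * k + 1)) ω) with hZ
  have mZ : ∀ k, Measurable (Z k) := fun k => (mU _).prodMk (mU _)
  have lZ : ∀ k, μ.map (Z k) = P.prod P := fun k => map_prodMk_eq_prod hU mU hX (by omega)
  have mI : Measurable (M.indicator fun _ => (1 : ℝ)) := measurable_const.indicator mM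
  have hslln := strong_law_ae_real (μ := μ) (fun k ω => M.indicator (fun _ => (1 : ℝ)) (Z k ω))
    ?_ ?_ ?_
  · have hmean : ∫ ω, M.indicator (fun _ => (1 : ℝ)) (Z 0 ω) ∂μ = (P.prod P).real M := by
      rw [← integral_map (mZ 0).aemeasurable mI.aestronglyMeasurable, lZ,
        integral_indicator_const _ mM, smul_eq_mul, mul_one]
    rw [hmean] at hslln
    filter_upwards [hslln] with ω hω
    by_contra! hall
    have h1 : ∀ k, M.indicator (fun _ => (1 : ℝ)) (Z k ω) = 1 := fun k =>
      Set.indicator_of_mem (show Z k ω ∈ M from hall k) _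
    simp only [h1, Finset.sum_const, Finset.card_range, nsmul_eq_mul, mul_one] at hω
    have hone : (P.prod P).real M = 1 := by
      refine tendsto_nhds_unique hω (tendsto_const_nhds.congr' ?_)
      filter_upwards [eventually_gt_atTop 0] with n hn
      rw [div_self (by positivity)]
    refine hP ((prob_compl_eq_zero_iff mM).2 ?_)
    rwa [measureReal_def, ENNReal.toReal_eq_one_iff] at hone
  · exact Integrable.of_bound (mI.comp (mZ 0)).aestronglyMeasurable 1
      (ae_of_all _ fun ω => by by_cases h : Z 0 ω ∈ M <;> simp [h])
  · intro k l hkl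
    refine IndepFun.comp (hU.indepFun_prodMk_prodMk mU _ _ _ _ ?_ ?_ ?_ ?_) mI mI <;>
    · simp only [ne_eq, Sum.inl.injEq]
      omega
  · intro k
    exact (IdentDistrib.mk (mZ k).aemeasurable (mZ 0).aemeasurable (by rw [lZ, lZ])).comp mI

/-- The variance estimate is nonzero with probability tending to one. -/
theorem tendsto_measure_sigmaHat2_eq_zero (hφ : Measurable φ) (hU : iIndepFun U μ)
    (mU : ∀ s, Measurable (U s)) (hX : ∀ i, μ.map (U (Sum.inl i)) = P)
    (hP : ¬ ∀ᵐ p ∂P.prod P, φ p.1 - φ p.2 ∈ degenerateDirections φ P) :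
    Tendsto (fun n => μ {ω | sigmaHat2 φ (truncate (fun i => U (Sum.inl i) ω)
      (fun j => U (Sum.inr j) ω) n (m n)) = 0}) atTop (𝓝 0) := by
  set D : ℕ → Ω → H := fun k ω => φ (U (Sum.inl (2 * k)) ω) - φ (U (Sum.inl (2 * k + 1)) ω) with hD
  set G : ℕ → Set Ω := fun K => {ω | ∀ k < K, D k ω ∈ degenerateDirections φ P} with hG
  set N : ℕ → ℕ → Set Ω := fun k n => {ω | D k ω ∉ degenerateDirections φ P ∧
      ⟪D k ω, diffMean2 φ (fun i => U (Sum.inl i) ω) (fun j => U (Sum.inr j) ω) n (m n)⟫ = 0}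
    with hN
  have mD : ∀ k, Measurable (D k) := fun k => (hφ.comp (mU _)).sub (hφ.comp (mU _))
  have hGlim : Tendsto (fun K => μ (G K)) atTop (𝓝 0) := by
    rw [← measure_empty (μ := μ)]
    refine tendsto_measure_of_ae_tendsto_indicator_of_isFiniteMeasure atTop MeasurableSet.empty
      (fun K => ?_) ?_
    · simp only [hG, Set.ofPred_forall]
      exact MeasurableSet.iInter fun k => MeasurableSet.iInter fun _ =>
        mD k (measurableSet_degenerateDirections hφ P)
    · filter_upwards [ae_exists_notMem_degenerateDirections hφ hU mU hX hP] with ω hω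
      obtain ⟨k, hk⟩ := hω
      filter_upwards [eventually_gt_atTop k] with K hK
      simp only [hG, Set.mem_ofPred_eq, Set.mem_empty_iff_false, iff_false]
      exact fun h => hk (h k hK)
  rw [ENNReal.tendsto_nhds_zero]
  intro ε hε
  have hε2 : 0 < ε / 2 := ENNReal.half_pos hε.ne'
  obtain ⟨K, hK⟩ := (ENNReal.tendsto_nhds_zero.1 hGlim (ε / 2) hε2).exists
  have hsum : Tendsto (fun n => ∑ k ∈ Finset.range K, μ (N k n)) atTop (𝓝 0) := by
    simpa using tendsto_finsetSum (Finset.range K) fun k _ =>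
      tendsto_measure_inner_sub_diffMean2_eq_zero (m := m) hφ hU mU hX (2 * k) (2 * k + 1)
  filter_upwards [ENNReal.tendsto_nhds_zero.1 hsum (ε / 2) hε2, eventually_ge_atTop (4 * K + 4)]
    with n hn hnK
  calc μ {ω | sigmaHat2 φ (truncate (fun i => U (Sum.inl i) ω)
      (fun j => U (Sum.inr j) ω) n (m n)) = 0} ≤ μ (G K ∪ ⋃ k ∈ Finset.range K, N k n) := by
        refine measure_mono fun ω hω => ?_
        by_cases hg : ω ∈ G K
        · exact Or.inl hg
        · simp only [hG, Set.mem_ofPred_eq, not_forall] at hg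
          obtain ⟨k, hk, hkN⟩ := hg
          refine Or.inr (Set.mem_biUnion (Finset.mem_coe.2 (Finset.mem_range.2 hk)) ⟨hkN, ?_⟩)
          exact inner_sub_eq_zero_of_sigmaHat2_truncate_eq_zero hω (by omega) (by omega)
    _ ≤ μ (G K) + ∑ k ∈ Finset.range K, μ (N k n) :=
        (measure_union_le _ _).trans (by gcongr; exact measure_biUnion_finset_le _ _)
    _ ≤ ε / 2 + ε / 2 := add_le_add hK hn
    _ = ε := ENNReal.add_halves ε

end Degeneracy

section Consistency

set_option linter.unusedSectionVars false

variable [MeasurableSpace H] [BorelSpace H] [SecondCountableTopology H]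

theorem measurable_sigmaHat2 {φ : 𝒳 → H} (hφ : Measurable φ) (n k : ℕ) :
    Measurable (sigmaHat2 φ (n := n) (m := k)) := by
  unfold sigmaHat2 sigmaHatX2 sigmaHatY2 UX UY empMean2
  fun_prop

theorem measurable_studentized {φ : 𝒳 → H} (hφ : Measurable φ) (n k : ℕ) :
    Measurable (studentized φ (n := n) (m := k)) := by
  have h : Measurable (xMMD2 φ (n := n) (m := k)) := by
    unfold xMMD2 empMean1 empMean2
    fun_prop
  exact h.div (measurable_sigmaHat2 hφ n k).sqrt

variable {φ : 𝒳 → H} {P Q : Measure 𝒳} [IsProbabilityMeasure P] [IsProbabilityMeasure Q]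
  {Ω : Type*} [MeasurableSpace Ω] {μ : Measure Ω} [IsProbabilityMeasure μ]
  {U : ℕ ⊕ ℕ → Ω → 𝒳}

theorem measurable_truncate (mU : ∀ s, Measurable (U s)) (n k : ℕ) :
    Measurable fun ω => truncate (fun i => U (Sum.inl i) ω) (fun j => U (Sum.inr j) ω) n k :=
  (measurable_pi_lambda _ fun _ => mU _).prodMk (measurable_pi_lambda _ fun _ => mU _)

theorem map_truncate (hU : iIndepFun U μ) (mU : ∀ s, Measurable (U s))
    (hX : ∀ i, μ.map (U (Sum.inl i)) = P) (hY : ∀ j, μ.map (U (Sum.inr j)) = Q) (n k : ℕ) :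
    μ.map (fun ω => truncate (fun i => U (Sum.inl i) ω) (fun j => U (Sum.inr j) ω) n k)
      = sampleMeasure P Q n k := by
  have hind : IndepFun (fun ω (i : Fin n) => U (Sum.inl (i : ℕ)) ω)
      (fun ω (j : Fin k) => U (Sum.inr (j : ℕ)) ω) μ := by
    refine indepFun_of_measurable_iSup hU mU Set.isCompl_range_inl_range_inr.disjoint ?_ ?_
    · exact @measurable_pi_lambda _ _ _ (_) _ _ fun i => measurable_iSup_comap U (Set.mem_range_self _)
    · exact @measurable_pi_lambda _ _ _ (_) _ _ fun i => measurable_iSup_comap U (Set.mem_range_self _)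
  have h1 := (iIndepFun_iff_map_fun_eq_pi_map fun _ => (mU _).aemeasurable).1
    (hU.precomp (g := fun i : Fin n => Sum.inl (i : ℕ))
      (Sum.inl_injective.comp Fin.val_injective))
  have h2 := (iIndepFun_iff_map_fun_eq_pi_map fun _ => (mU _).aemeasurable).1
    (hU.precomp (g := fun i : Fin k => Sum.inr (i : ℕ))
      (Sum.inr_injective.comp Fin.val_injective))
  unfold truncate
  rw [(indepFun_iff_map_prod_eq_prod_map_map
    (measurable_pi_lambda _ fun _ => mU _).aemeasurable
    (measurable_pi_lambda _ fun _ => mU _).aemeasurable).1 hind, h1, h2]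
  simp only [hX, hY, sampleMeasure]

/-- The strong law for the features, and for their norms, of an i.i.d. sequence. -/
theorem ae_tendsto_average (hφ : Measurable φ) (hint : Integrable φ P) {X : ℕ → Ω → 𝒳}
    (hind : iIndepFun X μ) (mX : ∀ i, Measurable (X i)) (hX : ∀ i, μ.map (X i) = P) :
    ∀ᵐ ω ∂μ,
      Tendsto (fun n : ℕ => (n : ℝ)⁻¹ • ∑ i ∈ Finset.range n, φ (X i ω)) atTop
        (𝓝 (meanEmb φ P)) ∧
      Tendsto (fun n : ℕ => (n : ℝ)⁻¹ * ∑ i ∈ Finset.range n, ‖φ (X i ω)‖) atTop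
        (𝓝 (∫ x, ‖φ x‖ ∂P)) := by
  have hid : ∀ i, IdentDistrib (X i) (X 0) μ μ := fun i =>
    ⟨(mX i).aemeasurable, (mX 0).aemeasurable, by rw [hX, hX]⟩
  have hint0 : Integrable (fun ω => φ (X 0 ω)) μ := by
    have h := hint
    rw [← hX 0] at h
    exact h.comp_measurable (mX 0)
  have h1 := strong_law_ae (μ := μ) (fun i ω => φ (X i ω)) hint0
    (fun i j hij => (hind.indepFun hij).comp hφ hφ) fun i => (hid i).comp hφ
  have h2 := strong_law_ae (μ := μ) (fun i ω => ‖φ (X i ω)‖) hint0.norm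
    (fun i j hij => (hind.indepFun hij).comp hφ.norm hφ.norm) fun i => (hid i).comp hφ.norm
  rw [← integral_map (mX 0).aemeasurable hφ.aestronglyMeasurable, hX] at h1
  rw [← integral_map (mX 0).aemeasurable hφ.norm.aestronglyMeasurable, hX] at h2
  filter_upwards [h1, h2] with ω hω1 hω2
  exact ⟨hω1, hω2⟩

end Consistency

/-- **Theorem (consistency against a fixed alternative).**
If `P ≠ Q` are fixed, the kernel is characteristic, and the centered kernels of `P` and of
`Q` have positive finite fourth moments, then for every `α ∈ (0,1)` the power of the
xMMD test tends to `1`: `P(x̄MMD² ≥ z_{1−α}) → 1`. -/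
theorem crossMMD_test_consistent_fixed_alternative
    [MeasurableSpace H] [BorelSpace H] [SecondCountableTopology H]
    (φ : 𝒳 → H) (hφ : Measurable φ)
    (P Q : Measure 𝒳) [IsProbabilityMeasure P] [IsProbabilityMeasure Q]
    (hPQ : P ≠ Q)
    (hPint : Integrable φ P) (hQint : Integrable φ Q)
    (m : ℕ → ℕ) (hm_mono : Monotone m) (hm_top : Tendsto m atTop atTop)
    (hchar : ∀ R S : Measure 𝒳, IsProbabilityMeasure R → IsProbabilityMeasure S →
      Integrable φ R → Integrable φ S → meanEmb φ R = meanEmb φ S → R = S)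
    (hP4_pos : 0 < ∫ x, ∫ y, kbar φ P x y ^ 4 ∂P ∂P)
    (hP4_fin : Integrable (fun p : 𝒳 × 𝒳 => kbar φ P p.1 p.2 ^ 4) (P.prod P))
    (hQ4_pos : 0 < ∫ x, ∫ y, kbar φ Q x y ^ 4 ∂Q ∂Q)
    (hQ4_fin : Integrable (fun p : 𝒳 × 𝒳 => kbar φ Q p.1 p.2 ^ 4) (Q.prod Q))
    (α : ℝ) (hα : α ∈ Set.Ioo (0 : ℝ) 1)
    (z : ℝ) (hz : stdGaussianCDF z = 1 - α) :
    Tendsto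
      (fun n : ℕ =>
        ((sampleMeasure P Q n (m n)) {ω | z ≤ studentized φ ω}).toReal)
      atTop (𝓝 1) := by
  have hmean : meanEmb φ P ≠ meanEmb φ Q := fun h =>
    hPQ (hchar P Q inferInstance inferInstance hPint hQint h)
  have hdeg : ¬ ∀ᵐ p ∂P.prod P, φ p.1 - φ p.2 ∈ degenerateDirections φ P := by
    intro h
    refine hP4_pos.ne' (integral_eq_zero_of_ae ?_)
    filter_upwards [ae_kbar_eq_zero hφ P hPint h] with x hx
    refine integral_eq_zero_of_ae ?_
    filter_upwards [hx] with y hy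
    simp [hy]
  have : ∀ s : ℕ ⊕ ℕ, IsProbabilityMeasure (Sum.elim (fun _ => P) (fun _ => Q) s) := by
    rintro (i | j) <;> assumption
  obtain ⟨Ω, _, μ, U, mU, lU, hU, _⟩ :=
    exists_hasLaw_indepFun (fun _ : ℕ ⊕ ℕ => 𝒳) (Sum.elim (fun _ => P) (fun _ => Q))
  have hX : ∀ i, μ.map (U (Sum.inl i)) = P := fun i => (lU (Sum.inl i)).map_eq
  have hY : ∀ j, μ.map (U (Sum.inr j)) = Q := fun j => (lU (Sum.inr j)).map_eq
  set T : (n : ℕ) → Ω → (Fin n → 𝒳) × (Fin (m n) → 𝒳) := fun n ω =>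
    truncate (fun i => U (Sum.inl i) ω) (fun j => U (Sum.inr j) ω) n (m n) with hT
  have mT : ∀ n, Measurable (T n) := fun n => measurable_truncate mU n (m n)
  have mσ : ∀ n, Measurable fun ω => sigmaHat2 φ (T n ω) := fun n =>
    (measurable_sigmaHat2 hφ n (m n)).comp (mT n)
  have ms : ∀ n, MeasurableSet {ω | z ≤ studentized φ (T n ω)} := fun n =>
    measurableSet_le measurable_const ((measurable_studentized hφ n (m n)).comp (mT n))
  have mz : ∀ n, MeasurableSet {ω | sigmaHat2 φ (T n ω) = 0} := fun n =>
    measurableSet_eq_fun (mσ n) measurable_const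
  have hunion : Tendsto
      (fun n => μ ({ω | sigmaHat2 φ (T n ω) = 0} ∪ {ω | z ≤ studentized φ (T n ω)})) atTop
      (𝓝 1) := by
    rw [← measure_univ (μ := μ)]
    refine tendsto_measure_of_ae_tendsto_indicator_of_isFiniteMeasure atTop MeasurableSet.univ
      (fun n => (mz n).union (ms n)) ?_
    filter_upwards [ae_tendsto_average hφ hPint (hU.precomp Sum.inl_injective) (fun _ => mU _) hX,
      ae_tendsto_average hφ hQint (hU.precomp Sum.inr_injective) (fun _ => mU _) hY] with ω hωX hωY
    filter_upwards [eventually_le_studentized_truncate hmean z hωX.1 hωY.1 hωX.2 hωY.2 hm_top]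
      with n hn
    simp only [Set.mem_univ, iff_true]
    exact or_iff_not_imp_left.2 hn
  have hzero : Tendsto (fun n => μ {ω | sigmaHat2 φ (T n ω) = 0}) atTop (𝓝 0) :=
    tendsto_measure_sigmaHat2_eq_zero hφ hU mU hX hdeg
  have hlow := ENNReal.Tendsto.sub hunion hzero (Or.inl ENNReal.one_ne_top)
  rw [tsub_zero] at hlow
  have hlim : Tendsto (fun n => μ {ω | z ≤ studentized φ (T n ω)}) atTop (𝓝 1) := by
    refine tendsto_of_tendsto_of_tendsto_of_le_of_le hlow tendsto_const_nhds (fun n => ?_)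
      fun n => prob_le_one
    rw [tsub_le_iff_left]
    exact measure_union_le _ _
  refine ((ENNReal.tendsto_toReal ENNReal.one_ne_top).comp hlim).congr fun n => ?_
  rw [Function.comp, ← map_truncate hU mU hX hY n (m n), Measure.map_apply (mT n)
    (measurableSet_le measurable_const (measurable_studentized hφ n (m n)))]
  rfl

end CrossMMD
end
end

section
/- Studentized CLT for triangular arrays under a fourth-moment condition: For each n, let W_{1,n},…,W_{n,n} be i.i.d. real random variables with E[W_{1,n}] = 0 and 0 < E[W_{1,n}²] < ∞. If lim_{n→∞} E[W_{1,n}⁴]/(n·E[W_{1,n}²]²) = 0, then the studentized sum V_n = (Σ_{i=1}^n W_{i,n}) / √(Σ_{i=1}^n (W_{i,n} − W̄_n)²), where W̄_n = n⁻¹ Σ_{i=1}^n W_{i,n}, converges in distribution to N(0,1). -/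
open MeasureTheory ProbabilityTheory Filter
open scoped ENNReal NNReal Topology

noncomputable section

/-- The standard normal cumulative distribution function `Φ`. -/
def stdGaussianCDF (x : ℝ) : ℝ := (gaussianReal 0 1 (Set.Iic x)).toReal

/-- The standard normal cumulative distribution function is continuous. -/
lemma continuous_stdGaussianCDF : Continuous stdGaussianCDF := by
  have := nullSingletonClass_gaussianReal (μ := 0) (v := 1) one_ne_zero
  refine continuous_iff_continuousAt.2 fun x ↦ ?_
  have h := IntegrableOn.continuousOn_Iic_primitive_Iic (μ := gaussianReal 0 1) (f := fun _ ↦ (1 : ℝ))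
    (a₀ := x + 1) (integrable_const _).integrableOn
  refine (h.continuousAt (Iic_mem_nhds (by linarith))).congr (.of_forall fun y ↦ ?_)
  simp [stdGaussianCDF, measureReal_def]

/-- A Slutsky-type statement for distribution functions, allowing the probability space to vary:
if the distribution functions of `X n` converge pointwise to a continuous function and `Y n`
converges to `1` in probability, then the distribution functions of `X n / Y n` have the same
limit. -/
lemma tendsto_measureReal_div_le {Ω : ℕ → Type*} [∀ n, MeasurableSpace (Ω n)]
    (P : ∀ n, Measure (Ω n)) [∀ n, IsProbabilityMeasure (P n)] (X Y : ∀ n, Ω n → ℝ)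
    {F : ℝ → ℝ} (hF : Continuous F)
    (hX : ∀ s, Tendsto (fun n ↦ (P n).real {ω | X n ω ≤ s}) atTop (𝓝 (F s)))
    (hY : ∀ δ > 0, Tendsto (fun n ↦ (P n).real {ω | δ ≤ |Y n ω - 1|}) atTop (𝓝 0)) (t : ℝ) :
    Tendsto (fun n ↦ (P n).real {ω | X n ω / Y n ω ≤ t}) atTop (𝓝 (F t)) := by
  have near {δ : ℝ} (hδ : δ ≤ 1) {y : ℝ} (hy : ¬ δ ≤ |y - 1|) :
      0 < y ∧ t - |t| * δ ≤ t * y ∧ t * y ≤ t + |t| * δ := by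
    rw [not_le] at hy
    have h1 := abs_lt.1 hy
    have h2 : |t * (y - 1)| ≤ |t| * δ := by
      rw [abs_mul]
      exact mul_le_mul_of_nonneg_left hy.le (abs_nonneg t)
    have h3 := abs_le.1 h2
    exact ⟨by linarith, by linarith, by linarith⟩
  have upper {δ : ℝ} (hδ : δ ≤ 1) (n : ℕ) : (P n).real {ω | X n ω / Y n ω ≤ t} ≤
      (P n).real {ω | X n ω ≤ t + |t| * δ} + (P n).real {ω | δ ≤ |Y n ω - 1|} := by
    refine (measureReal_mono fun ω hω ↦ ?_).trans (measureReal_union_le _ _)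
    by_cases hy : δ ≤ |Y n ω - 1|
    · exact Or.inr hy
    · obtain ⟨hpos, -, hle⟩ := near hδ hy
      exact Or.inl (((div_le_iff₀ hpos).1 hω).trans hle)
  have lower {δ : ℝ} (hδ : δ ≤ 1) (n : ℕ) : (P n).real {ω | X n ω ≤ t - |t| * δ} -
      (P n).real {ω | δ ≤ |Y n ω - 1|} ≤ (P n).real {ω | X n ω / Y n ω ≤ t} := by
    rw [sub_le_iff_le_add]
    refine (measureReal_mono fun ω hω ↦ ?_).trans (measureReal_union_le _ _)
    by_cases hy : δ ≤ |Y n ω - 1|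
    · exact Or.inr hy
    · obtain ⟨hpos, hle, -⟩ := near hδ hy
      exact Or.inl ((div_le_iff₀ hpos).2 (le_trans hω hle))
  have small : ∀ᶠ δ : ℝ in 𝓝[>] 0, 0 < δ ∧ δ ≤ 1 := by
    filter_upwards [Ioc_mem_nhdsGT (zero_lt_one' ℝ)] with δ hδ using hδ
  refine tendsto_order.2 ⟨fun a ha ↦ ?_, fun a ha ↦ ?_⟩
  · have hlim : Tendsto (fun δ ↦ F (t - |t| * δ)) (𝓝[>] 0) (𝓝 (F t)) := by
      have : Continuous fun δ ↦ F (t - |t| * δ) := by fun_prop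
      simpa using (this.tendsto 0).mono_left nhdsWithin_le_nhds
    obtain ⟨δ, hδ, hδ0, hδ1⟩ := ((hlim.eventually_const_lt ha).and small).exists
    have := (hX (t - |t| * δ)).sub (hY δ hδ0)
    rw [sub_zero] at this
    filter_upwards [this.eventually_const_lt hδ] with n hn using hn.trans_le (lower hδ1 n)
  · have hlim : Tendsto (fun δ ↦ F (t + |t| * δ)) (𝓝[>] 0) (𝓝 (F t)) := by
      have : Continuous fun δ ↦ F (t + |t| * δ) := by fun_prop
      simpa using (this.tendsto 0).mono_left nhdsWithin_le_nhds
    obtain ⟨δ, hδ, hδ0, hδ1⟩ := ((hlim.eventually_lt_const ha).and small).exists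
    have := (hX (t + |t| * δ)).add (hY δ hδ0)
    rw [add_zero] at this
    filter_upwards [this.eventually_lt_const hδ] with n hn using (upper hδ1 n).trans_lt hn

/-- Chebyshev's inequality for the empirical mean of `f` over an i.i.d. sample. -/
lemma measureReal_le_abs_mean_sub_le {μ : Measure ℝ} [IsProbabilityMeasure μ] {f : ℝ → ℝ}
    (hf : MemLp f 2 μ) {n : ℕ} (hn : 0 < n) {δ : ℝ} (hδ : 0 < δ) :
    (Measure.pi fun _ : Fin n ↦ μ).real
      {w | δ ≤ |(n : ℝ)⁻¹ * ∑ i, f (w i) - ∫ x, f x ∂μ|} ≤ Var[f; μ] / n / δ ^ 2 := by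
  have hn' : (0 : ℝ) < n := by exact_mod_cast hn
  set P := Measure.pi fun _ : Fin n ↦ μ
  set S : (Fin n → ℝ) → ℝ := ∑ i, fun w ↦ f (w i) with hS
  have hSL : MemLp S 2 P := memLp_finsetSum' _ fun i _ ↦
    hf.comp_measurePreserving (measurePreserving_eval (fun _ : Fin n ↦ μ) i)
  have hmean : ∫ w, S w ∂P = n * ∫ x, f x ∂μ := by
    have hint (i : Fin n) : Integrable (fun w : Fin n → ℝ ↦ f (w i)) P :=
      integrable_comp_eval (μ := fun _ : Fin n ↦ μ) (hf.integrable one_le_two)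
    simp only [hS, Finset.sum_apply]
    rw [integral_finsetSum _ fun i _ ↦ hint i]
    simp_rw [P, integral_comp_eval (μ := fun _ : Fin n ↦ μ) hf.aestronglyMeasurable]
    simp
  have hvar : Var[S; P] = n * Var[f; μ] := by
    rw [hS, variance_sum_pi (μ := fun _ : Fin n ↦ μ) (X := fun _ ↦ f) fun _ ↦ hf]
    simp
  have hset : {w | δ ≤ |(n : ℝ)⁻¹ * ∑ i, f (w i) - ∫ x, f x ∂μ|} =
      {w | n * δ ≤ |S w - ∫ w, S w ∂P|} := by
    ext w
    have : S w - n * ∫ x, f x ∂μ = n * ((n : ℝ)⁻¹ * ∑ i, f (w i) - ∫ x, f x ∂μ) := by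
      simp only [hS, Finset.sum_apply]
      field_simp
    rw [Set.mem_ofPred_eq, Set.mem_ofPred_eq, hmean, this, abs_mul, abs_of_pos hn',
      mul_le_mul_iff_right₀ hn']
  rw [hset, measureReal_def]
  refine ENNReal.toReal_le_of_le_ofReal (by have := variance_nonneg f μ; positivity)
    ((meas_ge_le_variance_div_sq hSL (mul_pos hn' hδ)).trans_eq ?_)
  rw [hvar]
  congr 1
  field_simp

/-- Cubic Taylor bound for the complex exponential on the imaginary axis. -/
lemma norm_exp_mul_I_sub_le (y : ℝ) :
    ‖Complex.exp (y * Complex.I) - (1 + y * Complex.I - (y : ℂ) ^ 2 / 2)‖ ≤ 4 * |y| ^ 3 := by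
  rcases le_or_gt |y| 1 with hy | hy
  · have h := Complex.norm_exp_sub_sum_le_norm_mul_exp (y * Complex.I) 3
    have hsum : ∑ m ∈ Finset.range 3, (y * Complex.I) ^ m / (m.factorial : ℂ) =
        1 + y * Complex.I - (y : ℂ) ^ 2 / 2 := by
      simp [Finset.sum_range_succ, mul_pow]
      ring
    have hnorm : ‖(y : ℂ) * Complex.I‖ = |y| := by simp
    rw [hsum, hnorm] at h
    have hexp : Real.exp |y| ≤ 4 :=
      (Real.exp_le_exp.2 hy).trans (by linarith [Real.exp_one_lt_three])
    calc _ ≤ |y| ^ 3 * Real.exp |y| := h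
      _ ≤ |y| ^ 3 * 4 := by gcongr
      _ = _ := mul_comm _ _
  · have h1 : ‖Complex.exp (y * Complex.I)‖ = 1 := Complex.norm_exp_ofReal_mul_I y
    have h2 : ‖1 + y * Complex.I - (y : ℂ) ^ 2 / 2‖ ≤ 1 + |y| + |y| ^ 2 / 2 := by
      refine (norm_sub_le _ _).trans (add_le_add ((norm_add_le _ _).trans ?_) ?_) <;> simp
    refine (norm_sub_le _ _).trans ?_
    have h3 : |y| ≤ |y| ^ 3 := le_self_pow₀ hy.le (by norm_num)
    have h4 : |y| ^ 2 ≤ |y| ^ 3 := pow_le_pow_right₀ hy.le (by norm_num)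
    linarith

section StandardizedLaw

variable {μ : Measure ℝ}

lemma integrable_abs_pow_three (h2 : Integrable (fun x : ℝ ↦ x ^ 2) μ)
    (h4 : Integrable (fun x : ℝ ↦ x ^ 4) μ) : Integrable (fun x : ℝ ↦ |x| ^ 3) μ := by
  refine (h2.add h4).mono' (by fun_prop) (.of_forall fun x ↦ ?_)
  rw [Real.norm_of_nonneg (by positivity), Pi.add_apply, ← sq_abs x,
    ← (show Even 4 by decide).pow_abs x]
  nlinarith [mul_nonneg (sq_nonneg |x|) (sq_nonneg (|x| - 1)), sq_nonneg |x|,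
    sq_nonneg (|x| ^ 2)]

/-- Absolute third moment bound from the second and fourth moments. -/
lemma integral_abs_pow_three_le [IsProbabilityMeasure μ] (hvar : ∫ x, x ^ 2 ∂μ = 1)
    (h2 : Integrable (fun x : ℝ ↦ x ^ 2) μ) (h4 : Integrable (fun x : ℝ ↦ x ^ 4) μ) :
    ∫ x, |x| ^ 3 ∂μ ≤ √(∫ x, x ^ 4 ∂μ) := by
  have h3 := integrable_abs_pow_three h2 h4
  set m := ∫ x, |x| ^ 3 ∂μ
  refine Real.le_sqrt_of_sq_le ?_
  have key : ∫ x, 2 * m * |x| ^ 3 ∂μ ≤ ∫ x, m ^ 2 * x ^ 2 + x ^ 4 ∂μ := by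
    refine integral_mono (h3.const_mul _) ((h2.const_mul _).add h4) fun x ↦ ?_
    simp only
    rw [← sq_abs x, ← (show Even 4 by decide).pow_abs x]
    nlinarith [mul_nonneg (sq_nonneg |x|) (sq_nonneg (|x| - m))]
  rw [integral_const_mul, integral_add (h2.const_mul _) h4, integral_const_mul, hvar] at key
  linarith [show 2 * m * m = 2 * m ^ 2 by ring]

/-- Quantitative second-order expansion of the characteristic function of a standardized law. -/
lemma norm_charFun_sub_le [IsProbabilityMeasure μ] (hmean : ∫ x, x ∂μ = 0) (hvar : ∫ x, x ^ 2 ∂μ = 1)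
    (h2 : Integrable (fun x : ℝ ↦ x ^ 2) μ) (h4 : Integrable (fun x : ℝ ↦ x ^ 4) μ) (t : ℝ) :
    ‖charFun μ t - 1 + (t : ℂ) ^ 2 / 2‖ ≤ 4 * |t| ^ 3 * √(∫ x, x ^ 4 ∂μ) := by
  have h1 : Integrable (fun x : ℝ ↦ x) μ :=
    ((memLp_two_iff_integrable_sq (by fun_prop)).2 h2).integrable one_le_two
  have h3 := integrable_abs_pow_three h2 h4
  have h1' : Integrable (fun x : ℝ ↦ (t : ℂ) * x * Complex.I) μ :=
    (h1.ofReal.const_mul _).mul_const _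
  have h01 : Integrable (fun x : ℝ ↦ 1 + (t : ℂ) * x * Complex.I) μ :=
    (integrable_const _).add h1'
  have h2' : Integrable (fun x : ℝ ↦ ((t : ℂ) * x) ^ 2 / 2) μ := by
    have := (h2.ofReal (𝕜 := ℂ)).const_mul ((t : ℂ) ^ 2 / 2)
    refine this.congr (.of_forall fun x ↦ ?_)
    simp only [Complex.coe_algebraMap]
    push_cast
    ring
  have h012 : Integrable (fun x : ℝ ↦ 1 + (t : ℂ) * x * Complex.I - ((t : ℂ) * x) ^ 2 / 2) μ :=
    h01.sub h2'
  have hexp : Integrable (fun x : ℝ ↦ Complex.exp ((t : ℂ) * x * Complex.I)) μ := by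
    refine Integrable.of_bound (by fun_prop) 1 (.of_forall fun x ↦ ?_)
    rw [← Complex.ofReal_mul, Complex.norm_exp_ofReal_mul_I]
  have hpoly : ∫ x : ℝ, (1 + (t : ℂ) * x * Complex.I - ((t : ℂ) * x) ^ 2 / 2) ∂μ =
      1 - (t : ℂ) ^ 2 / 2 := by
    rw [integral_sub h01 h2', integral_add (integrable_const _) h1']
    have e1 : ∫ x : ℝ, (t : ℂ) * x * Complex.I ∂μ = 0 := by
      rw [integral_mul_const, integral_const_mul, integral_complex_ofReal, hmean]
      simp
    have e2 : ∫ x : ℝ, ((t : ℂ) * x) ^ 2 / 2 ∂μ = (t : ℂ) ^ 2 / 2 := by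
      rw [integral_div]
      simp_rw [mul_pow]
      rw [integral_const_mul]
      simp_rw [← Complex.ofReal_pow]
      rw [integral_complex_ofReal, hvar]
      simp
    rw [e1, e2]
    simp
  have heq : charFun μ t - 1 + (t : ℂ) ^ 2 / 2 = ∫ x : ℝ, (Complex.exp ((t : ℂ) * x * Complex.I) -
      (1 + (t : ℂ) * x * Complex.I - ((t : ℂ) * x) ^ 2 / 2)) ∂μ := by
    rw [integral_sub hexp h012, hpoly, charFun_apply_real]
    ring
  rw [heq]
  calc _ ≤ ∫ x : ℝ, 4 * |t| ^ 3 * |x| ^ 3 ∂μ := by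
        refine norm_integral_le_of_norm_le (h3.const_mul _) (.of_forall fun x ↦ ?_)
        have := norm_exp_mul_I_sub_le (t * x)
        rw [abs_mul, mul_pow, ← mul_assoc] at this
        simpa only [Complex.ofReal_mul] using this
    _ = 4 * |t| ^ 3 * ∫ x, |x| ^ 3 ∂μ := integral_const_mul _ _
    _ ≤ _ := by gcongr; exact integral_abs_pow_three_le hvar h2 h4

end StandardizedLaw

section StandardizedArray

variable (ν : ℕ → Measure ℝ) [∀ n, IsProbabilityMeasure (ν n)]

/-- Central limit theorem for a row-wise i.i.d. standardized array with fourth moments `o(n)`. -/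
lemma tendsto_measureReal_normalized_sum_le (hmean : ∀ n, ∫ x, x ∂(ν n) = 0)
    (hvar : ∀ n, ∫ x, x ^ 2 ∂(ν n) = 1) (h2 : ∀ n, Integrable (fun x : ℝ ↦ x ^ 2) (ν n))
    (h4 : ∀ n, Integrable (fun x : ℝ ↦ x ^ 4) (ν n))
    (hcond : Tendsto (fun n : ℕ ↦ (∫ x, x ^ 4 ∂(ν n)) / n) atTop (𝓝 0)) (s : ℝ) :
    Tendsto (fun n : ℕ ↦ (Measure.pi fun _ : Fin n ↦ ν n).real {w | (√n)⁻¹ * ∑ i, w i ≤ s})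
      atTop (𝓝 (stdGaussianCDF s)) := by
  have hmeas (n : ℕ) : Measurable fun w : Fin n → ℝ ↦ (√n)⁻¹ * ∑ i, w i := by fun_prop
  let law (n : ℕ) : ProbabilityMeasure ℝ :=
    ⟨(Measure.pi fun _ : Fin n ↦ ν n).map fun w ↦ (√n)⁻¹ * ∑ i, w i,
      Measure.isProbabilityMeasure_map (hmeas n).aemeasurable⟩
  have hweak : Tendsto law atTop (𝓝 ⟨gaussianReal 0 1, inferInstance⟩) := by
    refine ProbabilityMeasure.tendsto_of_tendsto_charFun fun t ↦ ?_
    have hchar (n : ℕ) : charFun (law n : Measure ℝ) t =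
        (1 + (charFun (ν n) ((√n)⁻¹ * t) - 1)) ^ n := by
      simp only [law, ProbabilityMeasure.coe_mk]
      rw [charFun_map_mul_comp (by fun_prop), charFun_map_sum_pi_eq_prod]
      simp
    simp_rw [hchar, ProbabilityMeasure.coe_mk, charFun_gaussianReal]
    have hexponent : Complex.exp (t * (0 : ℝ) * Complex.I - ((1 : ℝ≥0) : ℝ) * (t : ℂ) ^ 2 / 2) =
        Complex.exp (-(t : ℂ) ^ 2 / 2) := by
      congr 1
      push_cast
      ring
    rw [hexponent]
    refine Complex.tendsto_one_add_pow_exp_of_tendsto ?_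
    rw [tendsto_iff_norm_sub_tendsto_zero]
    have hbound : Tendsto (fun n : ℕ ↦ 4 * |t| ^ 3 * √((∫ x, x ^ 4 ∂(ν n)) / n)) atTop (𝓝 0) := by
      simpa using (hcond.sqrt).const_mul (4 * |t| ^ 3)
    refine squeeze_zero' (.of_forall fun _ ↦ norm_nonneg _) ?_ hbound
    filter_upwards [eventually_gt_atTop 0] with n hn
    have hn' : (0 : ℝ) < n := by exact_mod_cast hn
    have hs : 0 < √(n : ℝ) := Real.sqrt_pos.2 hn'
    have hss : √(n : ℝ) ^ 2 = n := Real.sq_sqrt hn'.le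
    have hssC : ((√(n : ℝ) : ℝ) : ℂ) ^ 2 = n := by exact_mod_cast congrArg Complex.ofReal hss
    have heq : (n : ℂ) * (charFun (ν n) ((√n)⁻¹ * t) - 1) - -(t : ℂ) ^ 2 / 2 =
        n * (charFun (ν n) ((√n)⁻¹ * t) - 1 + (((√n)⁻¹ * t : ℝ) : ℂ) ^ 2 / 2) := by
      push_cast
      rw [mul_pow, inv_pow, hssC]
      have hnC : (n : ℂ) ≠ 0 := by exact_mod_cast hn.ne'
      field_simp
      ring
    rw [heq, norm_mul, Complex.norm_natCast]
    refine (mul_le_mul_of_nonneg_left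
      (norm_charFun_sub_le (hmean n) (hvar n) (h2 n) (h4 n) _) hn'.le).trans_eq ?_
    rw [abs_mul, abs_of_pos (inv_pos.2 hs), Real.sqrt_div' _ hn'.le]
    field_simp
    rw [hss]
  have := nullSingletonClass_gaussianReal (μ := 0) (v := 1) one_ne_zero
  have hconv := ProbabilityMeasure.tendsto_measure_of_null_frontier_of_tendsto' hweak
    (E := Set.Iic s) (by simp)
  have := (ENNReal.tendsto_toReal (measure_ne_top (gaussianReal 0 1) _)).comp hconv
  refine this.congr fun n ↦ ?_
  simp only [law, Function.comp_apply, ProbabilityMeasure.coe_mk, measureReal_def]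
  rw [Measure.map_apply (hmeas n) measurableSet_Iic]
  rfl

/-- The sample standard deviation of a standardized array with fourth moments `o(n)` converges
to `1` in probability. -/
lemma tendsto_measureReal_le_abs_sampleStd_sub_one (hmean : ∀ n, ∫ x, x ∂(ν n) = 0)
    (hvar : ∀ n, ∫ x, x ^ 2 ∂(ν n) = 1) (h2 : ∀ n, Integrable (fun x : ℝ ↦ x ^ 2) (ν n))
    (h4 : ∀ n, Integrable (fun x : ℝ ↦ x ^ 4) (ν n))
    (hcond : Tendsto (fun n : ℕ ↦ (∫ x, x ^ 4 ∂(ν n)) / n) atTop (𝓝 0)) {δ : ℝ} (hδ : 0 < δ) :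
    Tendsto (fun n : ℕ ↦ (Measure.pi fun _ : Fin n ↦ ν n).real
      {w | δ ≤ |√((n : ℝ)⁻¹ * ∑ i, (w i - (n : ℝ)⁻¹ * ∑ j, w j) ^ 2) - 1|}) atTop (𝓝 0) := by
  have hL1 (n : ℕ) : MemLp (fun x : ℝ ↦ x) 2 (ν n) :=
    (memLp_two_iff_integrable_sq (by fun_prop)).2 (h2 n)
  have hL2 (n : ℕ) : MemLp (fun x : ℝ ↦ x ^ 2) 2 (ν n) :=
    (memLp_two_iff_integrable_sq (by fun_prop)).2 ((h4 n).congr (.of_forall fun x ↦ by simp; ring))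
  have hV1 (n : ℕ) : Var[fun x : ℝ ↦ x; ν n] ≤ 1 := by
    refine (variance_le_expectation_sq (by fun_prop)).trans_eq ?_
    simpa using hvar n
  have hV2 (n : ℕ) : Var[fun x : ℝ ↦ x ^ 2; ν n] ≤ ∫ x, x ^ 4 ∂(ν n) := by
    refine (variance_le_expectation_sq (by fun_prop)).trans_eq ?_
    refine integral_congr_ae (.of_forall fun x ↦ ?_)
    simp only [Pi.pow_apply]
    ring
  obtain ⟨ε, hε, hε1, hεδ⟩ : ∃ ε : ℝ, 0 < ε ∧ ε ≤ 1 ∧ 2 * ε ≤ δ :=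
    ⟨min 1 (δ / 2), by positivity, min_le_left _ _, by linarith [min_le_right 1 (δ / 2)]⟩
  have hbound : Tendsto (fun n : ℕ ↦ (∫ x, x ^ 4 ∂(ν n)) / n / ε ^ 2 + 1 / (n : ℝ) / ε ^ 2)
      atTop (𝓝 0) := by
    simpa using (hcond.div_const (ε ^ 2)).add (tendsto_one_div_atTop_nhds_zero_nat.div_const (ε ^ 2))
  refine squeeze_zero' (.of_forall fun _ ↦ measureReal_nonneg) ?_ hbound
  filter_upwards [eventually_gt_atTop 0] with n hn
  have hn' : (0 : ℝ) < n := by exact_mod_cast hn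
  have hsub : {w : Fin n → ℝ | δ ≤ |√((n : ℝ)⁻¹ * ∑ i, (w i - (n : ℝ)⁻¹ * ∑ j, w j) ^ 2) - 1|} ⊆
      {w | ε ≤ |(n : ℝ)⁻¹ * ∑ i, w i ^ 2 - ∫ x, x ^ 2 ∂(ν n)|} ∪
      {w | ε ≤ |(n : ℝ)⁻¹ * ∑ i, w i - ∫ x, x ∂(ν n)|} := by
    intro w hw
    simp only [Set.mem_union, Set.mem_ofPred_eq, hmean, hvar, sub_zero] at hw ⊢
    by_contra! hcon
    obtain ⟨hq, hm⟩ := hcon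
    set m := (n : ℝ)⁻¹ * ∑ j, w j with hmdef
    have hsum : ∑ j, w j = n * m := by rw [hmdef]; field_simp
    have hexpand : (n : ℝ)⁻¹ * ∑ i, (w i - m) ^ 2 = (n : ℝ)⁻¹ * ∑ i, w i ^ 2 - m ^ 2 := by
      simp_rw [sub_sq, Finset.sum_add_distrib, Finset.sum_sub_distrib, ← Finset.sum_mul,
        ← Finset.mul_sum, hsum]
      simp
      field_simp
      ring
    set R := (n : ℝ)⁻¹ * ∑ i, (w i - m) ^ 2
    have hR : 0 ≤ R := by positivity
    have hmsq : m ^ 2 ≤ ε := by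
      rw [← sq_abs]
      nlinarith [abs_nonneg m]
    have hR1 : |R - 1| < δ := by
      rw [abs_lt] at hq ⊢
      constructor <;> nlinarith [sq_nonneg m]
    have hfactor : R - 1 = (√R - 1) * (√R + 1) := by
      nlinarith [Real.sq_sqrt hR]
    have hle : |√R - 1| ≤ |R - 1| := by
      rw [hfactor, abs_mul]
      refine le_mul_of_one_le_right (abs_nonneg _) ?_
      rw [abs_of_nonneg (by positivity)]
      linarith [Real.sqrt_nonneg R]
    linarith
  refine (measureReal_mono hsub).trans ((measureReal_union_le _ _).trans (add_le_add ?_ ?_))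
  · refine (measureReal_le_abs_mean_sub_le (hL2 n) hn hε).trans ?_
    gcongr
    exact hV2 n
  · refine (measureReal_le_abs_mean_sub_le (hL1 n) hn hε).trans ?_
    gcongr
    exact hV1 n

/-- The studentized central limit theorem for standardized arrays. -/
lemma tendsto_measureReal_studentized_le (hmean : ∀ n, ∫ x, x ∂(ν n) = 0)
    (hvar : ∀ n, ∫ x, x ^ 2 ∂(ν n) = 1) (h2 : ∀ n, Integrable (fun x : ℝ ↦ x ^ 2) (ν n))
    (h4 : ∀ n, Integrable (fun x : ℝ ↦ x ^ 4) (ν n))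
    (hcond : Tendsto (fun n : ℕ ↦ (∫ x, x ^ 4 ∂(ν n)) / n) atTop (𝓝 0)) (t : ℝ) :
    Tendsto (fun n : ℕ ↦ (Measure.pi fun _ : Fin n ↦ ν n).real
      {w | (∑ i, w i) / √(∑ i, (w i - (n : ℝ)⁻¹ * ∑ j, w j) ^ 2) ≤ t})
      atTop (𝓝 (stdGaussianCDF t)) := by
  have h := tendsto_measureReal_div_le (fun n ↦ Measure.pi fun _ : Fin n ↦ ν n)
    (fun n w ↦ (√n)⁻¹ * ∑ i, w i)
    (fun n w ↦ √((n : ℝ)⁻¹ * ∑ i, (w i - (n : ℝ)⁻¹ * ∑ j, w j) ^ 2)) continuous_stdGaussianCDF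
    (tendsto_measureReal_normalized_sum_le ν hmean hvar h2 h4 hcond)
    (fun δ hδ ↦ tendsto_measureReal_le_abs_sampleStd_sub_one ν hmean hvar h2 h4 hcond hδ) t
  refine h.congr' ?_
  filter_upwards [eventually_gt_atTop 0] with n hn
  have hs : (√(n : ℝ))⁻¹ ≠ 0 := inv_ne_zero (Real.sqrt_ne_zero'.2 (by exact_mod_cast hn))
  simp_rw [Real.sqrt_mul (inv_nonneg.2 (Nat.cast_nonneg n)), Real.sqrt_inv,
    mul_div_mul_left _ _ hs]

end StandardizedArray

/-- **Studentized CLT for triangular arrays under a fourth-moment condition.**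
For each `n`, let `W_{1,n},…,W_{n,n}` be i.i.d. with common law `νₙ`, mean `0` and
positive finite variance.  If `E[W⁴]/(n·E[W²]²) → 0`, then the studentized sum
`V_n = (Σ W_i)/√(Σ (W_i − W̄)²)` converges in distribution to `N(0,1)`. -/
theorem studentized_clt_triangular_array
    (ν : ℕ → Measure ℝ) [∀ n, IsProbabilityMeasure (ν n)]
    (hmean : ∀ n, ∫ x, x ∂(ν n) = 0)
    (hvar_pos : ∀ n, 0 < ∫ x, x ^ 2 ∂(ν n))
    (hvar_fin : ∀ n, Integrable (fun x : ℝ => x ^ 2) (ν n))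
    (h4_fin : ∀ n, Integrable (fun x : ℝ => x ^ 4) (ν n))
    (hcond : Filter.Tendsto
      (fun n : ℕ => (∫ x, x ^ 4 ∂(ν n)) / ((n : ℝ) * (∫ x, x ^ 2 ∂(ν n)) ^ 2))
      atTop (nhds 0)) :
    ∀ t : ℝ,
      Filter.Tendsto
        (fun n : ℕ =>
          ((Measure.pi fun _ : Fin n => ν n)
            {w : Fin n → ℝ |
              (∑ i, w i) /
                Real.sqrt (∑ i, (w i - (n : ℝ)⁻¹ * ∑ j, w j) ^ 2) ≤ t}).toReal)
        atTop (nhds (stdGaussianCDF t)) := by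
  intro t
  set σ : ℕ → ℝ := fun n ↦ √(∫ x, x ^ 2 ∂(ν n)) with hσdef
  have hσ n : 0 < σ n := Real.sqrt_pos.2 (hvar_pos n)
  have hσ2 n : σ n ^ 2 = ∫ x, x ^ 2 ∂(ν n) := Real.sq_sqrt (hvar_pos n).le
  let ρ : ℕ → Measure ℝ := fun n ↦ (ν n).map fun x ↦ (σ n)⁻¹ * x
  have hscale n : AEMeasurable (fun x ↦ (σ n)⁻¹ * x) (ν n) := by fun_prop
  have hρ n : IsProbabilityMeasure (ρ n) := Measure.isProbabilityMeasure_map (hscale n)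
  have hmoment (n k : ℕ) : ∫ x, x ^ k ∂(ρ n) = (σ n)⁻¹ ^ k * ∫ x, x ^ k ∂(ν n) := by
    simp only [ρ]
    rw [integral_map (hscale n) (by fun_prop)]
    simp_rw [mul_pow]
    exact integral_const_mul _ _
  have hintegrable (n k : ℕ) (h : Integrable (fun x : ℝ ↦ x ^ k) (ν n)) :
      Integrable (fun x : ℝ ↦ x ^ k) (ρ n) := by
    refine (integrable_map_measure (by fun_prop) (hscale n)).2 ?_
    simpa [Function.comp_def, mul_pow] using h.const_mul ((σ n)⁻¹ ^ k)
  have h := tendsto_measureReal_studentized_le ρ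
    (fun n ↦ by simpa [hmean n] using hmoment n 1)
    (fun n ↦ by
      rw [hmoment, ← hσ2, ← mul_pow, inv_mul_cancel₀ (hσ n).ne', one_pow])
    (fun n ↦ hintegrable n 2 (hvar_fin n)) (fun n ↦ hintegrable n 4 (h4_fin n))
    (hcond.congr fun n ↦ by
      have := (hσ n).ne'
      rw [hmoment, ← hσ2]
      field_simp) t
  refine h.congr fun n ↦ ?_
  have hmap : (Measure.pi fun _ : Fin n ↦ ρ n) =
      (Measure.pi fun _ : Fin n ↦ ν n).map fun w i ↦ (σ n)⁻¹ * w i :=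
    (Measure.pi_map_pi (f := fun _ x ↦ (σ n)⁻¹ * x) fun _ ↦ hscale n).symm
  rw [hmap, map_measureReal_apply (by fun_prop)
    (measurableSet_le (by fun_prop) measurable_const), measureReal_def]
  congr 2
  ext w
  simp only [Set.mem_preimage, Set.mem_ofPred_eq]
  have hsd : √(∑ i, ((σ n)⁻¹ * w i - (n : ℝ)⁻¹ * ∑ j, (σ n)⁻¹ * w j) ^ 2) =
      (σ n)⁻¹ * √(∑ i, (w i - (n : ℝ)⁻¹ * ∑ j, w j) ^ 2) := by
    have hsum : ∑ i, ((σ n)⁻¹ * w i - (n : ℝ)⁻¹ * ∑ j, (σ n)⁻¹ * w j) ^ 2 =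
        (σ n)⁻¹ ^ 2 * ∑ i, (w i - (n : ℝ)⁻¹ * ∑ j, w j) ^ 2 := by
      rw [← Finset.mul_sum _ w, Finset.mul_sum _ (fun i ↦ (w i - (n : ℝ)⁻¹ * ∑ j, w j) ^ 2)]
      refine Finset.sum_congr rfl fun i _ ↦ ?_
      ring
    rw [hsum, Real.sqrt_mul (sq_nonneg _), Real.sqrt_sq (inv_nonneg.2 (hσ n).le)]
  rw [hsd, ← Finset.mul_sum, mul_div_mul_left _ _ (inv_ne_zero (hσ n).ne')]
end
end
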